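/- Let F be a field of characteristic p > 0 and E = F(b_1^{1/p^{m_1}},…,b_r^{1/p^{m_r}}) a purely inseparable extension of exponent e with b_1,…,b_r ∈ F∖F^p and integers m_1,…,m_r ≥ 1. For n ≥ 1, the kernel H_p^{n+1}(E/F) is additively generated by: (i) the classes of b_j·s·(ds/s)∧(da_2/a_2)∧…∧(da_n/a_n) with j = 1,…,r and s, a_2,…,a_n ∈ F^*; and (ii) the classes of b_1^{k(t,1)}···b_r^{k(t,r)}·s^{p^t}·(ds/s)∧(da_2/a_2)∧…∧(da_n/a_n) with s, a_2,…,a_n ∈ F^*, t = 1,…,e−1, and 0 ≤ k(t,j) ≤ p^t − 1 with max{1, p^{t−m_j+1}} dividing k(t,j) for j = 1,…,r. For n = 0, H_p^1(E/F) = {0}. -/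

import Mathlib

noncomputable section

/-- The full algebra of absolute differential forms of a field `F`:
the exterior algebra of the `F`-module of absolute Kähler differentials `Ω[F⁄ℤ]`. -/
abbrev DF (F : Type*) [Field F] : Type _ :=
  ExteriorAlgebra F (KaehlerDifferential ℤ F)

/-- `Ω_F^n`, the space of differential `n`-forms, as a submodule of `DF F`. -/
def omegaPow (F : Type*) [Field F] (n : ℕ) : Submodule F (DF F) :=
  LinearMap.range (ExteriorAlgebra.ι F :
    KaehlerDifferential ℤ F →ₗ[F] DF F) ^ n

/-- `Ω_F^{n-1}`, with the convention `Ω_F^{-1} = 0`. -/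
def omegaPred (F : Type*) [Field F] : ℕ → Submodule F (DF F)
  | 0 => ⊥
  | n + 1 => omegaPow F n

/-- The exact 1-form `d a` of an element `a ∈ F`. -/
def dForm (F : Type*) [Field F] (a : F) : DF F :=
  ExteriorAlgebra.ι F (KaehlerDifferential.D ℤ F a)

/-- The logarithmic 1-form `da/a` of an element `a ∈ F`. -/
def dLog (F : Type*) [Field F] (a : F) : DF F :=
  ExteriorAlgebra.ι F (a⁻¹ • KaehlerDifferential.D ℤ F a)

/-- The logarithmic `n`-form `(dx₁/x₁) ∧ … ∧ (dxₙ/xₙ)`. -/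
def logForm (F : Type*) [Field F] {n : ℕ} (x : Fin n → F) : DF F :=
  (List.ofFn fun i => dLog F (x i)).prod

/-- The exterior derivative `d` together with the (`p`-basis dependent) additive map `s_p`
on the differential forms of a field `F` of characteristic `p`. -/
structure DiffStr (p : ℕ) (F : Type*) [Field F] where
  d : DF F →+ DF F
  sp : DF F →+ DF F
  d_grade : ∀ n : ℕ, ∀ ω ∈ omegaPow F n, d ω ∈ omegaPow F (n + 1)
  d_d : ∀ ω : DF F, d (d ω) = 0
  d_one : d 1 = 0
  d_smul : ∀ (a : F) (ω : DF F), d (a • ω) = dForm F a * ω + a • d ω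
  sp_grade : ∀ n : ℕ, ∀ ω ∈ omegaPow F n, sp ω ∈ omegaPow F n
  sp_log : ∀ (n : ℕ) (a : F) (x : Fin n → F),
      ∃ η ∈ omegaPred F n, sp (a • logForm F x) = a ^ p • logForm F x + d η

/-- The Artin–Schreier map `℘ = s_p − id` on differential forms. -/
def asMap {p : ℕ} {F : Type*} [Field F] (S : DiffStr p F) : DF F →+ DF F :=
  S.sp - AddMonoidHom.id (DF F)

/-- The subgroup `℘Ω_F^n + dΩ_F^{n-1}` of `Ω_F^n`; the group `H_p^{n+1}(F)` is the quotient
of `Ω_F^n` by this subgroup. -/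
def hRel {p : ℕ} {F : Type*} [Field F] (S : DiffStr p F) (n : ℕ) : AddSubgroup (DF F) :=
  ((omegaPow F n).toAddSubgroup.map (asMap S)) ⊔ ((omegaPred F n).toAddSubgroup.map S.d)

/-- The `t`-th iterate `v ↦ v^{[p^t]}` of the map `s_p`. -/
def spIter {p : ℕ} {F : Type*} [Field F] (S : DiffStr p F) (t : ℕ) : DF F → DF F :=
  (fun x => S.sp x)^[t]

/-- `ν_n(F) = ker(℘ : Ω_F^n → Ω_F^n/dΩ_F^{n-1})`. -/
def nuSet {p : ℕ} {F : Type*} [Field F] (S : DiffStr p F) (n : ℕ) : Set (DF F) :=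
  { η | η ∈ omegaPow F n ∧ ∃ z ∈ omegaPred F n, S.sp η - η = S.d z }

/-- Restriction of differential forms along a field extension `E/F`. -/
structure DiffRes (p : ℕ) (F E : Type*) [Field F] [Field E] [Algebra F E]
    (SF : DiffStr p F) (SE : DiffStr p E) where
  res : DF F →+ DF E
  res_one : res 1 = 1
  res_mul : ∀ x y : DF F, res (x * y) = res x * res y
  res_smul : ∀ (a : F) (ω : DF F), res (a • ω) = algebraMap F E a • res ω
  res_dForm : ∀ a : F, res (dForm F a) = dForm E (algebraMap F E a)
  res_grade : ∀ n : ℕ, ∀ ω ∈ omegaPow F n, res ω ∈ omegaPow E n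
  res_d : ∀ ω : DF F, res (SF.d ω) = SE.d (res ω)



section Jacobson

variable {p : ℕ} [hpF : Fact p.Prime] {R : Type*} [CommRing R] [Algebra (ZMod p) R]

/-- Leibniz rule. -/
def IsDer (D : Module.End (ZMod p) R) : Prop := ∀ a b, D (a * b) = D a * b + a * D b

lemma leibniz_pow (A B C : Module.End (ZMod p) R)
    (h : ∀ a b, A (a * b) = B a * b + a * C b) (n : ℕ) (a b : R) :
    (A ^ n) (a * b) = ∑ i ∈ Finset.range (n + 1),
      (n.choose i : R) * ((B ^ i) a * (C ^ (n - i)) b) := by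
  -- use commuting operators on the tensor square
  let μ := LinearMap.mul' (ZMod p) R
  let B' : Module.End (ZMod p) (TensorProduct (ZMod p) R R) := TensorProduct.map B 1
  let C' : Module.End (ZMod p) (TensorProduct (ZMod p) R R) := TensorProduct.map 1 C
  have hc : Commute B' C' := by
    change TensorProduct.map B 1 * TensorProduct.map 1 C = TensorProduct.map 1 C * TensorProduct.map B 1
    rw [← TensorProduct.map_mul, ← TensorProduct.map_mul]; simp
  have h1 : A ∘ₗ μ = μ ∘ₗ (B' + C') := by
    ext x y
    simp [μ, B', C', h]
  have h2 : ∀ n, (A ^ n) ∘ₗ μ = μ ∘ₗ ((B' + C') ^ n) := by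
    intro n
    induction n with
    | zero => ext; simp
    | succ k ih =>
      rw [pow_succ, pow_succ', Module.End.mul_eq_comp, LinearMap.comp_assoc, h1,
        ← LinearMap.comp_assoc, ih, ← pow_succ', pow_succ]; rfl
  have h3 := LinearMap.congr_fun (h2 n) (a ⊗ₜ[ZMod p] b)
  have hB : ∀ i, B' ^ i = TensorProduct.map (B ^ i) 1 := by
    intro i; simp only [B']; rw [TensorProduct.map_pow]; simp
  have hC : ∀ i, C' ^ i = TensorProduct.map 1 (C ^ i) := by
    intro i; simp only [C']; rw [TensorProduct.map_pow]; simp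
  rw [hc.add_pow] at h3
  simp only [LinearMap.comp_apply, LinearMap.sum_apply, map_sum] at h3
  simp only [μ, LinearMap.mul'_apply] at h3
  rw [h3]
  refine Finset.sum_congr rfl fun i _ => ?_
  have : ((B' ^ i * C' ^ (n - i) * ((n.choose i : ℕ) : Module.End (ZMod p) (TensorProduct (ZMod p) R R)) : Module.End (ZMod p) (TensorProduct (ZMod p) R R)) (a ⊗ₜ[ZMod p] b))
     = (n.choose i) • (((B ^ i) a) ⊗ₜ[ZMod p] ((C ^ (n - i)) b)) := by
    rw [hB, hC, ← nsmul_eq_mul', LinearMap.smul_apply]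
    simp
  rw [this, map_nsmul, LinearMap.mul'_apply, nsmul_eq_mul]

lemma leibniz_pow_p (A B C : Module.End (ZMod p) R)
    (h : ∀ a b, A (a * b) = B a * b + a * C b) (a b : R) :
    (A ^ p) (a * b) = (B ^ p) a * b + a * (C ^ p) b := by
  rw [leibniz_pow A B C h p a b, Finset.sum_range_succ]
  have hp := hpF.out
  obtain ⟨k, hk⟩ : ∃ k, p = k + 1 := ⟨p - 1, by have := hp.pos; omega⟩
  rw [show Finset.range p = Finset.range (k+1) by rw [hk], Finset.sum_range_succ']
  have hz : ∀ i ∈ Finset.range k, ((p.choose (i + 1) : ℕ) : R) * ((B ^ (i+1)) a * (C ^ (p - (i+1))) b) = 0 := by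
    intro i hi
    have hd : p ∣ p.choose (i+1) := hp.dvd_choose_self (by omega) (by
      have := Finset.mem_range.1 hi; omega)
    have : ((p.choose (i + 1) : ℕ) : R) = 0 := by
      have h1 : ((p.choose (i + 1) : ℕ) : ZMod p) = 0 := (ZMod.natCast_eq_zero_iff _ _).2 hd
      have := congrArg (algebraMap (ZMod p) R) h1
      simpa using this
    rw [this, zero_mul]
  rw [Finset.sum_eq_zero hz]
  simp
  ring

lemma IsDer.one {D : Module.End (ZMod p) R} (h : IsDer D) : D 1 = 0 := by
  have := h 1 1
  simp at this; exact this

/-- the operator `D + z` -/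
def Lop (D : Module.End (ZMod p) R) (z : R) : Module.End (ZMod p) R := D + LinearMap.mulLeft (ZMod p) z

lemma Lop_apply (D : Module.End (ZMod p) R) (z a : R) : Lop D z a = D a + z * a := rfl

lemma Lop_zero (D : Module.End (ZMod p) R) : Lop D 0 = D := by ext; simp [Lop_apply]

lemma L_pow_mul {D : Module.End (ZMod p) R} (h : IsDer D) (z w : R) (a b : R) :
    (Lop D (z + w) ^ p) (a * b) =
      (Lop D z ^ p) a * b + a * (Lop D w ^ p) b := by
  apply leibniz_pow_p
  intro a b
  simp [h a b, Lop_apply]; ring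

/-- eigen decomposition -/
lemma eigen_decomp (D : Module.End (ZMod p) R) (hD : D ^ p = D) (a : R) :
    ∃ f : ZMod p → R, (∀ c, D (f c) = c • f c) ∧ a = ∑ c, f c ∧
      ∀ N : Module.End (ZMod p) R, Commute N D → N a = 0 → ∀ c, N (f c) = 0 := by
  have hp := hpF.out
  let f : ZMod p → R := fun c => if c = 0 then a - (D ^ (p-1)) a else
    - ∑ k ∈ Finset.range (p - 1), c ^ k • (D ^ (p - 1 - k)) a
  have hDD : ∀ x, (D ^ p) x = D x := fun x => by rw [hD]
  refine ⟨f, ?_, ?_, ?_⟩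
  · intro c
    by_cases hc : c = 0
    · simp only [hc, f, if_true, map_sub, zero_smul]
      rw [← Module.End.mul_apply, ← pow_succ', Nat.sub_add_cancel hp.one_le, hD, sub_self]
    · simp only [hc, f, if_false, map_neg, map_sum, map_smul, smul_neg, Finset.smul_sum]
      congr 1
      have e1 : ∀ k ∈ Finset.range (p-1), c ^ k • D ((D ^ (p - 1 - k)) a) = c ^ k • (D ^ (p - k)) a := by
        intro k hk
        have := Finset.mem_range.1 hk
        rw [← Module.End.mul_apply, ← pow_succ', show p - 1 - k + 1 = p - k by omega]
      have e2 : ∀ k ∈ Finset.range (p-1), c • c ^ k • (D ^ (p - 1 - k)) a = c ^ (k+1) • (D ^ (p - (k+1))) a := by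
        intro k hk
        rw [smul_smul, ← pow_succ', show p - 1 - k = p - (k+1) by omega]
      rw [Finset.sum_congr rfl e1, Finset.sum_congr rfl e2]
      have t1 := Finset.sum_range_succ (fun k => c ^ k • (D ^ (p - k)) a) (p-1)
      have t2 := Finset.sum_range_succ' (fun k => c ^ k • (D ^ (p - k)) a) (p-1)
      rw [t1] at t2
      have hcp : c ^ (p - 1) = 1 := ZMod.pow_card_sub_one_eq_one hc
      have h3 : p - (p - 1) = 1 := by have := hp.one_le; omega
      rw [hcp, h3] at t2
      simp only [pow_zero, pow_one, Nat.sub_zero, hDD] at t2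
      exact add_right_cancel t2
  · have hs : ∑ c, f c = f 0 + ∑ c ∈ Finset.univ \ {0}, f c := by
      rw [← Finset.sum_sdiff (Finset.subset_univ {(0:ZMod p)}), add_comm]; simp
    have hnz : ∑ c ∈ Finset.univ \ {0}, f c = (D ^ (p-1)) a := by
      have : ∀ c ∈ Finset.univ \ {(0 : ZMod p)}, f c = - ∑ k ∈ Finset.range (p - 1), c ^ k • (D ^ (p - 1 - k)) a := by
        intro c hc
        have : c ≠ 0 := by simpa using hc
        simp [f, this]
      rw [Finset.sum_congr rfl this, Finset.sum_neg_distrib, Finset.sum_comm]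
      have h4 : ∀ k ∈ Finset.range (p - 1), ∑ c ∈ Finset.univ \ {(0 : ZMod p)}, c ^ k • (D ^ (p - 1 - k)) a
         = if k = 0 then - (D ^ (p-1)) a else 0 := by
        intro k hk
        rw [← Finset.sum_smul]
        have hk' := Finset.mem_range.1 hk
        split_ifs with h0
        · subst h0
          have : (∑ c ∈ Finset.univ \ {(0 : ZMod p)}, c ^ 0) = -1 := by
            simp [Finset.card_sdiff, ZMod.card, Nat.cast_sub hp.one_le]
          rw [this]; simp
        · have h5 := FiniteField.sum_pow_lt_card_sub_one (K := ZMod p) k (by rw [ZMod.card]; exact hk')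
          rw [← Finset.sum_sdiff (Finset.subset_univ {(0:ZMod p)})] at h5
          rw [Finset.sum_singleton, zero_pow h0, add_zero] at h5
          rw [h5, zero_smul]
      rw [Finset.sum_congr rfl h4, Finset.sum_ite_eq' ]
      have : 0 ∈ Finset.range (p-1) := by have := hp.two_le; simp; omega
      simp [this]
    rw [hs, hnz]; simp [f]
  · intro N hN hNa c
    have hk : ∀ k, N ((D ^ k) a) = 0 := fun k => by
      rw [← Module.End.mul_apply, (hN.pow_right k).eq, Module.End.mul_apply, hNa, map_zero]
    by_cases hc : c = 0
    · simp [f, hc, hk, hNa]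
    · simp [f, hc, hk]

open Polynomial in
lemma L_pow_one_eigen {D : Module.End (ZMod p) R} (h : IsDer D) (z : R) (c : ZMod p) (hz : D z = c • z) :
    (Lop D z ^ p) 1 = z ^ p + c ^ (p - 1) • z := by
  have hp := hpF.out
  have hpow : ∀ j : ℕ, D (z ^ j) = ((j : ZMod p) * c) • z ^ j := by
    intro j
    induction j with
    | zero => simp [h.one]
    | succ k ih =>
      rw [pow_succ, h, ih, hz]
      simp only [Algebra.smul_mul_assoc, Algebra.mul_smul_comm, ← add_smul]
      push_cast; congr 1; ring
  have hstep : ∀ j : ℕ, (aeval (Lop D z) (∏ i ∈ Finset.range j, (X - Polynomial.C ((i : ZMod p) * c)))) 1 = z ^ j := by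
    intro j
    induction j with
    | zero => simp
    | succ k ih =>
      rw [Finset.prod_range_succ, mul_comm, map_mul, Module.End.mul_apply, ih]
      simp only [map_sub, aeval_X, aeval_C, LinearMap.sub_apply, Lop_apply, hpow, Module.algebraMap_end_apply]
      rw [pow_succ']; abel
  have hprod : (∏ i ∈ Finset.range p, (X - Polynomial.C ((i : ZMod p) * c))) = X ^ p - Polynomial.C (c ^ (p-1)) * X := by
    have key : ∏ a : ZMod p, (X - Polynomial.C a) = X ^ p - X := by
      have h1 : (X ^ p - X : (ZMod p)[X]).natDegree = p :=
        FiniteField.X_pow_card_sub_X_natDegree_eq _ hp.one_lt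
      have h2 : (X ^ p - X : (ZMod p)[X]).roots = Finset.univ.val := by
        have := FiniteField.roots_X_pow_card_sub_X (ZMod p)
        rwa [ZMod.card] at this
      have h3 : (X ^ p - X : (ZMod p)[X]).Monic := by
        apply monic_X_pow_sub
        rw [degree_X]; exact_mod_cast hp.one_lt
      have := prod_multiset_X_sub_C_of_monic_of_roots_card_eq h3 (by rw [h1, h2]; simp [ZMod.card])
      rw [h2] at this; exact this
    have hr : ∏ i ∈ Finset.range p, (X - Polynomial.C ((i : ZMod p) * c)) = ∏ a : ZMod p, (X - Polynomial.C (a * c)) := by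
      refine Finset.prod_bij' (fun i _ => (i : ZMod p)) (fun a _ => a.val) ?_ ?_ ?_ ?_ ?_
      · simp
      · intro a _; simpa using ZMod.val_lt a
      · intro i hi; simpa using ZMod.val_cast_of_lt (Finset.mem_range.1 hi)
      · intro a _; simp
      · simp
    rw [hr]
    by_cases hc : c = 0
    · subst hc
      have : p - 1 ≠ 0 := by have := hp.two_le; omega
      simp [ZMod.card, this]
    · rw [ZMod.pow_card_sub_one_eq_one hc]
      simp only [map_one, one_mul]
      rw [← key]
      exact Fintype.prod_equiv (Equiv.mulRight₀ c hc) _ _ (by intro a; simp)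
  have h6 := hstep p
  rw [hprod] at h6
  simp only [map_sub, map_mul, map_pow, aeval_X, aeval_C, LinearMap.sub_apply, Module.End.mul_apply,
    Lop_apply, h.one, mul_one, zero_add] at h6
  rw [← map_pow, Module.algebraMap_end_apply] at h6
  rw [← h6]; abel

lemma L_pow_one {D : Module.End (ZMod p) R} (h : IsDer D) (hD : D ^ p = D) (z : R) :
    (Lop D z ^ p) 1 = z ^ p + (D ^ (p-1)) z := by
  have hp := hpF.out
  have : CharP R p ∨ Subsingleton R := by
    rcases subsingleton_or_nontrivial R with h | h
    · exact Or.inr h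
    · exact Or.inl (charP_of_injective_algebraMap (algebraMap (ZMod p) R).injective p)
  obtain ⟨f, hf, hsum, -⟩ := eigen_decomp D hD z
  rcases this with hch | hss
  swap
  · exact Subsingleton.elim _ _
  have gen : ∀ s : Finset (ZMod p), (Lop D (∑ c ∈ s, f c) ^ p) 1 = (∑ c ∈ s, f c) ^ p + (D ^ (p-1)) (∑ c ∈ s, f c) := by
    intro s
    induction s using Finset.induction_on with
    | empty =>
      simp [hD, h.one, hp.ne_zero, Lop_zero]
    | insert c s hc ih =>
      rw [Finset.sum_insert hc]
      have := L_pow_mul h (f c) (∑ c ∈ s, f c) 1 1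
      simp only [mul_one, one_mul] at this
      rw [this, ih, L_pow_one_eigen h (f c) c (hf c), add_pow_char, map_add]
      have hk : ∀ k, (D ^ k) (f c) = c ^ k • f c := by
        intro k
        induction k with
        | zero => simp
        | succ k ih => rw [pow_succ', Module.End.mul_apply, ih, map_smul, hf, smul_smul, pow_succ]
      rw [hk]; abel
  rw [hsum]; exact gen _

lemma L_pow {D : Module.End (ZMod p) R} (h : IsDer D) (hD : D ^ p = D) (z m : R) :
    (Lop D z ^ p) m = D m + (z ^ p + (D ^ (p-1)) z) * m := by
  have := L_pow_mul h z 0 1 m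
  simp only [add_zero, one_mul, Lop_zero, hD] at this
  rw [this, L_pow_one h hD]; ring

/-- logarithmic derivatives -/
lemma logder_pow {D : Module.End (ZMod p) R} (h : IsDer D) (hD : D ^ p = D) (y z : R) (hy : IsUnit y)
    (hz : D y = z * y) : z ^ p = z - (D ^ (p-1)) z := by
  -- (D + z)^n 1 * y = D^n y
  have key : ∀ n, ∀ a, (Lop D z ^ n) a * y = (D ^ n) (a * y) := by
    intro n
    induction n with
    | zero => simp
    | succ k ih =>
      intro a
      rw [pow_succ, pow_succ, Module.End.mul_apply, Module.End.mul_apply, ih]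
      congr 1
      simp [h a y, hz, Lop_apply]; ring
  have h1 := key p 1
  rw [L_pow_one h hD, hD, one_mul, hz] at h1
  have := hy.mul_right_cancel h1
  exact eq_sub_of_add_eq this

end Jacobson


section TL
universe u
variable {p : ℕ} [hpF : Fact p.Prime]

open TensorProduct Polynomial in
lemma TL_ext {E : Type u} [Field E] [Algebra (ZMod p) E] {ι : Type*}
    (D : ι → Module.End (ZMod p) E) (hder : ∀ l, IsDer (D l)) (hpow : ∀ l, D l ^ p = D l)
    (hcomm : ∀ i j, Commute (D i) (D j)) (v : E) (hv : v ≠ 0) :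
    ∃ (A : Type u) (_ : CommRing A) (_ : Algebra (ZMod p) A) (ie : E →+* A)
      (f finv : A) (π : A →+ E) (Dt : ι → Module.End (ZMod p) A),
      (∀ l, IsDer (Dt l)) ∧ (∀ l, Dt l ^ p = Dt l) ∧ (∀ i j, Commute (Dt i) (Dt j)) ∧
      (∀ l a, Dt l (ie a) = ie (D l a)) ∧ (∀ l, Dt l f = 0) ∧ f * finv = 1 ∧
      f ^ p = ie (v ^ p) * f ∧ (∀ a t, π (ie a * t) = a * π t) ∧ π 1 = 1 ∧
      (∀ l t, π (Dt l t) = D l (π t)) ∧ (∀ t : A, π (t ^ p) = π t ^ p) ∧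
      (∀ t : A, t ≠ 0 → IsUnit t) ∧ (1 : A) ≠ 0 := by
  have hp := hpF.out
  have hch : CharP E p := charP_of_injective_algebraMap (algebraMap (ZMod p) E).injective p
  let k : Subfield E := (frobenius E p).fieldRange
  have hk : ∀ a : E, a ^ p ∈ k := fun a => ⟨a, rfl⟩
  let g : k := ⟨v ^ p, hk v⟩
  have hg : g ≠ 0 := by
    intro h; have := congrArg Subtype.val h
    exact pow_ne_zero p hv this
  let q : k[X] := X ^ (p - 1) - C g
  have hp1 : p - 1 ≠ 0 := by have := hp.two_le; omega
  have hqdeg : q.degree ≠ 0 := by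
    rw [degree_X_pow_sub_C (Nat.pos_of_ne_zero hp1)]
    exact_mod_cast hp1
  obtain ⟨q0, hirr, hdvd⟩ := Polynomial.exists_irreducible_of_degree_pos (f := q) (by
    rw [degree_X_pow_sub_C (Nat.pos_of_ne_zero hp1)]
    exact_mod_cast Nat.pos_of_ne_zero hp1)
  have : Fact (Irreducible q0) := ⟨hirr⟩
  let K := AdjoinRoot q0
  let pb := AdjoinRoot.powerBasis hirr.ne_zero
  let fK : K := AdjoinRoot.root q0
  have hfK : fK ^ (p - 1) = algebraMap k K g := by
    obtain ⟨q1, hq1⟩ := hdvd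
    have h1 : AdjoinRoot.mk q0 q = 0 := by rw [hq1]; simp
    simp only [q, map_sub, map_pow, AdjoinRoot.mk_X, AdjoinRoot.mk_C, sub_eq_zero] at h1
    exact h1
  have hfKp : fK ^ p = algebraMap k K g * fK := by
    rw [← hfK, ← pow_succ, Nat.sub_add_cancel hp.one_le]
  have hfK0 : fK ≠ 0 := by
    intro h; rw [h, zero_pow hp1] at hfK
    exact hg ((algebraMap k K).injective (by rw [← hfK, map_zero]))
  have hDp : ∀ l a, D l (a ^ p) = 0 := by
    intro l a
    have : ∀ n : ℕ, D l (a ^ (n+1)) = ((n+1 : ℕ) : E) * a ^ n * D l a := by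
      intro n
      induction n with
      | zero => simp
      | succ n ih => rw [pow_succ, hder l, ih]; push_cast; ring
    have h1 := this (p-1)
    rw [Nat.sub_add_cancel hp.one_le] at h1
    rw [h1, CharP.cast_eq_zero, zero_mul, zero_mul]
  let Dk : ι → (E →ₗ[k] E) := fun l =>
    { toFun := D l
      map_add' := map_add _
      map_smul' := by
        rintro ⟨_, a, rfl⟩ b
        change D l (a ^ p * b) = a ^ p * D l b
        rw [hder l, hDp, zero_mul, zero_add] }
  let A := E ⊗[k] K
  let B : Module.Basis (Fin pb.dim) E A := Algebra.TensorProduct.basis E pb.basis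
  have hB : ∀ i, B i = (1 : E) ⊗ₜ[k] (fK ^ (i : ℕ)) := by
    intro i
    rw [Algebra.TensorProduct.basis_apply, pb.basis_eq_pow]; rfl
  let ie : E →+* A := algebraMap E A
  have hie : ∀ (a : E) (t : A), ie a * t = a • t := fun a t => (Algebra.smul_def a t).symm
  let Dt0 : ι → (A →ₗ[k] A) := fun l => LinearMap.rTensor K (Dk l)
  have hDt0 : ∀ l a κ, Dt0 l (a ⊗ₜ κ) = (D l a) ⊗ₜ κ := fun l a κ => by
    exact LinearMap.rTensor_tmul _ _ _ _
  have hrepr : ∀ l t i, B.repr (Dt0 l t) i = D l (B.repr t i) := by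
    intro l t i
    conv_lhs => rw [← B.sum_repr t]
    have : ∀ j, Dt0 l (B.repr t j • B j) = D l (B.repr t j) • B j := by
      intro j
      rw [hB, TensorProduct.smul_tmul', TensorProduct.smul_tmul', hDt0]; simp
    rw [map_sum, Finset.sum_congr rfl (fun j _ => this j), B.repr_sum_self]
  have : Nontrivial A := by
    refine ⟨⟨B ⟨0, pb.dim_pos⟩, 0, B.ne_zero _⟩⟩
  have hchA : CharP A p := charP_of_injective_algebraMap (algebraMap E A).injective p
  have hreprp : ∀ t i, B.repr (t ^ p) i = (B.repr t i) ^ p * (v ^ p) ^ (i : ℕ) := by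
    intro t i
    conv_lhs => rw [← B.sum_repr t]
    have : ∀ j, (B.repr t j • B j) ^ p = ((B.repr t j) ^ p * (v ^ p) ^ (j : ℕ)) • B j := by
      intro j
      rw [_root_.smul_pow, hB, Algebra.TensorProduct.tmul_pow, one_pow, ← pow_mul, mul_comm (j : ℕ) p,
        pow_mul, hfKp, mul_pow, mul_smul, ← map_pow (algebraMap k K), ← Algebra.smul_def, ← TensorProduct.smul_tmul]
      congr 1
    rw [sum_pow_char, Finset.sum_congr rfl (fun j _ => this j), B.repr_sum_self]
  have hleib : ∀ l s t, Dt0 l (s * t) = Dt0 l s * t + s * Dt0 l t := by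
    intro l s t
    induction s using TensorProduct.induction_on with
    | zero => simp
    | add a b ha hb => rw [add_mul, map_add, ha, hb, map_add]; ring
    | tmul a κ =>
      induction t using TensorProduct.induction_on with
      | zero => simp
      | add a b ha hb => rw [mul_add, map_add, ha, hb, map_add]; ring
      | tmul b κ' =>
        rw [Algebra.TensorProduct.tmul_mul_tmul, hDt0, hDt0, hDt0, hder l,
          Algebra.TensorProduct.tmul_mul_tmul, Algebra.TensorProduct.tmul_mul_tmul, TensorProduct.add_tmul]
  let algA : Algebra (ZMod p) A := inferInstance
  let Dt : ι → Module.End (ZMod p) A := fun l => AddMonoidHom.toZModLinearMap p (Dt0 l).toAddMonoidHom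
  have hDt : ∀ l t, Dt l t = Dt0 l t := fun l t => rfl
  have hreprt : ∀ l t i, B.repr (Dt l t) i = D l (B.repr t i) := hrepr
  have hreprn : ∀ l n t i, B.repr ((Dt l ^ n) t) i = (D l ^ n) (B.repr t i) := by
    intro l n t i
    induction n with
    | zero => simp
    | succ n ih => rw [pow_succ', pow_succ', Module.End.mul_apply, Module.End.mul_apply, hreprt, ih]
  have hpr : ∀ t : A, ∃ κ : K, t ^ p = (1 : E) ⊗ₜ[k] κ := by
    intro t
    induction t using TensorProduct.induction_on with
    | zero => exact ⟨0, by simp [hp.ne_zero]⟩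
    | add a b ha hb =>
      obtain ⟨x, hx⟩ := ha; obtain ⟨y, hy⟩ := hb
      exact ⟨x + y, by rw [add_pow_char, hx, hy, TensorProduct.tmul_add]⟩
    | tmul a κ =>
      refine ⟨(⟨a ^ p, hk a⟩ : k) • κ ^ p, ?_⟩
      rw [Algebra.TensorProduct.tmul_pow, ← TensorProduct.smul_tmul]
      congr 1
      change a ^ p = a ^ p * 1
      rw [mul_one]
  let i0 : Fin pb.dim := ⟨0, pb.dim_pos⟩
  have hB1 : B i0 = 1 := by rw [hB]; simp [i0]; rfl
  refine ⟨A, inferInstance, algA, ie, (1 : E) ⊗ₜ[k] fK, (1 : E) ⊗ₜ[k] fK⁻¹,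
    (B.coord i0).toAddMonoidHom, Dt, ?_, ?_, ?_, ?_, ?_, ?_, ?_, ?_, ?_, ?_, ?_, ?_, one_ne_zero⟩
  · intro l a b; exact hleib l a b
  · intro l; ext t
    apply B.repr.injective; ext i
    rw [hreprn, hpow, hreprt]
  · intro i j
    ext t
    apply B.repr.injective; ext n
    rw [Module.End.mul_apply, Module.End.mul_apply, hreprt, hreprt, hreprt, hreprt,
      ← Module.End.mul_apply, (hcomm i j).eq, Module.End.mul_apply]
  · intro l a
    rw [hDt]
    exact hDt0 l a 1
  · intro l
    rw [hDt, hDt0, (hder l).one, TensorProduct.zero_tmul]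
  · rw [Algebra.TensorProduct.tmul_mul_tmul, mul_inv_cancel₀ hfK0, one_mul]; rfl
  · rw [Algebra.TensorProduct.tmul_pow, one_pow, hfKp, hie, ← Algebra.smul_def, ← TensorProduct.smul_tmul,
      TensorProduct.smul_tmul']
    congr 1
  · intro a t
    rw [hie]; simp
  · rw [← hB1]; simp
  · intro l t; exact hreprt l t i0
  · intro t
    have := hreprp t i0
    simpa [i0] using this
  · intro t ht
    have h1 : t ^ p ≠ 0 := by
      intro h0
      apply ht
      apply B.repr.injective; ext i
      have := hreprp t i
      rw [h0] at this
      simp [hv, hp.ne_zero] at this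
      simpa using this
    obtain ⟨κ, hκ⟩ := hpr t
    have hκ0 : κ ≠ 0 := by rintro rfl; rw [TensorProduct.tmul_zero] at hκ; exact h1 hκ
    have : IsUnit (t ^ p) := by
      refine IsUnit.of_mul_eq_one ((1 : E) ⊗ₜ[k] κ⁻¹) ?_
      rw [hκ, Algebra.TensorProduct.tmul_mul_tmul, mul_inv_cancel₀ hκ0, one_mul]; rfl
    exact (isUnit_pow_iff hp.ne_zero).1 this

lemma IsDer.inv_pow {E : Type*} [Field E] [Algebra (ZMod p) E] {D : Module.End (ZMod p) E} (h : IsDer D)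
    (x : E) (hx : x ≠ 0) (c : E) (hDx : D x = c * x) (n : ℕ) : D ((x ^ n)⁻¹) = - (n * c) * (x ^ n)⁻¹ := by
  have h1 : ∀ n : ℕ, D (x ^ n) = n * c * x ^ n := by
    intro n
    induction n with
    | zero => simp [h.one]
    | succ k ih => rw [pow_succ, h, ih, hDx]; push_cast; ring
  have h2 := h (x ^ n) ((x ^ n)⁻¹)
  have h3 : x ^ n ≠ 0 := pow_ne_zero n hx
  rw [mul_inv_cancel₀ h3, h.one, h1] at h2
  have h4 : x ^ n * (D (x ^ n)⁻¹ + (n * c) * (x ^ n)⁻¹) = 0 := by rw [h2]; ring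
  have h5 := (mul_eq_zero.1 h4).resolve_left h3
  rw [neg_mul]; exact eq_neg_of_add_eq_zero_left h5

lemma IsDer.mul_apply_of_zero {R : Type*} [CommRing R] [Algebra (ZMod p) R]
    {D : Module.End (ZMod p) R} (h : IsDer D) (a : R) (ha : D a = 0) (n : ℕ) (b : R) :
    (D ^ n) (a * b) = a * (D ^ n) b := by
  induction n with
  | zero => simp
  | succ k ih => rw [pow_succ', Module.End.mul_apply, ih, h, ha, zero_mul, zero_add, Module.End.mul_apply]

theorem twisted {E : Type u} [Field E] [Algebra (ZMod p) E] {ι : Type*}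
    (D : ι → Module.End (ZMod p) E) (hder : ∀ l, IsDer (D l)) (hpow : ∀ l, D l ^ p = D l)
    (hcomm : ∀ i j, Commute (D i) (D j)) (x : ι → E) (hx : ∀ i, x i ≠ 0)
    (hDx : ∀ i, D i (x i) = x i) (hDx' : ∀ i j, i ≠ j → D i (x j) = 0)
    (U : Set ι) (j : ι) (hj : j ∈ U) (v : E) (hvU : ∀ l, l ∉ U → D l v = 0)
    (hvW : v - (D j ^ (p-1)) v = 1) :
    ∃ lam : ι → E, lam j = v ∧ (∀ b, b ∉ U → lam b = 0) ∧ (∀ b c, c ∉ U → D c (lam b) = 0) ∧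
      (∀ b c, D b (lam c) = D c (lam b)) ∧
      (∀ b, lam b ^ p = v ^ p * (lam b - (D b ^ (p-1)) (lam b))) := by
  have hp := hpF.out
  have hv : v ≠ 0 := by rintro rfl; simp at hvW
  obtain ⟨A, iA, iAlg, ie, f, finv, π, Dt, tder, tpow, tcomm, tie, tf, hff, hfp, πmul, πone, πD, πp, hunit, hne⟩ :=
    TL_ext D hder hpow hcomm v hv
  have : Nontrivial A := ⟨⟨1, 0, hne⟩⟩
  have hchA : CharP A p := charP_of_injective_algebraMap (algebraMap (ZMod p) A).injective p
  have tfinv : ∀ l, Dt l finv = 0 := by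
    intro l
    have h1 := tder l f finv
    rw [hff, (tder l).one, tf, zero_mul, zero_add] at h1
    calc Dt l finv = (f * finv) * Dt l finv := by rw [hff, one_mul]
      _ = finv * (f * Dt l finv) := by ring
      _ = 0 := by rw [← h1, mul_zero]
  have tien : ∀ l n a, (Dt l ^ n) (ie a) = ie ((D l ^ n) a) := by
    intro l n a
    induction n with
    | zero => simp
    | succ k ih => rw [pow_succ', pow_succ', Module.End.mul_apply, Module.End.mul_apply, ih, tie]
  set z : A := finv * ie v with hz
  have hDz : (Dt j ^ (p-1)) z = finv * ie ((D j ^ (p-1)) v) := by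
    rw [hz, (tder j).mul_apply_of_zero _ (tfinv j), tien]
  have hzp : z ^ p = finv := by
    rw [hz, mul_pow, ← map_pow]
    have h1 : ie (v ^ p) = ie (v ^ p) * f * finv := by rw [mul_assoc, hff, mul_one]
    rw [h1, ← hfp]
    calc finv ^ p * (f ^ p * finv) = (f * finv) ^ p * finv := by ring
      _ = finv := by rw [hff]; simp
  have hzW : z ^ p + (Dt j ^ (p-1)) z = z := by
    rw [hDz, hzp]
    have : ie v = 1 + ie ((D j ^ (p-1)) v) := by
      rw [← map_one ie, ← map_add]; congr 1; rw [← hvW]; ring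
    rw [hz, this]; ring
  set T : Module.End (ZMod p) A := Lop (Dt j) (-z) with hT
  have hTp : T ^ p = T := by
    ext m
    rw [hT, L_pow (tder j) (tpow j), Lop_apply, map_neg]
    have : (-z) ^ p = - z ^ p := by
      have := sub_pow_char (p := p) (0 : A) z
      rw [zero_pow hp.ne_zero, zero_sub, zero_sub] at this; exact this
    rw [this, ← neg_add, hzW]
  obtain ⟨ev, hev, hsum, hN⟩ := eigen_decomp T hTp 1
  obtain ⟨c, hc⟩ : ∃ c, ev c ≠ 0 := by
    by_contra hcon
    push Not at hcon
    exact hne (by rw [hsum]; exact Finset.sum_eq_zero fun c _ => hcon c)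
  set y := ev c with hy
  have hyU : ∀ l, l ∉ U → Dt l y = 0 := by
    intro l hl
    refine hN (Dt l) ?_ (tder l).one c
    have hz0 : Dt l z = 0 := by rw [hz, tder l, tfinv, zero_mul, zero_add, tie, hvU l hl, map_zero, mul_zero]
    ext m
    rw [Module.End.mul_apply, Module.End.mul_apply, Lop_apply, Lop_apply, map_add, tder l, map_neg, hz0,
      ← Module.End.mul_apply, (tcomm l j).eq, Module.End.mul_apply]
    ring
  set w : E := (x j ^ c.val)⁻¹ with hw
  have hw0 : w ≠ 0 := inv_ne_zero (pow_ne_zero _ (hx j))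
  set y' : A := ie w * y with hy'
  have hy'0 : IsUnit y' := by
    apply IsUnit.mul
    · exact (IsUnit.mk0 w hw0).map ie
    · exact hunit y hc
  have hDy' : Dt j y' = z * y' := by
    have h1 : Dt j y = z * y + c • y := by
      have := hev c
      rw [hT, Lop_apply] at this
      rw [← this]; ring
    have h2 : Dt j (ie w) = - (c.val : A) * ie w := by
      rw [tie, hw, (hder j).inv_pow (x j) (hx j) 1 (by rw [hDx, one_mul])]
      rw [mul_one, map_mul, map_neg, map_natCast]
    have h3 : c • y = (c.val : A) * y := by
      rw [Algebra.smul_def]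
      congr 1
      conv_lhs => rw [← ZMod.natCast_zmod_val c]
      rw [map_natCast]
    rw [hy', tder j, h1, h2, h3]; ring
  have hy'U : ∀ l, l ∉ U → Dt l y' = 0 := by
    intro l hl
    have hlj : l ≠ j := fun h => hl (h ▸ hj)
    have h2 : Dt l (ie w) = 0 := by
      rw [tie, hw, (hder l).inv_pow (x j) (hx j) 0 (by rw [hDx' l j hlj, zero_mul])]
      simp
    rw [hy', tder l, h2, hyU l hl]; ring
  obtain ⟨yi, hyi⟩ := hy'0.exists_right_inv
  let zz : ι → A := fun b => Dt b y' * yi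
  have hzz : ∀ b, Dt b y' = zz b * y' := fun b => by
    simp only [zz]; rw [mul_assoc, mul_comm yi, hyi, mul_one]
  have hzj : zz j = z := by
    simp only [zz]; rw [hDy', mul_assoc, hyi, mul_one]
  have hcl : ∀ b c, Dt b (zz c) = Dt c (zz b) := by
    intro b c
    apply hy'0.mul_right_cancel
    have h1 : Dt b (Dt c y') = Dt c (Dt b y') := by
      rw [← Module.End.mul_apply, (tcomm b c).eq, Module.End.mul_apply]
    rw [hzz c, hzz b, tder b, tder c, hzz b, hzz c] at h1
    linear_combination h1
  have hfD : ∀ b n t, (Dt b ^ n) (f * t) = f * (Dt b ^ n) t := fun b n t => (tder b).mul_apply_of_zero _ (tf b) n t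
  have hfD1 : ∀ b t, Dt b (f * t) = f * Dt b t := fun b t => by simpa using hfD b 1 t
  have πDn : ∀ b n t, π ((Dt b ^ n) t) = (D b ^ n) (π t) := by
    intro b n t
    induction n with
    | zero => simp
    | succ k ih => rw [pow_succ', pow_succ', Module.End.mul_apply, Module.End.mul_apply, πD, ih]
  refine ⟨fun b => π (f * zz b), ?_, ?_, ?_, ?_, ?_⟩
  · simp only [hzj, hz]
    rw [← mul_assoc, hff, one_mul, ← mul_one (ie v), πmul, πone, mul_one]
  · intro b hb
    have : zz b = 0 := by simp only [zz]; rw [hy'U b hb, zero_mul]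
    simp [this]
  · intro b c hc
    simp only
    rw [← πD, hfD1, hcl c b]
    have : zz c = 0 := by simp only [zz]; rw [hy'U c hc, zero_mul]
    simp [this]
  · intro b c
    simp only
    rw [← πD, ← πD, hfD1, hfD1, hcl]
  · intro b
    simp only
    rw [← πp, mul_pow, hfp, logder_pow (tder b) (tpow b) y' (zz b) hy'0 (hzz b), mul_assoc, πmul, mul_sub,
      map_sub, ← πDn, hfD]

end TL


section Model
universe u
variable {X : Type*} [LinearOrder X]

/-- sign: parity of the number of elements of `S` above `i` -/
def sg (i : X) (S : Finset X) : ℤ := (-1) ^ (S.filter (fun j => i < j)).card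

lemma sg_mul_self (i : X) (S : Finset X) : sg i S * sg i S = 1 := by
  unfold sg; rw [← mul_pow]; simp

lemma sg_erase_of_le (i j : X) (S : Finset X) (h : j ≤ i) : sg i (S.erase j) = sg i S := by
  unfold sg; congr 2
  ext k; simp only [Finset.mem_filter, Finset.mem_erase]
  constructor
  · rintro ⟨⟨_, h1⟩, h2⟩; exact ⟨h1, h2⟩
  · rintro ⟨h1, h2⟩; exact ⟨⟨fun h3 => by subst h3; exact absurd h2 (not_lt.2 h), h1⟩, h2⟩

lemma sg_insert_of_le (i j : X) (S : Finset X) (h : j ≤ i) : sg i (insert j S) = sg i S := by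
  rw [← sg_erase_of_le i j (insert j S) h, ← sg_erase_of_le i j S h, Finset.erase_insert_eq_erase]

lemma sg_erase_of_lt (i j : X) (S : Finset X) (hj : j ∈ S) (h : i < j) : sg i (S.erase j) = - sg i S := by
  unfold sg
  have : S.filter (fun k => i < k) = insert j ((S.erase j).filter (fun k => i < k)) := by
    ext k; simp only [Finset.mem_filter, Finset.mem_erase, Finset.mem_insert]
    constructor
    · rintro ⟨h1, h2⟩
      by_cases hk : k = j
      · exact Or.inl hk
      · exact Or.inr ⟨⟨hk, h1⟩, h2⟩
    · rintro (rfl | ⟨⟨_, h1⟩, h2⟩)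
      · exact ⟨hj, h⟩
      · exact ⟨h1, h2⟩
  rw [this, Finset.card_insert_of_notMem (by simp), pow_succ]; ring

lemma sg_max (i : X) (S : Finset X) (h : ∀ j ∈ S, j ≤ i) : sg i S = 1 := by
  unfold sg
  rw [Finset.filter_eq_empty_iff.2 (fun j hj => not_lt.2 (h j hj))]; simp

lemma sg_swap (i j : X) (S : Finset X) (hi : i ∈ S) (hj : j ∈ S) (hij : i ≠ j) :
    sg i S * sg j (S.erase i) = - (sg j S * sg i (S.erase j)) := by
  rcases lt_or_gt_of_ne hij with h | h
  · rw [sg_erase_of_le j i S h.le, sg_erase_of_lt i j S hj h]; ring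
  · rw [sg_erase_of_le i j S h.le, sg_erase_of_lt j i S hi h]; ring

lemma alt_zero {M : Type*} [AddCommGroup M] (S : Finset X) (G : X → X → M)
    (hG : ∀ i ∈ S, ∀ j ∈ S, i ≠ j → G i j = G j i) :
    ∑ i ∈ S, ∑ j ∈ S.erase i, (sg i S * sg j (S.erase i)) • G i j = 0 := by
  rw [Finset.sum_sigma']
  refine Finset.sum_involution (fun a _ => ⟨a.2, a.1⟩) ?_ ?_ ?_ ?_
  · rintro ⟨i, j⟩ h
    simp only [Finset.mem_sigma, Finset.mem_erase] at h
    obtain ⟨hi, hji, hj⟩ := h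
    rw [sg_swap i j S hi hj hji.symm, hG i hi j hj hji.symm, neg_smul, neg_add_cancel]
  · rintro ⟨i, j⟩ h _ heq
    simp only [Finset.mem_sigma, Finset.mem_erase] at h
    simp only [Sigma.mk.injEq] at heq
    exact h.2.1 heq.1
  · rintro ⟨i, j⟩ h
    simp only [Finset.mem_sigma, Finset.mem_erase] at h ⊢
    exact ⟨h.2.2, h.2.1.symm, h.1⟩
  · rintro ⟨i, j⟩ h; rfl

variable {p : ℕ} [hpF : Fact p.Prime] {E : Type u} [Field E] [Algebra (ZMod p) E]

/-- left multiplication by a one form -/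
def wdg (lam : X → E) (f : Finset X → E) : Finset X → E :=
  fun S => ∑ i ∈ S, sg i S • (lam i * f (S.erase i))

/-- exterior derivative in coordinates -/
def dd (D : X → Module.End (ZMod p) E) (f : Finset X → E) : Finset X → E :=
  fun S => ∑ i ∈ S, sg i S • D i (f (S.erase i))

/-- contraction -/
def ctr (i : X) (f : Finset X → E) : Finset X → E :=
  fun S => if i ∈ S then 0 else sg i S • f (insert i S)

lemma dd_add (D : X → Module.End (ZMod p) E) (f g : Finset X → E) : dd D (f + g) = dd D f + dd D g := by
  ext S; simp [dd, Finset.sum_add_distrib]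

lemma dd_sub (D : X → Module.End (ZMod p) E) (f g : Finset X → E) : dd D (f - g) = dd D f - dd D g := by
  ext S; simp [dd, Finset.sum_sub_distrib, smul_sub]

lemma dd_zero (D : X → Module.End (ZMod p) E) : dd D 0 = 0 := by
  ext S; simp [dd]

lemma wdg_add (lam : X → E) (f g : Finset X → E) : wdg lam (f + g) = wdg lam f + wdg lam g := by
  ext S; simp [wdg, Finset.sum_add_distrib, mul_add]

lemma wdg_add_left (lam mu : X → E) (f : Finset X → E) : wdg (lam + mu) f = wdg lam f + wdg mu f := by
  ext S; simp [wdg, Finset.sum_add_distrib, add_mul]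

lemma dd_dd (D : X → Module.End (ZMod p) E) (hcomm : ∀ i j, Commute (D i) (D j)) (f : Finset X → E) :
    dd D (dd D f) = 0 := by
  ext S
  simp only [dd, map_sum, map_zsmul, Finset.smul_sum, smul_smul, Pi.zero_apply]
  refine alt_zero S (fun i j => D i (D j (f ((S.erase i).erase j)))) ?_
  intro i _ j _ _
  rw [← Module.End.mul_apply, (hcomm i j).eq, Module.End.mul_apply, Finset.erase_right_comm]

lemma wdg_wdg (lam : X → E) (f : Finset X → E) : wdg lam (wdg lam f) = 0 := by
  ext S
  simp only [wdg, Finset.mul_sum, mul_smul_comm, Finset.smul_sum, smul_smul, Pi.zero_apply]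
  refine alt_zero S (fun i j => lam i * (lam j * (f ((S.erase i).erase j)))) ?_
  intro i _ j _ _
  rw [Finset.erase_right_comm]; ring

lemma dd_wdg (D : X → Module.End (ZMod p) E) (hder : ∀ l, IsDer (D l)) (lam : X → E)
    (hl : ∀ i j, D i (lam j) = D j (lam i)) (f : Finset X → E) :
    dd D (wdg lam f) + wdg lam (dd D f) = 0 := by
  ext S
  simp only [dd, wdg, Pi.add_apply, Finset.mul_sum, mul_smul_comm, map_sum, map_zsmul, Finset.smul_sum,
    smul_smul, Pi.zero_apply]
  rw [← Finset.sum_add_distrib]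
  simp only [← Finset.sum_add_distrib, ← smul_add]
  refine alt_zero S (fun i j => D i (lam j * f ((S.erase i).erase j)) +
    lam i * D j (f ((S.erase i).erase j))) ?_
  intro i _ j _ _
  rw [Finset.erase_right_comm, hder i, hder j, hl i j]; ring

/-- `d(μ f) = dμ ∧ f + μ df` -/
lemma dd_smul (D : X → Module.End (ZMod p) E) (hder : ∀ l, IsDer (D l)) (mu : E) (f : Finset X → E) :
    dd D (fun S => mu * f S) = fun S => wdg (fun i => D i mu) f S + mu * dd D f S := by
  ext S
  simp only [dd, wdg, Finset.mul_sum, ← Finset.sum_add_distrib]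
  refine Finset.sum_congr rfl fun i _ => ?_
  rw [hder i, smul_add, mul_smul_comm]

lemma ctr_homotopy (D : X → Module.End (ZMod p) E) (i : X) (f : Finset X → E) (S : Finset X) :
    dd D (ctr i f) S + ctr i (dd D f) S = D i (f S) := by
  by_cases hi : i ∈ S
  · have h1 : ctr i (dd D f) S = 0 := by simp [ctr, hi]
    rw [h1, add_zero]
    unfold dd
    rw [Finset.sum_eq_single i]
    · simp only [ctr, Finset.mem_erase, ne_eq, not_true, false_and, if_false]
      rw [sg_erase_of_le i i S le_rfl, Finset.insert_erase hi, map_zsmul, smul_smul, sg_mul_self, one_smul]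
    · intro j hj hji
      simp [ctr, hi, hji.symm]
    · intro h; exact absurd hi h
  · simp only [ctr, hi, if_false, dd]
    rw [Finset.sum_insert hi, Finset.erase_insert hi, smul_add, smul_smul, sg_insert_of_le i i S le_rfl, sg_mul_self,
      one_smul]
    have : ∑ j ∈ S, sg j S • D j (if i ∈ S.erase j then 0 else sg i (S.erase j) • f (insert i (S.erase j)))
       + sg i S • ∑ j ∈ S, sg j (insert i S) • D j (f ((insert i S).erase j)) = 0 := by
      rw [Finset.smul_sum, ← Finset.sum_add_distrib]
      apply Finset.sum_eq_zero
      intro j hj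
      have hij : i ≠ j := fun h => hi (h ▸ hj)
      rw [if_neg (fun h => hi (Finset.mem_of_mem_erase h)), map_zsmul, smul_smul, smul_smul,
        Finset.erase_insert_of_ne hij, ← add_smul]
      have h2 := sg_swap i j (insert i S) (Finset.mem_insert_self _ _) (Finset.mem_insert_of_mem hj) hij
      rw [Finset.erase_insert hi, sg_insert_of_le i i S le_rfl, Finset.erase_insert_of_ne hij,
        sg_insert_of_le i i _ le_rfl] at h2
      have h3 : sg j S * sg i (S.erase j) + sg i S * sg j (insert i S) = 0 := by
        have e1 := sg_mul_self i S
        have e2 := sg_mul_self i (S.erase j)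
        have : sg i S * sg i (S.erase j) * (sg j S * sg i (S.erase j) + sg i S * sg j (insert i S))  = 0 := by
          linear_combination h2 + (sg i S * sg j S) * e2 + (sg j (insert i S) * sg i (S.erase j)) * e1
        have h4 : sg i S * sg i (S.erase j) ≠ 0 := by
          intro h0
          have : (1 : ℤ) = 0 := by
            linear_combination (sg i S * sg i (S.erase j)) * h0 - e1 * (sg i (S.erase j) * sg i (S.erase j)) - e2
          exact one_ne_zero this
        exact (mul_eq_zero.1 this).resolve_left h4
      rw [h3, zero_smul]
    rw [add_comm (D i _), ← add_assoc, this, zero_add]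

/-- `W_l` -/
def W1 (D : X → Module.End (ZMod p) E) (l : X) : Module.End (ZMod p) E := 1 - D l ^ (p-1)

section
variable (D : X → Module.End (ZMod p) E) (hcomm : ∀ i j, Commute (D i) (D j))

include hcomm in
lemma W1_comm (i j : X) : Commute (W1 D i) (W1 D j) := by
  unfold W1
  exact (Commute.one_left _).sub_left ((Commute.one_right _).sub_right ((hcomm i j).pow_pow _ _))

include hcomm in
lemma D_W1_comm (i j : X) : Commute (D i) (W1 D j) := by
  unfold W1
  exact ((Commute.one_right _).sub_right ((hcomm i j).pow_right _))

include hcomm in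
lemma W1_pw (U : Finset X) : (U : Set X).Pairwise (Function.onFun Commute (W1 D)) :=
  fun i _ j _ _ => W1_comm D hcomm i j

/-- product of the `W_l` over `U` -/
def WU (U : Finset X) : Module.End (ZMod p) E :=
  U.noncommProd (W1 D) (W1_pw D hcomm U)

lemma WU_empty : WU D hcomm ∅ = 1 := Finset.noncommProd_empty _ _

lemma WU_insert (i : X) (U : Finset X) (hi : i ∉ U) : WU D hcomm (insert i U) = W1 D i * WU D hcomm U := by
  unfold WU; rw [Finset.noncommProd_insert_of_notMem _ _ _ _ hi]

lemma D_WU_comm (i : X) (U : Finset X) : Commute (D i) (WU D hcomm U) := by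
  induction U using Finset.induction_on with
  | empty => rw [WU_empty]; exact Commute.one_right _
  | insert j U hj ih => rw [WU_insert D hcomm j U hj]; exact (D_W1_comm D hcomm i j).mul_right ih

lemma W1_WU_comm (i : X) (U : Finset X) : Commute (W1 D i) (WU D hcomm U) := by
  unfold W1
  exact ((Commute.one_left _).sub_left ((D_WU_comm D hcomm i U).pow_left _))

variable (hpow : ∀ l, D l ^ p = D l) (hder : ∀ l, IsDer (D l))

include hpow in
lemma D_W1 (i : X) : D i * W1 D i = 0 := by
  unfold W1
  rw [mul_sub, mul_one, ← pow_succ', Nat.sub_add_cancel hpF.out.one_le, hpow, sub_self]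

include hpow in
lemma D_WU (i : X) (U : Finset X) (hi : i ∈ U) : D i * WU D hcomm U = 0 := by
  rw [← Finset.insert_erase hi, WU_insert D hcomm i _ (Finset.notMem_erase _ _), ← mul_assoc, D_W1 D hpow, zero_mul]

include hpow in
lemma WU_D (i : X) (U : Finset X) (hi : i ∈ U) (a : E) : WU D hcomm U (D i a) = 0 := by
  rw [← Module.End.mul_apply, ← (D_WU_comm D hcomm i U).eq, D_WU D hcomm hpow i U hi]; rfl

lemma W1_of_zero (i : X) (a : E) (h : D i a = 0) : W1 D i a = a := by
  have hp := hpF.out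
  obtain ⟨k, hk⟩ : ∃ k, p - 1 = k + 1 := ⟨p - 2, by have := hp.two_le; omega⟩
  unfold W1; rw [hk, pow_succ]; simp [h]

include hder in
lemma W1_mul (i : X) (c a : E) (h : D i c = 0) : W1 D i (c * a) = c * W1 D i a := by
  unfold W1; simp [(hder i).mul_apply_of_zero c h, mul_sub]

include hder in
lemma WU_mul (U : Finset X) (c a : E) (h : ∀ i ∈ U, D i c = 0) : WU D hcomm U (c * a) = c * WU D hcomm U a := by
  induction U using Finset.induction_on generalizing a with
  | empty => simp [WU_empty]
  | insert i U hi ih =>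
    rw [WU_insert D hcomm i U hi, Module.End.mul_apply, ih _ (fun j hj => h j (Finset.mem_insert_of_mem hj)),
      W1_mul D hder i c _ (h i (Finset.mem_insert_self _ _)), Module.End.mul_apply]

lemma WU_of_zero (U : Finset X) (a : E) (h : ∀ i ∈ U, D i a = 0) : WU D hcomm U a = a := by
  induction U using Finset.induction_on with
  | empty => simp [WU_empty]
  | insert i U hi ih =>
    rw [WU_insert D hcomm i U hi, Module.End.mul_apply, ih (fun j hj => h j (Finset.mem_insert_of_mem hj)),
      W1_of_zero D i _ (h i (Finset.mem_insert_self _ _))]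

/-- homotopy: closed forms are cohomologous to their `W`-part -/
lemma homotopy_W (U : Finset X) (f : Finset X → E) (hf : dd D f = 0) (P : (Finset X → E) → Prop)
    (h0 : P 0) (hadd : ∀ a b, P a → P b → P (a + b))
    (hctr : ∀ i ∈ U, ∀ V n, P (ctr i (fun S => (D i ^ n) (WU D hcomm V (f S)))) ∨
        ∀ S, D i (f S) = 0) :
    ∃ h, P h ∧ (fun S => f S - WU D hcomm U (f S)) = dd D h := by
  have hp := hpF.out
  have hcl : ∀ T : Module.End (ZMod p) E, (∀ i, Commute (D i) T) → dd D (fun S => T (f S)) = 0 := by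
    intro T hT
    ext S
    have := congrFun hf S
    simp only [dd, Pi.zero_apply] at this ⊢
    have h2 : ∀ i, D i (T (f (S.erase i))) = T (D i (f (S.erase i))) := fun i => by
      rw [← Module.End.mul_apply, (hT i).eq, Module.End.mul_apply]
    simp only [h2]
    rw [← map_zero T, ← this, map_sum]
    simp only [map_zsmul]
  induction U using Finset.induction_on with
  | empty => exact ⟨0, h0, by rw [dd_zero]; ext S; simp [WU_empty]⟩
  | insert i U hi ih =>
    obtain ⟨h, hP, hh⟩ := ih (fun j hj => hctr j (Finset.mem_insert_of_mem hj))
    have key : ∀ S, f S - WU D hcomm (insert i U) (f S) = (f S - WU D hcomm U (f S)) +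
        (D i ^ (p-1)) (WU D hcomm U (f S)) := by
      intro S
      rw [WU_insert D hcomm i U hi, Module.End.mul_apply]
      simp only [W1, LinearMap.sub_apply, Module.End.one_apply]; abel
    obtain ⟨k, hk⟩ : ∃ k, p - 1 = k + 1 := ⟨p - 2, by have := hp.two_le; omega⟩
    rcases hctr i (Finset.mem_insert_self _ _) U k with h1 | h1
    · refine ⟨h + ctr i (fun S => (D i ^ k) (WU D hcomm U (f S))), hadd _ _ hP h1, ?_⟩
      ext S
      rw [key, congrFun hh S, dd_add, Pi.add_apply]
      congr 1
      have h2 := ctr_homotopy D i (fun S => (D i ^ k) (WU D hcomm U (f S))) S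
      have h3 := hcl (D i ^ k * WU D hcomm U) (fun j => ((hcomm j i).pow_right k).mul_right (D_WU_comm D hcomm j U))
      simp only [Module.End.mul_apply] at h3
      rw [h3] at h2
      rw [hk, pow_succ', Module.End.mul_apply, ← h2]
      simp [ctr]
    · refine ⟨h, hP, ?_⟩
      rw [← hh]
      ext S
      rw [key, hk, pow_succ, Module.End.mul_apply, ← Module.End.mul_apply (D i) (WU D hcomm U),
        (D_WU_comm D hcomm i U).eq, Module.End.mul_apply, h1]
      simp

end
end Model


section Kato
universe u
variable {X : Type*} [LinearOrder X] [Fintype X]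
variable {p : ℕ} [hpF : Fact p.Prime] {E : Type u} [Field E] [Algebra (ZMod p) E]
variable (D : X → Module.End (ZMod p) E) (hcomm : ∀ i j, Commute (D i) (D j))
variable (hpow : ∀ l, D l ^ p = D l) (hder : ∀ l, IsDer (D l))

include hpow in
lemma D_Wu (i : X) (a : E) : D i (WU D hcomm Finset.univ a) = 0 := by
  rw [← Module.End.mul_apply, D_WU D hcomm hpow i _ (Finset.mem_univ _)]; rfl

omit [Fintype X] in
lemma one_form_homotopy (lam : X → E) (hl : ∀ i j, D i (lam j) = D j (lam i)) (U : Finset X) :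
    ∃ mu : E, ∀ j, lam j - WU D hcomm U (lam j) = D j mu := by
  have hp := hpF.out
  obtain ⟨k, hk⟩ : ∃ k, p - 1 = k + 1 := ⟨p - 2, by have := hp.two_le; omega⟩
  induction U using Finset.induction_on with
  | empty => exact ⟨0, fun j => by simp [WU_empty]⟩
  | insert i U hi ih =>
    obtain ⟨mu, hmu⟩ := ih
    refine ⟨mu + (D i ^ k) (WU D hcomm U (lam i)), fun j => ?_⟩
    rw [map_add, ← hmu, WU_insert D hcomm i U hi]
    have e1 : D j ((D i ^ k) (WU D hcomm U (lam i))) = (D i ^ (k+1)) (WU D hcomm U (lam j)) := by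
      have c1 : Commute (D j) (D i ^ k * WU D hcomm U) := ((hcomm j i).pow_right k).mul_right (D_WU_comm D hcomm j U)
      have c2 := congrArg (fun T => T (lam i)) c1.eq
      simp only [Module.End.mul_apply] at c2
      rw [c2, hl j i, pow_succ, Module.End.mul_apply]
      have c3 := congrArg (fun T => T (lam j)) (D_WU_comm D hcomm i U).eq
      simp only [Module.End.mul_apply] at c3
      rw [c3]
    rw [e1]
    simp only [Module.End.mul_apply, W1, LinearMap.sub_apply, Module.End.one_apply, hk]
    abel

include hpow hder in
lemma W_wdg (lam : X → E) (hl : ∀ i j, D i (lam j) = D j (lam i)) (f : Finset X → E) (hf : dd D f = 0)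
    (S : Finset X) : WU D hcomm Finset.univ (wdg lam f S) =
      wdg (fun i => WU D hcomm Finset.univ (lam i)) (fun S => WU D hcomm Finset.univ (f S)) S := by
  obtain ⟨mu, hmu⟩ := one_form_homotopy D hcomm lam hl Finset.univ
  set W := WU D hcomm Finset.univ with hW
  have e1 : lam = (fun i => W (lam i)) + fun i => D i mu := by
    ext j; simp [← hmu j]
  have e2 := dd_smul D hder mu f
  rw [hf] at e2
  have e3 : wdg lam f S = wdg (fun i => W (lam i)) f S + dd D (fun S => mu * f S) S := by
    rw [e2]
    conv_lhs => rw [e1, wdg_add_left]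
    simp
  rw [e3, map_add]
  have e4 : W (dd D (fun S => mu * f S) S) = 0 := by
    unfold dd; rw [map_sum]
    apply Finset.sum_eq_zero
    intro i _
    rw [map_zsmul, WU_D D hcomm hpow i _ (Finset.mem_univ _), smul_zero]
  rw [e4, add_zero]
  unfold wdg
  rw [map_sum]
  refine Finset.sum_congr rfl fun i _ => ?_
  rw [map_zsmul, WU_mul D hcomm hder]
  intro l _
  exact D_Wu D hcomm hpow l _

omit [Field E] [Fintype X] [LinearOrder X] in
lemma charP_of_alg [Field E] [Algebra (ZMod p) E] : CharP E p :=
  charP_of_injective_algebraMap (algebraMap (ZMod p) E).injective p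

omit [Fintype X] in
include hpF in
lemma wdg_pow [CharP E p] (lam : X → E) (f : Finset X → E) (S : Finset X) :
    (wdg lam f S) ^ p = wdg (fun i => lam i ^ p) (fun S => f S ^ p) S := by
  have := map_sum (frobenius E p) (fun i => sg i S • (lam i * f (S.erase i))) S
  simp only [map_zsmul, frobenius_def, mul_pow] at this
  exact this

omit [Fintype X] in
lemma wdg_smul (c d : E) (lam : X → E) (f : Finset X → E) (S : Finset X) :
    wdg (fun i => c * lam i) (fun S => d * f S) S = (c * d) * wdg lam f S := by
  unfold wdg
  rw [Finset.mul_sum]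
  refine Finset.sum_congr rfl fun i _ => ?_
  rw [mul_smul_comm]; congr 1; ring

include hpow hder in
lemma wdg_pth (lam : X → E) (hl : ∀ i j, D i (lam j) = D j (lam i)) (f : Finset X → E) (hf : dd D f = 0)
    (g g' : E) (h1 : ∀ i, lam i ^ p = g * WU D hcomm Finset.univ (lam i))
    (h2 : ∀ S, f S ^ p = g' * WU D hcomm Finset.univ (f S)) (S : Finset X) :
    (wdg lam f S) ^ p = (g * g') * WU D hcomm Finset.univ (wdg lam f S) := by
  haveI : CharP E p := charP_of_alg
  rw [wdg_pow, W_wdg D hcomm hpow hder lam hl f hf]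
  simp only [h1, h2]
  rw [wdg_smul]

omit [Fintype X] [LinearOrder X] in
lemma IsDer.pow {R : Type*} [CommRing R] [Algebra (ZMod p) R] {D : Module.End (ZMod p) R} (h : IsDer D) (a : R) (n : ℕ) :
    D (a ^ n) = n * a ^ (n - 1) * D a := by
  induction n with
  | zero => simp [h.one]
  | succ n ih =>
    rw [pow_succ, h, ih]
    cases n with
    | zero => simp
    | succ n => push_cast; ring

omit [Fintype X] [LinearOrder X] in
lemma IsDer.inv {D : Module.End (ZMod p) E} (h : IsDer D) (a : E) (ha : a ≠ 0) : D (a⁻¹) = - D a * (a⁻¹)^2 := by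
  have h1 := h a a⁻¹
  rw [mul_inv_cancel₀ ha, h.one] at h1
  field_simp at h1 ⊢
  linear_combination -h1

omit [Fintype X] in
include hder in
lemma D_pth (l : X) (a : E) : D l (a ^ p) = 0 := by
  haveI : CharP E p := charP_of_alg
  rw [(hder l).pow]; simp

include hcomm hpow hder in
lemma kato (x : X → E) (hx : ∀ i, x i ≠ 0) (hDx : ∀ i, D i (x i) = x i) (hDx' : ∀ i j, i ≠ j → D i (x j) = 0)
    (f : Finset X → E) (hf : dd D f = 0) (α : Finset X)
    (htop : ∀ S, toColex α < toColex S → f S = 0) (hα : f α ≠ 0)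
    (hW : WU D hcomm Finset.univ (f α) = f α ^ p) :
    ∃ Θ : Finset X → E, dd D Θ = 0 ∧ Θ α = f α ∧ (∀ S, toColex α < toColex S → Θ S = 0) ∧
      ∀ S, Θ S ^ p = WU D hcomm Finset.univ (Θ S) := by
  have hp := hpF.out
  set a := f α with ha
  let A : Finset X → E := fun U => WU D hcomm (Finset.univ \ U) a
  have hA0 : A ∅ = a ^ p := by simp only [A, Finset.sdiff_empty]; exact hW
  have hA1 : A Finset.univ = a := by simp only [A, Finset.sdiff_self, WU_empty, Module.End.one_apply]
  have hA0' : A ∅ ≠ 0 := by rw [hA0]; exact pow_ne_zero _ hα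
  have hstep : ∀ i U, i ∉ U → A U = W1 D i (A (insert i U)) := by
    intro i U hi
    simp only [A]
    have : Finset.univ \ U = insert i (Finset.univ \ insert i U) := by
      ext j; simp only [Finset.mem_sdiff, Finset.mem_univ, true_and, Finset.mem_insert, not_or]
      by_cases hj : j = i
      · subst hj; simp [hi]
      · simp [hj]
    rw [this, WU_insert _ _ _ _ (by simp)]; rfl
  have hAn : ∀ U, A U ≠ 0 := by
    intro U
    induction U using Finset.induction_on with
    | empty => exact hA0'
    | insert i U hi ih => intro h; apply ih; rw [hstep i U hi, h, map_zero]
  have hAD : ∀ U l, l ∉ U → D l (A U) = 0 := by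
    intro U l hl
    simp only [A]; rw [← Module.End.mul_apply, D_WU D hcomm hpow l _ (by simp [hl])]; rfl
  have main : ∀ U : Finset X, (∀ i ∈ U, ∀ j < i, j ∈ U) → ∃ Θ : Finset X → E, dd D Θ = 0 ∧
      (∀ S, ¬ S ⊆ U → Θ S = 0) ∧ (∀ S, toColex (α ∩ U) < toColex S → Θ S = 0) ∧ Θ (α ∩ U) = A U ∧
      ∀ S, Θ S ^ p = (A U ^ p * (A ∅)⁻¹) * WU D hcomm Finset.univ (Θ S) := by
    intro U
    induction U using Finset.induction_on_max with
    | empty =>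
      intro _
      refine ⟨fun S => if S = ∅ then A ∅ else 0, ?_, ?_, ?_, ?_, ?_⟩
      · ext S
        apply Finset.sum_eq_zero
        intro i _
        by_cases h : S.erase i = ∅
        · simp only [h, if_true, hAD ∅ i (by simp), smul_zero]
        · simp only [h, if_false, map_zero, smul_zero]
      · intro S hS
        apply if_neg; rintro rfl; exact hS le_rfl
      · intro S hS
        apply if_neg; rintro rfl; simp at hS
      · simp
      · intro S
        by_cases h : S = ∅
        · simp only [h, if_true]
          rw [WU_of_zero D hcomm _ _ (fun i _ => hAD ∅ i (by simp))]
          field_simp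
        · simp only [h, if_false, map_zero, mul_zero, zero_pow hp.ne_zero]
    | insert i U hmax ih =>
      intro hini
      have hiU : i ∉ U := fun h => lt_irrefl _ (hmax i h)
      obtain ⟨Θ, h1, h2, h3, h4, h5⟩ := ih (fun k hk j hj => by
        have := hini k (Finset.mem_insert_of_mem hk) j hj
        rcases Finset.mem_insert.1 this with rfl | h
        · exact absurd hj (not_lt.2 (hmax k hk).le)
        · exact h)
      have hgt : ∀ l, l ∉ insert i U → i < l := by
        intro l hl
        by_contra h
        rcases lt_or_eq_of_le (not_lt.1 h) with h | h
        · exact hl (hini i (Finset.mem_insert_self _ _) l h)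
        · exact hl (h ▸ Finset.mem_insert_self _ _)
      by_cases hi : i ∈ α
      · -- multiply by a one form
        have hintr : α ∩ insert i U = insert i (α ∩ U) := by
          rw [Finset.inter_insert_of_mem hi]
        set v := A (insert i U) / A U with hv
        have hvA : v * A U = A (insert i U) := div_mul_cancel₀ _ (hAn U)
        have hDinv : ∀ l, l ∉ U → D l (A U)⁻¹ = 0 := fun l hl => by
          rw [(hder l).inv _ (hAn U), hAD U l hl]; simp
        have hv1 : v - (D i ^ (p-1)) v = 1 := by
          have : W1 D i v = 1 := by
            rw [hv, div_eq_inv_mul, W1_mul D hder i _ _ (hDinv i hiU), ← hstep i U hiU, inv_mul_cancel₀ (hAn U)]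
          exact this
        have hv0 : ∀ l, l ∉ insert i U → D l v = 0 := by
          intro l hl
          rw [hv, div_eq_mul_inv, hder l, hAD _ l hl, hDinv l (fun h => hl (Finset.mem_insert_of_mem h))]
          ring
        obtain ⟨lam, l1, l2, l3, l4, l5⟩ := twisted D hder hpow hcomm x hx hDx hDx' (insert i U : Finset X) i
          (by simp) v (by intro l hl; exact hv0 l (by simpa using hl)) hv1
        have hvn : v ≠ 0 := div_ne_zero (hAn _) (hAn _)
        have l6 : ∀ b, lam b ^ p = v ^ p * WU D hcomm Finset.univ (lam b) := by
          intro b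
          rw [l5 b]; congr 1
          have e1 : lam b - (D b ^ (p-1)) (lam b) = W1 D b (lam b) := rfl
          have e2 : W1 D b (lam b) = (v⁻¹ * lam b) ^ p := by
            rw [mul_pow, l5 b, e1, inv_pow]
            field_simp
          rw [e1, ← Finset.insert_erase (Finset.mem_univ b), WU_insert _ _ _ _ (Finset.notMem_erase _ _),
            (W1_WU_comm D hcomm b _).eq, Module.End.mul_apply, WU_of_zero]
          intro l _
          rw [e2, D_pth D hder]
        refine ⟨wdg lam Θ, ?_, ?_, ?_, ?_, ?_⟩
        · have := dd_wdg D hder lam l4 Θ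
          rw [h1] at this
          rw [← this]; ext S; simp [wdg]
        · intro S hS
          apply Finset.sum_eq_zero
          intro l _
          by_cases hl : l ∈ insert i U
          · rw [h2, mul_zero, smul_zero]
            intro h; apply hS
            intro k hk
            by_cases hkl : k = l
            · exact hkl ▸ hl
            · exact Finset.mem_insert_of_mem (h (Finset.mem_erase.2 ⟨hkl, hk⟩))
          · rw [l2 l (by simpa using hl), zero_mul, smul_zero]
        · intro S hS
          rw [hintr] at hS
          obtain ⟨c, hc, hc', hcb⟩ := Finset.Colex.toColex_lt_toColex_iff_exists_forall_lt.1 hS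
          have hci : c ≠ i := fun h => hc' (h ▸ Finset.mem_insert_self _ _)
          apply Finset.sum_eq_zero
          intro l hl
          by_cases hli : l = i
          · subst hli
            rw [h3, mul_zero, smul_zero]
            refine Finset.Colex.toColex_lt_toColex_iff_exists_forall_lt.2 ⟨c, Finset.mem_erase.2 ⟨hci, hc⟩,
              fun h => hc' (Finset.mem_insert_of_mem h), fun b hb hbS => ?_⟩
            refine hcb b (Finset.mem_insert_of_mem hb) (fun h => hbS (Finset.mem_erase.2 ⟨?_, h⟩))
            rintro rfl
            exact hiU (Finset.mem_inter.1 hb).2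
          · by_cases hlU : l ∈ insert i U
            · rw [h2, mul_zero, smul_zero]
              intro h
              by_cases hiS : i ∈ S
              · exact hiU (h (Finset.mem_erase.2 ⟨Ne.symm hli, hiS⟩))
              · have h6 := hcb i (Finset.mem_insert_self _ _) hiS
                by_cases hcl : c = l
                · subst hcl
                  rcases Finset.mem_insert.1 hlU with h | h
                  · exact hli h
                  · exact lt_asymm h6 (hmax c h)
                · exact lt_asymm h6 (hmax c (h (Finset.mem_erase.2 ⟨hcl, hc⟩)))
            · rw [l2 l (by simpa using hlU), zero_mul, smul_zero]
        · rw [hintr]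
          unfold wdg
          rw [Finset.sum_eq_single i]
          · rw [Finset.erase_insert (fun h => hiU (Finset.mem_inter.1 h).2), h4, l1, hvA, sg_max, one_smul]
            intro j hj
            rcases Finset.mem_insert.1 hj with rfl | h
            · exact le_rfl
            · exact (hmax j (Finset.mem_inter.1 h).2).le
          · intro l _ hli
            rw [h2, mul_zero, smul_zero]
            intro h
            exact hiU (h (Finset.mem_erase.2 ⟨Ne.symm hli, Finset.mem_insert_self _ _⟩))
          · intro h; exact absurd (Finset.mem_insert_self _ _) h
        · intro S
          rw [wdg_pth D hcomm hpow hder lam l4 Θ h1 _ _ l6 h5, ← hvA]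
          ring
      · have hintr : α ∩ insert i U = α ∩ U := by
          rw [Finset.inter_insert_of_notMem hi]
        have hAA : A U = A (insert i U) := by
          rw [hstep i U hiU]
          apply W1_of_zero
          simp only [A]
          set W := WU D hcomm (Finset.univ \ insert i U) with hWd
          have c1 := congrArg (fun T => T a) (D_WU_comm D hcomm i (Finset.univ \ insert i U)).eq
          simp only [Module.End.mul_apply] at c1
          rw [c1]
          have c2 := congrArg W (congrFun hf (insert i α))
          simp only [dd, Pi.zero_apply, map_zero, map_sum, map_zsmul] at c2
          rw [Finset.sum_eq_single i] at c2
          · rw [Finset.erase_insert hi] at c2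
            have c3 := congrArg (fun y => sg i (insert i α) • y) c2
            simpa only [smul_smul, sg_mul_self, one_smul, smul_zero] using c3
          · intro l hl hli
            by_cases hlU : l ∈ insert i U
            · rw [htop, map_zero, map_zero, smul_zero]
              refine Finset.Colex.toColex_lt_toColex_iff_exists_forall_lt.2 ⟨i, Finset.mem_erase.2 ⟨Ne.symm hli,
                Finset.mem_insert_self _ _⟩, hi, fun b hb hbS => ?_⟩
              have : b = l := by
                by_contra h
                exact hbS (Finset.mem_erase.2 ⟨h, Finset.mem_insert_of_mem hb⟩)
              subst this
              exact hmax b ((Finset.mem_insert.1 hlU).resolve_left hli)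
            · rw [hWd, WU_D D hcomm hpow l _ (by simpa using hlU), smul_zero]
          · intro h; exact absurd (Finset.mem_insert_self _ _) h
        refine ⟨Θ, h1, fun S hS => h2 S (fun h => hS (h.trans (Finset.subset_insert _ _))), ?_, ?_, ?_⟩
        · rw [hintr]; exact h3
        · rw [hintr, ← hAA]; exact h4
        · rw [← hAA]; exact h5
  obtain ⟨Θ, h1, h2, h3, h4, h5⟩ := main Finset.univ (fun _ _ _ _ => Finset.mem_univ _)
  rw [Finset.inter_univ] at h3 h4
  refine ⟨Θ, h1, h4.trans hA1, h3, fun S => ?_⟩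
  rw [h5, hA1, hA0, mul_inv_cancel₀ (pow_ne_zero _ hα), one_mul]

end Kato


section Core
universe u
variable {X : Type*} [LinearOrder X] [Fintype X]
variable {p : ℕ} [hpF : Fact p.Prime] {E : Type u} [Field E] [Algebra (ZMod p) E]
variable (D : X → Module.End (ZMod p) E) (hcomm : ∀ i j, Commute (D i) (D j))
variable (hpow : ∀ l, D l ^ p = D l) (hder : ∀ l, IsDer (D l))

include hpow hder in
lemma core_step (x : X → E) (hx : ∀ i, x i ≠ 0) (hDx : ∀ i, D i (x i) = x i) (hDx' : ∀ i j, i ≠ j → D i (x j) = 0)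
    (J : Set X) (hJ : ∀ i j, i ∉ J → j ∈ J → i < j) (ω : Finset X → E)
    (hω1 : ∀ S : Finset X, (∃ j ∈ S, j ∈ J) → ω S = 0)
    (α : Colex (Finset X)) : ∀ θ : Finset X → E, dd D (θ + ω) = 0 →
      (∀ S, WU D hcomm Finset.univ (θ S + ω S) = θ S ^ p) →
      (∃ j ∈ ofColex α, j ∈ J) → (θ (ofColex α) ≠ 0) →
      (∀ S : Finset X, (∃ j ∈ S, j ∈ J) → θ S ≠ 0 → toColex S ≤ α) →
    ∃ θ' : Finset X → E, dd D (θ' + ω) = 0 ∧ (∀ S, WU D hcomm Finset.univ (θ' S + ω S) = θ' S ^ p) ∧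
      ∀ S : Finset X, (∃ j ∈ S, j ∈ J) → θ' S = 0 := by
  haveI : CharP E p := charP_of_alg
  haveI : Finite (Colex (Finset X)) := inferInstanceAs (Finite (Finset X))
  induction α using WellFoundedLT.induction with
  | ind α ih =>
  intro θ h1 h2 h3 h4 h5
  have hα : (θ + ω) (ofColex α) = θ (ofColex α) := by simp [hω1 _ h3]
  obtain ⟨Θ, t1, t2, t3, t4⟩ := kato D hcomm hpow hder x hx hDx hDx' (θ + ω) h1 (ofColex α) (by
    intro S hS
    by_cases hSJ : ∃ j ∈ S, j ∈ J
    · rw [Pi.add_apply, hω1 S hSJ, add_zero]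
      by_contra h
      exact absurd (h5 S hSJ h) (not_le.2 hS)
    · exfalso
      obtain ⟨j, hj, hjJ⟩ := h3
      refine lt_asymm hS ?_
      refine Finset.Colex.toColex_lt_toColex_iff_exists_forall_lt.2 ⟨j, hj, fun h => hSJ ⟨j, h, hjJ⟩, ?_⟩
      intro b hb _
      exact hJ b j (fun h => hSJ ⟨b, hb, h⟩) hjJ) (by rw [hα]; exact h4) (by
    have := h2 (ofColex α)
    rw [hω1 _ h3, add_zero] at this; rw [hα, this])
  have n1 : dd D (θ - Θ + ω) = 0 := by
    have : θ - Θ + ω = (θ + ω) - Θ := by abel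
    rw [this, dd_sub, h1, t1, sub_zero]
  have n2 : ∀ S, WU D hcomm Finset.univ ((θ - Θ) S + ω S) = (θ - Θ) S ^ p := by
    intro S
    have : (θ - Θ) S + ω S = (θ S + ω S) - Θ S := by simp only [Pi.sub_apply]; ring
    rw [this, map_sub, h2, ← t4, Pi.sub_apply, sub_pow_char]
  classical
  let N : Finset (Finset X) := Finset.univ.filter (fun S => (∃ j ∈ S, j ∈ J) ∧ (θ - Θ) S ≠ 0)
  by_cases hN : N.Nonempty
  · obtain ⟨T, hT, hmax⟩ := Finset.exists_max_image N toColex hN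
    obtain ⟨hT1, hT2⟩ := (Finset.mem_filter.1 hT).2
    refine ih (toColex T) ?_ (θ - Θ) n1 n2 hT1 hT2 ?_
    · by_contra hlt
      apply hT2
      rcases eq_or_lt_of_le (not_lt.1 hlt) with h | h
      · have : T = ofColex α := by rw [h]; rfl
        rw [Pi.sub_apply, this, t2, hα, sub_self]
      · rw [Pi.sub_apply, t3 T h, sub_zero]
        by_contra h0
        exact absurd (h5 T hT1 h0) (not_le.2 h)
    · intro S hS1 hS2
      exact hmax S (Finset.mem_filter.2 ⟨Finset.mem_univ _, hS1, hS2⟩)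
  · refine ⟨θ - Θ, n1, n2, fun S hS => ?_⟩
    by_contra h
    exact hN ⟨S, Finset.mem_filter.2 ⟨Finset.mem_univ _, hS, h⟩⟩

include hcomm hpow hder in
theorem core (x : X → E) (hx : ∀ i, x i ≠ 0) (hDx : ∀ i, D i (x i) = x i) (hDx' : ∀ i j, i ≠ j → D i (x j) = 0)
    (J : Set X) (hJ : ∀ i j, i ∉ J → j ∈ J → i < j) (ω : Finset X → E)
    (hω1 : ∀ S : Finset X, (∃ j ∈ S, j ∈ J) → ω S = 0) (hω2 : ∀ j ∈ J, ∀ S, D j (ω S) = 0)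
    (θ η : Finset X → E) (heq : ∀ S, ω S = θ S ^ p - θ S + dd D η S) :
    ∃ θ' h : Finset X → E, (∀ S : Finset X, (∃ j ∈ S, j ∈ J) → θ' S = 0) ∧ (∀ j ∈ J, ∀ S, D j (θ' S) = 0) ∧
      (∀ S : Finset X, (∃ j ∈ S, j ∈ J) → h S = 0) ∧ (∀ j ∈ J, ∀ S, D j (h S) = 0) ∧
      ∀ S, ω S = θ' S ^ p - θ' S + dd D h S := by
  have h1 : dd D (θ + ω) = 0 := by
    have : θ + ω = (fun S => θ S ^ p) + dd D η := by
      ext S; simp only [Pi.add_apply, heq S]; ring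
    rw [this, dd_add, dd_dd D hcomm, add_zero]
    ext S
    apply Finset.sum_eq_zero
    intro i _
    rw [D_pth D hder, smul_zero]
  have h2 : ∀ S, WU D hcomm Finset.univ (θ S + ω S) = θ S ^ p := by
    intro S
    have : θ S + ω S = θ S ^ p + dd D η S := by rw [heq S]; ring
    rw [this, map_add, WU_of_zero D hcomm _ _ (fun i _ => D_pth D hder i _)]
    have e4 : WU D hcomm Finset.univ (dd D η S) = 0 := by
      unfold dd; rw [map_sum]
      apply Finset.sum_eq_zero
      intro i _
      rw [map_zsmul, WU_D D hcomm hpow i _ (Finset.mem_univ _), smul_zero]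
    rw [e4, add_zero]
  have : ∃ θ' : Finset X → E, dd D (θ' + ω) = 0 ∧ (∀ S, WU D hcomm Finset.univ (θ' S + ω S) = θ' S ^ p) ∧
      ∀ S : Finset X, (∃ j ∈ S, j ∈ J) → θ' S = 0 := by
    classical
    let N : Finset (Finset X) := Finset.univ.filter (fun S => (∃ j ∈ S, j ∈ J) ∧ θ S ≠ 0)
    by_cases hN : N.Nonempty
    · obtain ⟨T, hT, hmax⟩ := Finset.exists_max_image N toColex hN
      obtain ⟨hT1, hT2⟩ := (Finset.mem_filter.1 hT).2
      refine core_step D hcomm hpow hder x hx hDx hDx' J hJ ω hω1 (toColex T) θ h1 h2 hT1 hT2 ?_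
      intro S hS1 hS2
      exact hmax S (Finset.mem_filter.2 ⟨Finset.mem_univ _, hS1, hS2⟩)
    · refine ⟨θ, h1, h2, fun S hS => ?_⟩
      by_contra h
      exact hN ⟨S, Finset.mem_filter.2 ⟨Finset.mem_univ _, hS, h⟩⟩
  obtain ⟨θ', k1, k2, k3⟩ := this
  have g0 : ∀ S : Finset X, (∃ j ∈ S, j ∈ J) → (θ' + ω) S = 0 := fun S hS => by
    rw [Pi.add_apply, k3 S hS, hω1 S hS, add_zero]
  have k4 : ∀ j ∈ J, ∀ S, D j ((θ' + ω) S) = 0 := by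
    intro j hj S
    by_cases hS : ∃ j ∈ S, j ∈ J
    · rw [g0 S hS, map_zero]
    · have hjS : j ∉ S := fun h => hS ⟨j, h, hj⟩
      have c2 := congrFun k1 (insert j S)
      simp only [dd, Pi.zero_apply] at c2
      rw [Finset.sum_eq_single j] at c2
      · rw [Finset.erase_insert hjS] at c2
        have c3 := congrArg (fun y => sg j (insert j S) • y) c2
        simpa only [smul_smul, sg_mul_self, one_smul, smul_zero] using c3
      · intro l hl hlj
        rw [g0 _ ⟨j, Finset.mem_erase.2 ⟨Ne.symm hlj, Finset.mem_insert_self _ _⟩, hj⟩, map_zero, smul_zero]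
      · intro h; exact absurd (Finset.mem_insert_self _ _) h
  obtain ⟨h, ⟨hP1, hP2⟩, hh⟩ := homotopy_W D hcomm Finset.univ (θ' + ω) k1
    (fun h => (∀ S : Finset X, (∃ j ∈ S, j ∈ J) → h S = 0) ∧ (∀ j ∈ J, ∀ S, D j (h S) = 0))
    ⟨fun _ _ => rfl, fun _ _ _ => map_zero _⟩
    (fun a b ha hb => ⟨fun S hS => by rw [Pi.add_apply, ha.1 S hS, hb.1 S hS, add_zero],
      fun j hj S => by rw [Pi.add_apply, map_add, ha.2 j hj, hb.2 j hj, add_zero]⟩)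
    (by
      intro i _ V n
      by_cases hi : i ∈ J
      · exact Or.inr (k4 i hi)
      · left
        constructor
        · rintro S ⟨j, hj, hjJ⟩
          unfold ctr
          split_ifs
          · rfl
          · beta_reduce
            rw [g0 _ ⟨j, Finset.mem_insert_of_mem hj, hjJ⟩, map_zero, map_zero, smul_zero]
        · intro j hj S
          unfold ctr
          split_ifs
          · exact map_zero _
          · beta_reduce
            rw [map_zsmul]
            have c1 := (((hcomm j i).pow_right n).mul_right (D_WU_comm D hcomm j V)).eq
            have c2 := congrArg (fun T => T ((θ' + ω) (insert i S))) c1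
            simp only [Module.End.mul_apply] at c2
            rw [c2, k4 j hj, map_zero, map_zero, smul_zero])
  refine ⟨θ', h, k3, ?_, hP1, hP2, ?_⟩
  · intro j hj S
    have := k4 j hj S
    rwa [Pi.add_apply, map_add, hω2 j hj, add_zero] at this
  · intro S
    have := congrFun hh S
    rw [← this, Pi.add_apply, k2]; ring

end Core


section CoreInf
universe u
variable {X : Type*} [LinearOrder X]
variable {p : ℕ} [hpF : Fact p.Prime] {E : Type u} [Field E] [Algebra (ZMod p) E]
variable (D : X → Module.End (ZMod p) E) (hder : ∀ l, IsDer (D l))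

/-- constants for the derivations outside `U0` -/
def constField (U : Set X) : IntermediateField (ZMod p) E where
  carrier := {a | ∀ l ∉ U, D l a = 0}
  mul_mem' := by
    intro a b ha hb l hl
    rw [hder l, ha l hl, hb l hl]; ring
  add_mem' := by
    intro a b ha hb l hl
    rw [map_add, ha l hl, hb l hl, add_zero]
  algebraMap_mem' := by
    intro c l hl
    rw [Algebra.algebraMap_eq_smul_one, map_smul, (hder l).one, smul_zero]
  inv_mem' := by
    intro a ha l hl
    by_cases h0 : a = 0
    · simp [h0]
    · rw [(hder l).inv a h0, ha l hl]; simp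

lemma mem_constField (U : Set X) (a : E) : a ∈ constField D hder U ↔ ∀ l ∉ U, D l a = 0 := Iff.rfl

variable (hcomm : ∀ i j, Commute (D i) (D j))

/-- restricted derivation -/
def Drestr (U : Set X) (i : X) : Module.End (ZMod p) (constField D hder U) where
  toFun a := ⟨D i a, by
    intro l hl
    rw [← Module.End.mul_apply, (hcomm l i).eq, Module.End.mul_apply, a.2 l hl, map_zero]⟩
  map_add' a b := by ext; simp
  map_smul' c a := by ext; simp

lemma Drestr_coe (U : Set X) (i : X) (a : constField D hder U) : (Drestr D hder hcomm U i a : E) = D i a := rfl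

lemma Drestr_pow (U : Set X) (i : X) (n : ℕ) (a : constField D hder U) :
    (((Drestr D hder hcomm U i) ^ n) a : E) = ((D i) ^ n) a := by
  induction n generalizing a with
  | zero => rfl
  | succ n ih => rw [pow_succ, pow_succ, Module.End.mul_apply, Module.End.mul_apply, ih]; rfl

lemma sg_map (U : Set X) (S : Finset U) (i : U) :
    sg (i : X) (S.map (Function.Embedding.subtype _)) = sg i S := by
  unfold sg
  rw [Finset.filter_map, Finset.card_map]
  congr 1

lemma dd_restr (U : Set X) (f : Finset X → E) (f0 : Finset U → constField D hder U)
    (h : ∀ S : Finset U, (f0 S : E) = f (S.map (Function.Embedding.subtype _))) (S : Finset U) :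
    ((dd (fun i : U => Drestr D hder hcomm U i) f0 S : constField D hder U) : E) = dd D f (S.map (Function.Embedding.subtype _)) := by
  unfold dd
  rw [Finset.sum_map]
  push_cast
  refine Finset.sum_congr rfl fun i _ => ?_
  have e1 : sg ((Function.Embedding.subtype (fun y => y ∈ U)) i) (S.map (Function.Embedding.subtype _)) = sg i S := sg_map U S i
  rw [e1, Drestr_coe, h, Finset.map_erase]; rfl

include hcomm hder in
theorem core_inf (hpow : ∀ l, D l ^ p = D l)
    (x : X → E) (hx : ∀ i, x i ≠ 0) (hDx : ∀ i, D i (x i) = x i) (hDx' : ∀ i j, i ≠ j → D i (x j) = 0)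
    (J : Set X) (hJ : ∀ i j, i ∉ J → j ∈ J → i < j) (U : Finset X) (ω θ η : Finset X → E)
    (hω1 : ∀ S : Finset X, (∃ j ∈ S, j ∈ J) → ω S = 0) (hω2 : ∀ j ∈ J, ∀ S, D j (ω S) = 0)
    (hω3 : ∀ S, ¬ S ⊆ U → ω S = 0) 
    (hω4 : ∀ S, ∀ l ∉ U, D l (ω S) = 0) (hθ4 : ∀ S, ∀ l ∉ U, D l (θ S) = 0) (hη4 : ∀ S, ∀ l ∉ U, D l (η S) = 0)
    (heq : ∀ S, ω S = θ S ^ p - θ S + dd D η S) :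
    ∃ θ' h : Finset X → E, (∀ S : Finset X, (∃ j ∈ S, j ∈ J) → θ' S = 0) ∧ (∀ j ∈ J, ∀ S, D j (θ' S) = 0) ∧
      (∀ S : Finset X, (∃ j ∈ S, j ∈ J) → h S = 0) ∧ (∀ j ∈ J, ∀ S, D j (h S) = 0) ∧
      (∀ S, ¬ S ⊆ U → θ' S = 0) ∧ (∀ S, ¬ S ⊆ U → h S = 0) ∧
      ∀ S, ω S = θ' S ^ p - θ' S + dd D h S := by
  have hp := hpF.out
  let E0 := constField D hder (U : Set X)
  let D0 : ↥(U : Set X) → Module.End (ZMod p) E0 := fun i => Drestr D hder hcomm U i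
  have hx0 : ∀ i : ↥(U : Set X), x i ∈ E0 := fun i l hl => hDx' l i (fun h => hl (h ▸ i.2))
  let ι : ↥(U : Set X) ↪ X := Function.Embedding.subtype _
  let tr : (f : Finset X → E) → (∀ S, ∀ l ∉ U, D l (f S) = 0) → Finset ↥(U : Set X) → E0 :=
    fun f hf S => ⟨f (S.map ι), hf _⟩
  obtain ⟨t, h, h1, h2, h3, h4, h5⟩ := core D0
    (fun i j => LinearMap.ext fun a => Subtype.ext (congrArg (fun T => T (a : E)) (hcomm i j).eq))
    (fun l => LinearMap.ext fun a => Subtype.ext (by rw [Drestr_pow, hpow]; rfl))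
    (fun l a b => Subtype.ext (hder l a b))
    (fun i => ⟨x i, hx0 i⟩) (fun i h => hx i (congrArg Subtype.val h))
    (fun i => Subtype.ext (hDx i)) (fun i j hij => Subtype.ext (hDx' i j (fun h => hij (Subtype.ext h))))
    {i | (i : X) ∈ J} (fun i j hi hj => hJ i j hi hj) (tr ω hω4)
    (by
      rintro S ⟨j, hj, hjJ⟩
      exact Subtype.ext (hω1 _ ⟨j, Finset.mem_map_of_mem ι hj, hjJ⟩))
    (fun j hj S => Subtype.ext (hω2 j hj _)) (tr θ hθ4) (tr η hη4)
    (fun S => Subtype.ext (by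
      have e1 := dd_restr D hder hcomm (U : Set X) η (tr η hη4) (fun S => rfl) S
      have e2 := heq (S.map ι)
      push_cast
      rw [e1]; exact e2))
  let ex : (Finset ↥(U : Set X) → E0) → Finset X → E := fun f S =>
    if S ⊆ U then f (S.subtype (fun y => y ∈ (U : Set X))) else 0
  have ex_map : ∀ f S, ex f (S.map ι) = f S := by
    intro f S
    have : S.map ι ⊆ U := by
      intro y hy
      obtain ⟨z, _, rfl⟩ := Finset.mem_map.1 hy
      exact z.2
    simp only [ex, if_pos this]
    congr 2
    ext y
    simp [ι]
  have ex_cas : ∀ S : Finset X, S ⊆ U → ∃ S0 : Finset ↥(U : Set X), S = S0.map ι := by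
    intro S hS
    refine ⟨S.subtype (fun y => y ∈ (U : Set X)), ?_⟩
    ext y
    simp only [Finset.mem_map, Finset.mem_subtype, ι]
    constructor
    · intro hy; exact ⟨⟨y, hS hy⟩, hy, rfl⟩
    · rintro ⟨z, hz, rfl⟩; exact hz
  have ex_not : ∀ f S, ¬ S ⊆ U → ex f S = 0 := fun f S hS => if_neg hS
  have exJ : ∀ f : Finset ↥(U : Set X) → E0, (∀ S, (∃ j ∈ S, j ∈ {i : ↥(U : Set X) | (i : X) ∈ J}) → f S = 0) →
      ∀ S : Finset X, (∃ j ∈ S, j ∈ J) → ex f S = 0 := by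
    intro f hf S hS
    by_cases hSU : S ⊆ U
    · obtain ⟨S0, rfl⟩ := ex_cas S hSU
      rw [ex_map, hf, ZeroMemClass.coe_zero]
      obtain ⟨j, hj, hjJ⟩ := hS
      obtain ⟨z, hz, rfl⟩ := Finset.mem_map.1 hj
      exact ⟨z, hz, hjJ⟩
    · exact ex_not _ _ hSU
  have exU : ∀ (f : Finset ↥(U : Set X) → E0) S, ∀ l ∉ U, D l (ex f S) = 0 := by
    intro f S l hl
    simp only [ex]
    split_ifs
    · exact (f _).2 l hl
    · exact map_zero _
  have exD : ∀ f : Finset ↥(U : Set X) → E0, (∀ j ∈ {i : ↥(U : Set X) | (i : X) ∈ J}, ∀ S, D0 j (f S) = 0) →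
      ∀ j ∈ J, ∀ S, D j (ex f S) = 0 := by
    intro f hf j hj S
    by_cases hjU : j ∈ U
    · by_cases hSU : S ⊆ U
      · obtain ⟨S0, rfl⟩ := ex_cas S hSU
        rw [ex_map]
        exact congrArg Subtype.val (hf ⟨j, hjU⟩ hj S0)
      · rw [ex_not _ _ hSU, map_zero]
    · exact exU f S j hjU
  refine ⟨ex t, ex h, exJ t h1, exD t h2, exJ h h3, exD h h4, ex_not t, ex_not h, ?_⟩
  intro S
  by_cases hSU : S ⊆ U
  · obtain ⟨S0, rfl⟩ := ex_cas S hSU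
    have e1 := dd_restr D hder hcomm (U : Set X) (ex h) h (fun S => (ex_map h S).symm) S0
    have e2 := congrArg Subtype.val (h5 S0)
    push_cast at e2
    rw [ex_map]
    exact e2.trans (congrArg _ e1)
  · rw [hω3 S hSU, ex_not _ _ hSU, zero_pow hp.ne_zero, sub_zero, zero_add]
    symm
    apply Finset.sum_eq_zero
    intro i hi
    by_cases hiU : i ∈ U
    · rw [ex_not, map_zero, smul_zero]
      intro h6
      apply hSU
      intro y hy
      by_cases hyi : y = i
      · exact hyi ▸ hiU
      · exact h6 (Finset.mem_erase.2 ⟨hyi, hy⟩)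
    · rw [exU _ _ i hiU, smul_zero]

end CoreInf


section Forms

lemma dLog_eq {F : Type*} [Field F] (a : F) : dLog F a = a⁻¹ • dForm F a := by
  unfold dLog dForm; rw [map_smul]

lemma logForm_zero {F : Type*} [Field F] (x : Fin 0 → F) : logForm F x = 1 := by
  simp [logForm]

lemma logForm_succ {F : Type*} [Field F] {n : ℕ} (x : Fin (n+1) → F) :
    logForm F x = dLog F (x 0) * logForm F (fun i => x i.succ) := by
  unfold logForm; rw [List.ofFn_succ, List.prod_cons]

lemma range_iota (F : Type*) [Field F] : LinearMap.range (ExteriorAlgebra.ι F :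
    KaehlerDifferential ℤ F →ₗ[F] DF F) = Submodule.span F {w | ∃ x : F, x ≠ 0 ∧ dLog F x = w} := by
  apply le_antisymm
  · rw [LinearMap.range_eq_map, ← KaehlerDifferential.span_range_derivation ℤ F, Submodule.map_span, Submodule.span_le]
    rintro _ ⟨_, ⟨a, rfl⟩, rfl⟩
    by_cases ha : a = 0
    · subst ha; simp
    · have : ExteriorAlgebra.ι F ((KaehlerDifferential.D ℤ F) a) = a • dLog F a := by
        unfold dLog; rw [← map_smul, smul_smul, mul_inv_cancel₀ ha, one_smul]
      rw [this]
      exact Submodule.smul_mem _ _ (Submodule.subset_span ⟨a, ha, rfl⟩)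
  · rw [Submodule.span_le]
    rintro _ ⟨a, ha, rfl⟩
    exact ⟨_, rfl⟩

lemma omegaPow_eq (F : Type*) [Field F] (n : ℕ) :
    omegaPow F n = Submodule.span F {w | ∃ y : Fin n → F, (∀ i, y i ≠ 0) ∧ logForm F y = w} := by
  unfold omegaPow
  rw [range_iota, Submodule.span_pow]
  congr 1
  ext w
  rw [Set.mem_pow]
  constructor
  · rintro ⟨f, rfl⟩
    choose g hg1 hg2 using fun i => (f i).2
    exact ⟨g, hg1, by unfold logForm; simp only [hg2]⟩
  · rintro ⟨y, hy, rfl⟩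
    exact ⟨fun i => ⟨dLog F (y i), y i, hy i, rfl⟩, rfl⟩

lemma logForm_mem {F : Type*} [Field F] {n : ℕ} (y : Fin n → F) : logForm F y ∈ omegaPow F n := by
  unfold omegaPow logForm
  induction n with
  | zero => simp
  | succ n ih =>
    rw [List.ofFn_succ, List.prod_cons, pow_succ']
    exact Submodule.mul_mem_mul ⟨_, rfl⟩ (ih _)

lemma omega_induction {F : Type*} [Field F] {n : ℕ} (Q : DF F → Prop) (h0 : Q 0)
    (hadd : ∀ a b, Q a → Q b → Q (a + b))
    (hL : ∀ (a : F) (y : Fin n → F), (∀ i, y i ≠ 0) → Q (a • logForm F y)) : ∀ ω ∈ omegaPow F n, Q ω := by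
  intro ω hω
  rw [omegaPow_eq] at hω
  suffices h : ∀ c : F, Q (c • ω) by simpa using h 1
  induction hω using Submodule.span_induction with
  | mem x h => obtain ⟨y, hy, rfl⟩ := h; exact fun c => hL c y hy
  | zero => intro c; rw [smul_zero]; exact h0
  | add x y _ _ hx hy => intro c; rw [smul_add]; exact hadd _ _ (hx c) (hy c)
  | smul a x _ hx => intro c; rw [smul_smul]; exact hx _

lemma iota_sq {F : Type*} [Field F] (m : KaehlerDifferential ℤ F) (w : DF F) :
    ExteriorAlgebra.ι F m * (ExteriorAlgebra.ι F m * w) = 0 := by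
  rw [← mul_assoc, ExteriorAlgebra.ι_sq_zero, zero_mul]

lemma dForm_inv {F : Type*} [Field F] (y : F) (hy : y ≠ 0) : dForm F (y⁻¹) = (- (y⁻¹)^2) • dForm F y := by
  unfold dForm
  rw [← map_smul]
  congr 1
  have := Derivation.leibniz (KaehlerDifferential.D ℤ F) y y⁻¹
  rw [mul_inv_cancel₀ hy, Derivation.map_one_eq_zero] at this
  have h2 : y • (KaehlerDifferential.D ℤ F) y⁻¹ = - (y⁻¹ • (KaehlerDifferential.D ℤ F) y) :=
    eq_neg_of_add_eq_zero_left this.symm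
  have h3 := congrArg (fun z => y⁻¹ • z) h2
  simp only [smul_smul, inv_mul_cancel₀ hy, one_smul, smul_neg] at h3
  rw [h3, neg_smul, sq]

lemma d_logForm {p : ℕ} {F : Type*} [Field F] (S : DiffStr p F) {n : ℕ} (y : Fin n → F) (hy : ∀ i, y i ≠ 0) :
    S.d (logForm F y) = 0 := by
  induction n with
  | zero => rw [logForm_zero, S.d_one]
  | succ n ih =>
    have h1 := ih (fun i => y i.succ) (fun i => hy _)
    have h2 := S.d_smul (y 0) (logForm F fun i => y i.succ)
    rw [h1, smul_zero, add_zero] at h2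
    rw [logForm_succ, dLog_eq, smul_mul_assoc, S.d_smul, ← h2, S.d_d, smul_zero, add_zero, h2, dForm_inv _ (hy 0),
      smul_mul_assoc]
    unfold dForm
    rw [iota_sq, smul_zero]

end Forms

section Coord
universe u
variable {X : Type*} [LinearOrder X]
variable {p : ℕ} [hpF : Fact p.Prime] {E : Type u} [Field E] [Algebra (ZMod p) E]
variable (B : Module.Basis X E (KaehlerDifferential ℤ E)) (x : X → E)

/-- dual derivation -/
def Dl (l : X) : Module.End (ZMod p) E :=
  AddMonoidHom.toZModLinearMap p
    ((B.coord l).toAddMonoidHom.comp (KaehlerDifferential.D ℤ E).toLinearMap.toAddMonoidHom)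

lemma Dl_apply (l : X) (a : E) : Dl (p := p) B l a = B.repr (KaehlerDifferential.D ℤ E a) l := rfl

lemma Dl_der (l : X) : IsDer (Dl (p := p) B l) := by
  intro a b
  simp only [Dl_apply, Derivation.leibniz, map_add, map_smul, Finsupp.add_apply, Finsupp.smul_apply, smul_eq_mul]
  ring

omit [LinearOrder X] in
lemma der_ext (hx : ∀ i, x i ≠ 0) (hB : ∀ l, B l = (x l)⁻¹ • KaehlerDifferential.D ℤ E (x l))
    (δ : Module.End (ZMod p) E) (hδ : IsDer δ) (h : ∀ l, δ (x l) = 0) : δ = 0 := by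
  let d : Derivation ℤ E E := Derivation.mk' (δ.toAddMonoidHom.toIntLinearMap) (by
    intro a b
    have := hδ a b
    change δ (a * b) = a • δ b + b • δ a
    rw [this, smul_eq_mul, smul_eq_mul]; ring)
  have h1 : d.liftKaehlerDifferential = 0 := by
    apply B.ext
    intro l
    rw [hB, map_smul, Derivation.liftKaehlerDifferential_comp_D]
    change (x l)⁻¹ • δ (x l) = 0
    rw [h, smul_zero]
  ext a
  change d a = 0
  rw [← Derivation.liftKaehlerDifferential_comp_D, h1]; rfl

variable (hx : ∀ i, x i ≠ 0) (hB : ∀ l, B l = (x l)⁻¹ • KaehlerDifferential.D ℤ E (x l))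

include hx hB in
lemma Dl_x (l m : X) : Dl (p := p) B l (x m) = if l = m then x m else 0 := by
  have : KaehlerDifferential.D ℤ E (x m) = x m • B m := by
    rw [hB, smul_smul, mul_inv_cancel₀ (hx m), one_smul]
  rw [Dl_apply, this, map_smul, B.repr_self, Finsupp.smul_apply, Finsupp.single_apply]
  by_cases h : l = m
  · simp [h]
  · simp [h, Ne.symm h]

include hx hB in
lemma Dl_comm (i j : X) : Commute (Dl (p := p) B i) (Dl (p := p) B j) := by
  have := der_ext B x hx hB (Dl (p := p) B i * Dl (p := p) B j - Dl (p := p) B j * Dl (p := p) B i) (by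
    intro a b
    simp only [LinearMap.sub_apply, Module.End.mul_apply, Dl_der B i _ _, Dl_der B j _ _, map_add]
    ring) (by
    intro l
    simp only [LinearMap.sub_apply, Module.End.mul_apply, Dl_x B x hx hB, apply_ite (Dl (p := p) B i),
      apply_ite (Dl (p := p) B j), map_zero]
    split_ifs <;> simp_all)
  exact sub_eq_zero.1 this

include hx hB in
lemma Dl_pow (i : X) : (Dl (p := p) B i) ^ p = Dl (p := p) B i := by
  have := der_ext B x hx hB ((Dl (p := p) B i)^p - Dl (p := p) B i) (by
    intro a b
    rw [LinearMap.sub_apply, leibniz_pow_p _ _ _ (Dl_der B i)]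
    simp only [LinearMap.sub_apply, Dl_der B i a b]
    ring) (by
    intro l
    have h2 : ∀ n, ((Dl (p := p) B i)^(n+1)) (x l) = if i = l then x l else 0 := by
      intro n
      induction n with
      | zero => rw [zero_add, pow_one, Dl_x B x hx hB]
      | succ n ih =>
        rw [pow_succ', Module.End.mul_apply, ih, apply_ite (Dl (p := p) B i), map_zero, Dl_x B x hx hB]
        split_ifs <;> rfl
    have h3 := h2 (p-1)
    rw [Nat.sub_add_cancel hpF.out.one_le] at h3
    rw [LinearMap.sub_apply, h3, Dl_x B x hx hB, sub_self])
  exact sub_eq_zero.1 this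

lemma Dl_fin (a : E) : ∃ U : Finset X, ∀ l ∉ U, Dl (p := p) B l a = 0 :=
  ⟨(B.repr (KaehlerDifferential.D ℤ E a)).support, fun _ hl => Finsupp.notMem_support_iff.1 hl⟩

/-- left multiplication by a one form as linear map -/
def wdgL : (KaehlerDifferential ℤ E) →ₗ[E] Module.End E (Finset X → E) where
  toFun m :=
    { toFun := fun f => wdg (fun i => B.repr m i) f
      map_add' := fun f g => wdg_add _ f g
      map_smul' := fun c f => by
        ext S; simp only [wdg, Pi.smul_apply, smul_eq_mul, RingHom.id_apply, Finset.mul_sum, mul_smul_comm]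
        refine Finset.sum_congr rfl fun i _ => ?_
        congr 1; ring }
  map_add' m m' := by
    ext f S
    simp only [map_add, LinearMap.coe_mk, AddHom.coe_mk, LinearMap.add_apply, Pi.add_apply]
    exact congrFun (wdg_add_left (fun i => B.repr m i) (fun i => B.repr m' i) _) S
  map_smul' c m := by
    ext f S
    simp only [map_smul, LinearMap.coe_mk, AddHom.coe_mk, LinearMap.smul_apply, Pi.smul_apply, RingHom.id_apply,
      wdg, Finsupp.smul_apply, smul_eq_mul, Finset.mul_sum, mul_smul_comm, mul_assoc]

/-- coordinates of forms -/
def phi : DF E →ₗ[E] (Finset X → E) :=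
  (LinearMap.applyₗ (R := E) (fun S : Finset X => if S = ∅ then (1 : E) else 0)).comp
    (ExteriorAlgebra.lift E ⟨wdgL B, fun m => LinearMap.ext fun f => wdg_wdg (fun i => B.repr m i) f⟩).toLinearMap

lemma phi_mul (m : KaehlerDifferential ℤ E) (w : DF E) :
    phi B (ExteriorAlgebra.ι E m * w) = wdg (fun i => B.repr m i) (phi B w) := by
  simp only [phi, LinearMap.comp_apply, AlgHom.toLinearMap_apply, map_mul, ExteriorAlgebra.lift_ι_apply]
  rfl

lemma phi_one : phi B 1 = fun S : Finset X => if S = ∅ then (1 : E) else 0 := by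
  simp only [phi, LinearMap.comp_apply, AlgHom.toLinearMap_apply, map_one]
  rfl

lemma phi_dForm (a : E) (w : DF E) :
    phi B (dForm E a * w) = wdg (fun i => Dl (p := p) B i a) (phi B w) := phi_mul B _ _

lemma phi_dLog (a : E) (w : DF E) :
    phi B (dLog E a * w) = wdg (fun i => a⁻¹ * Dl (p := p) B i a) (phi B w) := by
  unfold dLog; rw [phi_mul]; simp only [map_smul, Finsupp.smul_apply, smul_eq_mul]; rfl

end Coord


section Nice
universe u
variable {X : Type*} [LinearOrder X]
variable {p : ℕ} [hpF : Fact p.Prime] {E : Type u} [Field E] [Algebra (ZMod p) E]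
variable (D : X → Module.End (ZMod p) E)

/-- finiteness of a coordinate form -/
def Nice (f : Finset X → E) : Prop :=
  ∃ U : Finset X, ∀ S, (¬ S ⊆ U → f S = 0) ∧ ∀ l ∉ U, D l (f S) = 0

/-- finiteness of a coordinate one form -/
def Nice1 (lam : X → E) : Prop :=
  ∃ U : Finset X, ∀ i, (i ∉ U → lam i = 0) ∧ ∀ l ∉ U, D l (lam i) = 0

lemma Nice.add {f g : Finset X → E} (hf : Nice D f) (hg : Nice D g) : Nice D (f + g) := by
  obtain ⟨U, hU⟩ := hf
  obtain ⟨V, hV⟩ := hg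
  refine ⟨U ∪ V, fun S => ⟨fun hS => ?_, fun l hl => ?_⟩⟩
  · rw [Pi.add_apply, (hU S).1 (fun h => hS (h.trans Finset.subset_union_left)),
      (hV S).1 (fun h => hS (h.trans Finset.subset_union_right)), add_zero]
  · rw [Pi.add_apply, map_add, (hU S).2 l (fun h => hl (Finset.mem_union_left _ h)),
      (hV S).2 l (fun h => hl (Finset.mem_union_right _ h)), add_zero]

lemma Nice.neg {f : Finset X → E} (hf : Nice D f) : Nice D (-f) := by
  obtain ⟨U, hU⟩ := hf
  refine ⟨U, fun S => ⟨fun hS => ?_, fun l hl => ?_⟩⟩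
  · rw [Pi.neg_apply, (hU S).1 hS, neg_zero]
  · rw [Pi.neg_apply, map_neg, (hU S).2 l hl, neg_zero]

lemma Nice.zero : Nice D (0 : Finset X → E) := ⟨∅, fun S => ⟨fun _ => rfl, fun _ _ => map_zero _⟩⟩

variable (hder : ∀ l, IsDer (D l)) (hcomm : ∀ i j, Commute (D i) (D j))
  (hfin : ∀ a, ∃ U : Finset X, ∀ l ∉ U, D l a = 0)

include hder hfin in
lemma Nice.smul {f : Finset X → E} (a : E) (hf : Nice D f) : Nice D (fun S => a * f S) := by
  obtain ⟨U, hU⟩ := hf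
  obtain ⟨V, hV⟩ := hfin a
  refine ⟨U ∪ V, fun S => ⟨fun hS => ?_, fun l hl => ?_⟩⟩
  · beta_reduce; rw [(hU S).1 (fun h => hS (h.trans Finset.subset_union_left)), mul_zero]
  · beta_reduce; rw [hder l, (hU S).2 l (fun h => hl (Finset.mem_union_left _ h)),
      hV l (fun h => hl (Finset.mem_union_right _ h))]; ring

include hder in
lemma Nice.wdg {f : Finset X → E} {lam : X → E} (hl : Nice1 D lam) (hf : Nice D f) : Nice D (wdg lam f) := by
  obtain ⟨U, hU⟩ := hf
  obtain ⟨V, hV⟩ := hl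
  refine ⟨U ∪ V, fun S => ⟨fun hS => ?_, fun l hl => ?_⟩⟩
  · apply Finset.sum_eq_zero
    intro i hi
    by_cases hiV : i ∈ V
    · rw [(hU _).1, mul_zero, smul_zero]
      intro h
      apply hS
      intro y hy
      by_cases hyi : y = i
      · subst hyi; exact Finset.mem_union_right _ hiV
      · exact Finset.mem_union_left _ (h (Finset.mem_erase.2 ⟨hyi, hy⟩))
    · rw [(hV i).1 hiV, zero_mul, smul_zero]
  · unfold _root_.wdg
    rw [map_sum]
    apply Finset.sum_eq_zero
    intro i hi
    rw [map_zsmul, hder l, (hU _).2 l (fun h => hl (Finset.mem_union_left _ h)),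
      (hV _).2 l (fun h => hl (Finset.mem_union_right _ h))]; simp

include hcomm in
lemma Nice.dd {f : Finset X → E} (hf : Nice D f) : Nice D (dd D f) := by
  obtain ⟨U, hU⟩ := hf
  refine ⟨U, fun S => ⟨fun hS => ?_, fun l hl => ?_⟩⟩
  · apply Finset.sum_eq_zero
    intro i hi
    by_cases hiV : i ∈ U
    · rw [(hU _).1, map_zero, smul_zero]
      intro h
      apply hS
      intro y hy
      by_cases hyi : y = i
      · subst hyi; exact hiV
      · exact (h (Finset.mem_erase.2 ⟨hyi, hy⟩))
    · rw [(hU _).2 i hiV, smul_zero]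
  · unfold _root_.dd
    rw [map_sum]
    apply Finset.sum_eq_zero
    intro i hi
    rw [map_zsmul, ← Module.End.mul_apply, (hcomm l i).eq, Module.End.mul_apply, (hU _).2 l hl, map_zero, smul_zero]

include hcomm hfin in
omit [LinearOrder X] in
lemma Nice1.der (a : E) : Nice1 D (fun i => D i a) := by
  obtain ⟨V, hV⟩ := hfin a
  refine ⟨V, fun i => ⟨fun h => hV i h, fun l hl => ?_⟩⟩
  rw [← Module.End.mul_apply, (hcomm l i).eq, Module.End.mul_apply, hV l hl, map_zero]

include hcomm hfin hder in
omit [LinearOrder X] in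
lemma Nice1.dlog (a : E) (ha : a ≠ 0) : Nice1 D (fun i => a⁻¹ * D i a) := by
  obtain ⟨V, hV⟩ := hfin a
  refine ⟨V, fun i => ⟨fun h => by beta_reduce; rw [hV i h, mul_zero], fun l hl => ?_⟩⟩
  rw [hder l, (hder l).inv a ha, ← Module.End.mul_apply (D l), (hcomm l i).eq, Module.End.mul_apply, hV l hl, map_zero]
  ring

include hder hcomm in
omit [LinearOrder X] in
lemma dlog_closed (a : E) (ha : a ≠ 0) (i j : X) : D i (a⁻¹ * D j a) = D j (a⁻¹ * D i a) := by
  have := congrArg (fun T => T a) (hcomm i j).eq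
  simp only [Module.End.mul_apply] at this
  rw [hder i, hder j, (hder i).inv a ha, (hder j).inv a ha, this]
  ring

/-- logarithmic one forms are fixed by the Cartier operator -/
lemma dlog_pth (hder : ∀ l, IsDer (D l)) (hcomm : ∀ i j, Commute (D i) (D j))
    (hfin : ∀ a, ∃ U : Finset X, ∀ l ∉ U, D l a = 0) (hpow : ∀ l, D l ^ p = D l) (a : E) (ha : a ≠ 0) :
    ∃ mu : E, ∀ i, (a⁻¹ * D i a) ^ p = a⁻¹ * D i a - D i mu := by
  have hp := hpF.out
  obtain ⟨U, hU⟩ := hfin a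
  obtain ⟨mu, hmu⟩ := one_form_homotopy D hcomm (fun i => a⁻¹ * D i a) (fun i j => dlog_closed D hder hcomm a ha i j) U
  refine ⟨mu, fun i => ?_⟩
  rw [← hmu i, sub_sub_cancel]
  by_cases hi : i ∈ U
  · have h1 := logder_pow (hder i) (hpow i) a (a⁻¹ * D i a) (IsUnit.mk0 a ha) (by field_simp)
    have h2 : (a⁻¹ * D i a) ^ p = W1 D i (a⁻¹ * D i a) := h1
    rw [← Finset.insert_erase hi, WU_insert _ _ _ _ (Finset.notMem_erase _ _),
            (W1_WU_comm D hcomm i _).eq, Module.End.mul_apply, ← h2, WU_of_zero]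
    intro l _
    exact D_pth D hder l _
  · rw [hU i hi, mul_zero, zero_pow hp.ne_zero, map_zero]

end Nice

section PhiRel
universe u
variable {X : Type*} [LinearOrder X]
variable {p : ℕ} [hpF : Fact p.Prime] {E : Type u} [Field E] [Algebra (ZMod p) E]
variable (B : Module.Basis X E (KaehlerDifferential ℤ E)) (x : X → E)
variable (hx : ∀ i, x i ≠ 0) (hB : ∀ l, B l = (x l)⁻¹ • KaehlerDifferential.D ℤ E (x l))

local notation "𝔇" => Dl (p := p) B

include hx hB in
lemma phi_log_dd {n : ℕ} (y : Fin n → E) (hy : ∀ i, y i ≠ 0) : dd 𝔇 (phi B (logForm E y)) = 0 := by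
  induction n with
  | zero =>
    rw [logForm_zero, phi_one]
    ext S
    apply Finset.sum_eq_zero
    intro i _
    beta_reduce
    split_ifs
    · rw [(Dl_der B i).one, smul_zero]
    · rw [map_zero, smul_zero]
  | succ n ih =>
    rw [logForm_succ, phi_dLog (p := p)]
    have h1 := dd_wdg 𝔇 (Dl_der B) (fun i => (y 0)⁻¹ * Dl (p := p) B i (y 0))
      (fun i j => dlog_closed 𝔇 (Dl_der B) (Dl_comm B x hx hB) (y 0) (hy 0) i j)
      (phi B (logForm E fun i => y i.succ))
    rw [ih _ (fun i => hy _)] at h1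
    rw [← h1]
    ext S; simp [wdg]

include hx hB in
lemma phi_log_nice {n : ℕ} (y : Fin n → E) (hy : ∀ i, y i ≠ 0) : Nice 𝔇 (phi B (logForm E y)) := by
  induction n with
  | zero =>
    rw [logForm_zero, phi_one]
    refine ⟨∅, fun S => ⟨fun hS => if_neg (fun h => hS h.le), fun l _ => ?_⟩⟩
    beta_reduce
    split_ifs
    · rw [(Dl_der B l).one]
    · rw [map_zero]
  | succ n ih =>
    rw [logForm_succ, phi_dLog (p := p)]
    exact (ih _ (fun i => hy _)).wdg 𝔇 (Dl_der B) (Nice1.dlog 𝔇 (Dl_der B) (Dl_comm B x hx hB) (Dl_fin B) (y 0) (hy 0))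

include hx hB in
lemma phi_nice {n : ℕ} (ω : DF E) (hω : ω ∈ omegaPow E n) : Nice 𝔇 (phi B ω) := by
  refine omega_induction (fun ω => Nice 𝔇 (phi B ω)) ?_ ?_ ?_ ω hω
  · rw [map_zero]; exact Nice.zero _
  · intro a b ha hb; rw [map_add]; exact ha.add _ hb
  · intro a y hy
    rw [map_smul]
    exact (phi_log_nice B x hx hB y hy).smul 𝔇 (Dl_der B) (Dl_fin B) a

include hx hB in
lemma phi_d (S : DiffStr p E) {n : ℕ} (ω : DF E) (hω : ω ∈ omegaPow E n) : phi B (S.d ω) = dd 𝔇 (phi B ω) := by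
  refine omega_induction (fun ω => phi B (S.d ω) = dd 𝔇 (phi B ω)) ?_ ?_ ?_ ω hω
  · rw [map_zero, map_zero, dd_zero]
  · intro a b ha hb
    rw [map_add, map_add, map_add, ha, hb, dd_add]
  · intro a y hy
    have h1 := dd_smul 𝔇 (Dl_der B) a (phi B (logForm E y))
    rw [phi_log_dd B x hx hB y hy] at h1
    rw [S.d_smul, d_logForm S y hy, smul_zero, add_zero, phi_dForm (p := p), map_smul]
    refine Eq.trans ?_ h1.symm
    ext S; simp

include hx hB in
lemma phi_log_pth {n : ℕ} (y : Fin n → E) (hy : ∀ i, y i ≠ 0) :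
    ∃ h, Nice 𝔇 h ∧ (fun S => phi B (logForm E y) S ^ p) = phi B (logForm E y) + dd 𝔇 h := by
  have hp := hpF.out
  haveI : CharP E p := charP_of_alg
  induction n with
  | zero =>
    refine ⟨0, Nice.zero _, ?_⟩
    rw [logForm_zero, phi_one, dd_zero, add_zero]
    ext S
    split_ifs
    · simp_all
    · simp_all [hp.ne_zero]
  | succ n ih =>
    obtain ⟨h, hN, hh⟩ := ih (fun i => y i.succ) (fun i => hy _)
    have hcl := phi_log_dd (p := p) B x hx hB (fun i => y i.succ) (fun i => hy _)
    have hnl := phi_log_nice (p := p) B x hx hB (fun i => y i.succ) (fun i => hy _)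
    set g := phi B (logForm E fun i => y i.succ) with hg
    obtain ⟨mu, hmu⟩ := dlog_pth 𝔇 (Dl_der B) (Dl_comm B x hx hB) (Dl_fin B) (Dl_pow B x hx hB) (y 0) (hy 0)
    rw [logForm_succ, phi_dLog (p := p)]
    set lam : X → E := fun i => (y 0)⁻¹ * Dl (p := p) B i (y 0) with hlam
    have hlN : Nice1 𝔇 lam := Nice1.dlog 𝔇 (Dl_der B) (Dl_comm B x hx hB) (Dl_fin B) (y 0) (hy 0)
    have e1 : (fun i => lam i ^ p) = lam + fun i => Dl (p := p) B i (-mu) := by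
      ext i; simp only [Pi.add_apply, map_neg]; rw [hlam]; beta_reduce; rw [hmu i]; ring
    have e2 : (fun S => g S ^ p) = g + dd 𝔇 h := hh
    have e3 : dd 𝔇 (g + dd 𝔇 h) = 0 := by
      rw [dd_add, hcl, dd_dd 𝔇 (Dl_comm B x hx hB), add_zero]
    have e4 := dd_wdg 𝔇 (Dl_der B) lam
      (fun i j => dlog_closed 𝔇 (Dl_der B) (Dl_comm B x hx hB) (y 0) (hy 0) i j) h
    have e5 := dd_smul 𝔇 (Dl_der B) (-mu) (g + dd 𝔇 h)
    rw [e3] at e5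
    refine ⟨-(wdg lam h) + fun S => -mu * (g + dd 𝔇 h) S, ?_, ?_⟩
    · refine ((hN.wdg 𝔇 (Dl_der B) hlN).neg 𝔇).add 𝔇 ?_
      exact ((hnl.add 𝔇 (hN.dd 𝔇 (Dl_comm B x hx hB)))).smul 𝔇 (Dl_der B) (Dl_fin B) _
    · have e6 : (fun S => wdg lam g S ^ p) = wdg (fun i => lam i ^ p) (fun S => g S ^ p) := by
        ext S; exact wdg_pow _ _ _
      rw [e6, e1, e2, wdg_add_left, dd_add, e5, wdg_add]
      have e7 : dd 𝔇 (-(wdg lam h)) = wdg lam (dd 𝔇 h) := by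
        have : -(wdg lam h) = 0 - wdg lam h := by abel
        rw [this, dd_sub, dd_zero, zero_sub]
        exact neg_eq_of_add_eq_zero_right e4
      rw [e7, add_assoc]
      congr 2
      ext S; simp

include hx hB in
lemma phi_sp (S : DiffStr p E) {n : ℕ} (ω : DF E) (hω : ω ∈ omegaPow E n) :
    ∃ h, Nice 𝔇 h ∧ phi B (S.sp ω) = (fun S => phi B ω S ^ p) + dd 𝔇 h := by
  have hp := hpF.out
  haveI : CharP E p := charP_of_alg
  refine omega_induction (fun ω => ∃ h, Nice 𝔇 h ∧ phi B (S.sp ω) = (fun S => phi B ω S ^ p) + dd 𝔇 h) ?_ ?_ ?_ ω hω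
  · refine ⟨0, Nice.zero _, ?_⟩
    rw [map_zero, map_zero, dd_zero]; ext S; simp [hp.ne_zero]
  · rintro a b ⟨h, h1, h2⟩ ⟨k, k1, k2⟩
    refine ⟨h + k, h1.add _ k1, ?_⟩
    rw [map_add, map_add, map_add, h2, k2, dd_add]
    ext S
    simp only [Pi.add_apply, add_pow_char]; ring
  · intro a y hy
    obtain ⟨h, h1, h2⟩ := phi_log_pth B x hx hB y hy (p := p)
    obtain ⟨η, hη, hs⟩ := S.sp_log n a y
    have hη' : ∃ k, Nice 𝔇 k ∧ phi B (S.d η) = dd 𝔇 k := by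
      cases n with
      | zero =>
        have : η = 0 := hη
        exact ⟨0, Nice.zero _, by rw [this, map_zero, map_zero, dd_zero]⟩
      | succ n => exact ⟨_, phi_nice B x hx hB η hη, phi_d B x hx hB S η hη⟩
    obtain ⟨k, k1, k2⟩ := hη'
    refine ⟨k + fun S => (- a^p) * h S, k1.add _ (h1.smul 𝔇 (Dl_der B) (Dl_fin B) _), ?_⟩
    have e5 := dd_smul 𝔇 (Dl_der B) (-a^p) h
    rw [hs, map_add, k2, map_smul, map_smul, dd_add, e5]
    ext T
    have h3 := congrFun h2 T
    simp only [Pi.add_apply, Pi.smul_apply, smul_eq_mul, mul_pow] at h3 ⊢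
    rw [h3]
    have : wdg (fun i => Dl (p := p) B i (-a^p)) h T = 0 := by
      apply Finset.sum_eq_zero
      intro i _
      beta_reduce; rw [map_neg, D_pth 𝔇 (Dl_der B)]; simp
    rw [this]; ring

include hx hB in
theorem phi_hRel (S : DiffStr p E) {n : ℕ} (ω : DF E) (hω : ω ∈ hRel S n) :
    ∃ θ η, Nice 𝔇 θ ∧ Nice 𝔇 η ∧ ∀ T, phi B ω T = θ T ^ p - θ T + dd 𝔇 η T := by
  obtain ⟨_, ⟨z, hz, rfl⟩, _, ⟨w, hw, rfl⟩, rfl⟩ := AddSubgroup.mem_sup.1 hω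
  obtain ⟨h, h1, h2⟩ := phi_sp B x hx hB S z hz
  have hη' : ∃ k, Nice 𝔇 k ∧ phi B (S.d w) = dd 𝔇 k := by
      cases n with
      | zero =>
        have : w = 0 := hw
        exact ⟨0, Nice.zero _, by rw [this, map_zero, map_zero, dd_zero]⟩
      | succ n => exact ⟨_, phi_nice B x hx hB w hw, phi_d B x hx hB S w hw⟩
  obtain ⟨k, k1, k2⟩ := hη'
  refine ⟨phi B z, h + k, phi_nice B x hx hB z hz, h1.add _ k1, fun T => ?_⟩
  have : asMap S z = S.sp z - z := rfl
  rw [map_add, this, map_sub, h2, k2, dd_add]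
  simp only [Pi.add_apply, Pi.sub_apply]; ring

end PhiRel


section LogLists
variable {F : Type*} [Field F]

/-- products of logarithmic one forms indexed by a list -/
def logL (l : List F) : DF F := (l.map (dLog F)).prod

lemma logL_nil : logL ([] : List F) = 1 := rfl
lemma logL_cons (a : F) (l : List F) : logL (a :: l) = dLog F a * logL l := by simp [logL]
lemma logL_append (l l' : List F) : logL (l ++ l') = logL l * logL l' := by simp [logL]

lemma logForm_eq_logL {n : ℕ} (y : Fin n → F) : logForm F y = logL (List.ofFn y) := by
  simp [logForm, logL, List.map_ofFn, Function.comp_def]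

lemma exists_tuple (n : ℕ) (l : List F) (hl : l.length = n) : ∃ y : Fin n → F, List.ofFn y = l := by
  subst hl; exact ⟨l.get, List.ofFn_get l⟩

lemma exists_tuple' (n : ℕ) (l : List F) (hl : l.length = n) (h0 : ∀ a ∈ l, a ≠ 0) :
    ∃ y : Fin n → F, List.ofFn y = l ∧ ∀ i, y i ≠ 0 := by
  obtain ⟨y, rfl⟩ := exists_tuple n l hl
  exact ⟨y, rfl, fun i => h0 _ (List.mem_ofFn.2 ⟨i, rfl⟩)⟩

lemma dLog_mul (a b : F) (ha : a ≠ 0) (hb : b ≠ 0) : dLog F (a * b) = dLog F a + dLog F b := by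
  unfold dLog
  rw [← map_add]; congr 1
  rw [Derivation.leibniz, smul_add, smul_smul, smul_smul, add_comm]
  congr 2 <;> field_simp

lemma dLog_one : dLog F 1 = 0 := by
  unfold dLog; simp

lemma dLog_pow (a : F) (ha : a ≠ 0) (k : ℕ) : dLog F (a ^ k) = k • dLog F a := by
  induction k with
  | zero => simp [dLog_one]
  | succ k ih => rw [pow_succ, dLog_mul _ _ (pow_ne_zero _ ha) ha, ih, succ_nsmul]

lemma dLog_prod {ι : Type*} (s : Finset ι) (f : ι → F) (hf : ∀ i, f i ≠ 0) :
    dLog F (∏ i ∈ s, f i) = ∑ i ∈ s, dLog F (f i) := by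
  classical
  induction s using Finset.induction_on with
  | empty => simp [dLog_one]
  | insert i s hi ih => rw [Finset.prod_insert hi, Finset.sum_insert hi,
      dLog_mul _ _ (hf i) (Finset.prod_ne_zero_iff.2 fun i _ => hf i), ih]

lemma dLog_swap (a b : F) : dLog F a * dLog F b = - (dLog F b * dLog F a) :=
  eq_neg_of_add_eq_zero_left (by unfold dLog; exact ExteriorAlgebra.ι_add_mul_swap _ _)

lemma logL_swap (l : List F) (a : F) : logL l * dLog F a = ((-1 : ℤ) ^ l.length) • (dLog F a * logL l) := by
  induction l with
  | nil => simp [logL_nil]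
  | cons b l ih =>
    rw [logL_cons, mul_assoc, ih, mul_smul_comm, ← mul_assoc, dLog_swap b a, List.length_cons, pow_succ, neg_mul,
      smul_neg, mul_assoc]
    simp

lemma logL_mem (l : List F) : logL l ∈ omegaPow F l.length := by
  obtain ⟨y, hy⟩ := exists_tuple l.length l rfl
  rw [← hy, ← logForm_eq_logL]
  have := logForm_mem y
  rwa [hy]

variable {p : ℕ} (S : DiffStr p F)

lemma d_logL (l : List F) (h0 : ∀ a ∈ l, a ≠ 0) : S.d (logL l) = 0 := by
  obtain ⟨y, hy, h⟩ := exists_tuple' l.length l rfl h0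
  rw [← hy, ← logForm_eq_logL, d_logForm S y h]

/-- exact forms are relations -/
lemma exact_mem (n : ℕ) (l : List F) (hl : l.length = n) (h0 : ∀ a ∈ l, a ≠ 0) (x : F) :
    dForm F x * logL l ∈ hRel S (n+1) := by
  have : S.d (x • logL l) = dForm F x * logL l := by
    rw [S.d_smul, d_logL S l h0, smul_zero, add_zero]
  rw [← this]
  refine AddSubgroup.mem_sup_right ⟨x • logL l, ?_, rfl⟩
  subst hl
  exact Submodule.smul_mem _ _ (logL_mem l)

lemma pth_mem (n : ℕ) (l : List F) (hl : l.length = n) (x : F) :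
    x ^ p • logL l - x • logL l ∈ hRel S n := by
  obtain ⟨y, rfl⟩ := exists_tuple n l hl
  rw [← logForm_eq_logL]
  obtain ⟨η, hη, h⟩ := S.sp_log n x y
  have : x ^ p • logForm F y - x • logForm F y = asMap S (x • logForm F y) + S.d (-η) := by
    have h2 : asMap S (x • logForm F y) = S.sp (x • logForm F y) - x • logForm F y := rfl
    rw [h2, h, map_neg]; abel
  rw [this]
  exact AddSubgroup.add_mem_sup ⟨_, Submodule.smul_mem _ _ (logForm_mem y), rfl⟩ ⟨-η, neg_mem hη, rfl⟩

lemma ppow_mem (n : ℕ) (l : List F) (hl : l.length = n) (x : F) (t : ℕ) :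
    x ^ p ^ t • logL l - x • logL l ∈ hRel S n := by
  induction t with
  | zero => simp
  | succ t ih =>
    have := add_mem (pth_mem S n l hl (x ^ p ^ t)) ih
    rwa [← pow_mul, ← pow_succ, sub_add_sub_cancel] at this

lemma smul_dLog (x : F) (hx : x ≠ 0) : x • dLog F x = dForm F x := by
  rw [dLog_eq, smul_smul, mul_inv_cancel₀ hx, one_smul]

end LogLists

section GGroup
variable {F : Type*} [Field F] {p : ℕ} (SF : DiffStr p F) {r : ℕ} (b : Fin r → F) (m : Fin r → ℕ)

/-- the group of the claimed generators -/
def Ggrp (n : ℕ) : AddSubgroup (DF F) :=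
  AddSubgroup.closure ((hRel SF (n + 1) : Set (DF F)) ∪
          { x | ∃ (j : Fin r) (y : Fin (n + 1) → F), (∀ i, y i ≠ 0) ∧
              x = (b j * y 0) • logForm F y } ∪
          { x | ∃ (t : ℕ) (k : Fin r → ℕ) (y : Fin (n + 1) → F),
              0 < t ∧ t < Finset.univ.sup m ∧
              (∀ j, k j < p ^ t ∧ p ^ (t + 1 - m j) ∣ k j) ∧ (∀ i, y i ≠ 0) ∧
              x = ((∏ j, b j ^ k j) * y 0 ^ p ^ t) • logForm F y })

lemma hRel_le (n : ℕ) : hRel SF (n+1) ≤ Ggrp SF b m n := fun _ hx =>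
  AddSubgroup.subset_closure (Or.inl (Or.inl hx))

variable {SF b m} {n : ℕ} (l : List F) (hl : l.length = n) (h0 : ∀ a ∈ l, a ≠ 0)

include hl h0 in
lemma gen_tuple (s : F) (hs : s ≠ 0) : ∃ y : Fin (n+1) → F, (∀ i, y i ≠ 0) ∧ y 0 = s ∧
    logForm F y = dLog F s * logL l := by
  obtain ⟨y, rfl, hy⟩ := exists_tuple' n l hl h0
  refine ⟨Fin.cons s y, ?_, rfl, ?_⟩
  · intro i
    refine Fin.cases ?_ ?_ i
    · exact hs
    · exact hy
  · rw [logForm_succ, logForm_eq_logL]; rfl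

include hl h0 in
lemma gen_i (j : Fin r) (s : F) (hs : s ≠ 0) : (b j * s) • (dLog F s * logL l) ∈ Ggrp SF b m n := by
  obtain ⟨y, h1, h2, h3⟩ := gen_tuple l hl h0 s hs
  exact AddSubgroup.subset_closure (Or.inl (Or.inr ⟨j, y, h1, by rw [h2, h3]⟩))

include hl h0 in
lemma gen_ii (t : ℕ) (k : Fin r → ℕ) (ht : 0 < t) (ht' : t < Finset.univ.sup m)
    (hk : ∀ j, k j < p ^ t ∧ p ^ (t + 1 - m j) ∣ k j) (s : F) (hs : s ≠ 0) :
    ((∏ j, b j ^ k j) * s ^ p ^ t) • (dLog F s * logL l) ∈ Ggrp SF b m n := by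
  obtain ⟨y, h1, h2, h3⟩ := gen_tuple l hl h0 s hs
  exact AddSubgroup.subset_closure (Or.inr ⟨t, k, y, ht, ht', hk, h1, by rw [h2, h3]⟩)

include hl h0 in
lemma G0 (hb : ∀ j, b j ≠ 0) (j : Fin r) (x : F) : x • (dLog F (b j) * logL l) ∈ Ggrp SF b m n := by
  by_cases hx : x = 0
  · rw [hx, zero_smul]; exact zero_mem _
  set x' := x / b j with hx'
  have e1 : x = x' * b j := by rw [hx', div_mul_cancel₀ _ (hb j)]
  have hx0 : x' ≠ 0 := div_ne_zero hx (hb j)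
  have e2 : x • (dLog F (b j) * logL l) = dForm F (x' * b j) * logL l - (b j * x') • (dLog F x' * logL l) := by
    rw [← smul_dLog (x' * b j) (mul_ne_zero hx0 (hb j)), dLog_mul _ _ hx0 (hb j), e1, smul_mul_assoc, add_mul, smul_add,
      mul_comm (b j)]
    abel
  rw [e2]
  exact sub_mem (hRel_le SF b m n (exact_mem SF n l hl h0 _)) (gen_i l hl h0 j x' hx0)

include hl h0 in
lemma G1 [hpF : Fact p.Prime] (hb : ∀ j, b j ≠ 0) (hm : ∀ j, 1 ≤ m j) (w : Fin r → ℕ) (s : F) (hs : s ≠ 0) :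
    ((∏ j, (b j ^ p ^ (Finset.univ.sup m - m j)) ^ w j) * s ^ p ^ (Finset.univ.sup m - 1)) • (dLog F s * logL l)
      ∈ Ggrp SF b m n := by
  have hp := hpF.out
  set e := Finset.univ.sup m with he
  have hme : ∀ j, m j ≤ e := fun j => Finset.le_sup (f := m) (Finset.mem_univ j)
  rcases Nat.lt_or_ge e 2 with h2 | h2
  · have e0 : e - 1 = 0 := by omega
    rw [e0, pow_zero, pow_one]
    set x := ∏ j, (b j ^ p ^ (e - m j)) ^ w j with hx
    have hx0 : x ≠ 0 := Finset.prod_ne_zero_iff.2 fun j _ => pow_ne_zero _ (pow_ne_zero _ (hb j))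
    have e1 : dLog F x = ∑ j, (w j * p ^ (e - m j)) • dLog F (b j) := by
      rw [hx, dLog_prod _ _ (fun j => pow_ne_zero _ (pow_ne_zero _ (hb j)))]
      refine Finset.sum_congr rfl fun j _ => ?_
      rw [dLog_pow _ (pow_ne_zero _ (hb j)), dLog_pow _ (hb j), mul_smul]
    have e2 : (x * s) • (dLog F s * logL l) = dForm F (x * s) * logL l
        - ∑ j, (w j * p ^ (e - m j)) • ((x * s) • (dLog F (b j) * logL l)) := by
      rw [← smul_dLog (x * s) (mul_ne_zero hx0 hs), dLog_mul _ _ hx0 hs, e1, smul_mul_assoc, add_mul, smul_add,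
        Finset.sum_mul, Finset.smul_sum]
      simp only [smul_mul_assoc, smul_comm (x * s)]
      abel
    rw [e2]
    refine sub_mem (hRel_le SF b m n (exact_mem SF n l hl h0 _)) (sum_mem fun j _ => ?_)
    exact nsmul_mem (G0 l hl h0 hb j _) _
  · set t := e - 1 with ht
    have hpt : 0 < p ^ t := pow_pos hp.pos _
    let k : Fin r → ℕ := fun j => p ^ (e - m j) * w j
    let z : F := ∏ j, b j ^ (k j / p ^ t)
    have hz : z ≠ 0 := Finset.prod_ne_zero_iff.2 fun j _ => (pow_ne_zero _ (hb j))
    have e1 : (∏ j, (b j ^ p ^ (e - m j)) ^ w j) = (∏ j, b j ^ (k j % p ^ t)) * z ^ p ^ t := by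
      rw [← Finset.prod_pow, ← Finset.prod_mul_distrib]
      refine Finset.prod_congr rfl fun j _ => ?_
      rw [← pow_mul, ← pow_mul, ← pow_add, mul_comm (k j / p ^ t), Nat.mod_add_div]
    have e3 : dLog F z = ∑ j, (k j / p ^ t) • dLog F (b j) := by
      rw [dLog_prod _ _ (fun j => (pow_ne_zero _ (hb j)))]
      exact Finset.sum_congr rfl fun j _ => dLog_pow _ (hb j) _
    rw [e1]
    have e2 : ((∏ j, b j ^ (k j % p ^ t)) * z ^ p ^ t * s ^ p ^ t) • (dLog F s * logL l) =
        ((∏ j, b j ^ (k j % p ^ t)) * (z * s) ^ p ^ t) • (dLog F (z * s) * logL l)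
        - ∑ j, (k j / p ^ t) • (((∏ j, b j ^ (k j % p ^ t)) * (z * s) ^ p ^ t) • (dLog F (b j) * logL l)) := by
      rw [dLog_mul _ _ hz hs, e3, add_mul, smul_add, Finset.sum_mul, Finset.smul_sum, mul_pow, mul_assoc]
      simp only [smul_mul_assoc, smul_comm _ (k _ / p ^ t)]
      abel
    rw [e2]
    refine sub_mem (gen_ii l hl h0 t _ (by omega) (by omega) ?_ _ (mul_ne_zero hz hs)) (sum_mem fun j _ => ?_)
    · intro j
      refine ⟨Nat.mod_lt _ hpt, ?_⟩
      have h3 : t + 1 - m j = e - m j := by omega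
      rw [h3]
      refine (Nat.dvd_mod_iff (pow_dvd_pow p ?_)).2 (Dvd.intro _ rfl)
      have := hm j
      omega
    · exact nsmul_mem (G0 l hl h0 hb j _) _

end GGroup


section EForms
variable {X : Type*} [LinearOrder X] {F : Type*} [Field F] (c : X → F)

/-- list of the elements in descending order -/
def eList (S : Finset X) : List F := (S.sort (· ≥ ·)).map c

/-- basis form -/
def eF (S : Finset X) : DF F := logL (eList c S)

lemma eList_length (S : Finset X) : (eList c S).length = S.card := by
  simp [eList]

lemma eList_ne (hc : ∀ i, c i ≠ 0) (S : Finset X) : ∀ a ∈ eList c S, a ≠ 0 := by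
  intro a ha
  obtain ⟨i, _, rfl⟩ := List.mem_map.1 ha
  exact hc i

lemma eF_insert_max (a : X) (S : Finset X) (h : ∀ x ∈ S, x < a) : eF c (insert a S) = dLog F (c a) * eF c S := by
  have ha : a ∉ S := fun h' => lt_irrefl _ (h a h')
  unfold eF eList
  rw [← Finset.cons_eq_insert _ _ ha, Finset.sort_cons (· ≥ ·) (fun b hb => (h b hb).le) ha, List.map_cons, logL_cons]

lemma eF_mul (i : X) (T : Finset X) (hi : i ∉ T) :
    dLog F (c i) * eF c T = sg i (insert i T) • eF c (insert i T) := by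
  induction T using Finset.induction_on_max with
  | empty => rw [sg_max _ _ (by simp), one_smul, eF_insert_max _ _ _ (by simp)]
  | insert a s hs ih =>
    have ha : a ∉ s := fun h' => lt_irrefl _ (hs a h')
    have hia : i ≠ a := fun h => hi (by rw [h]; exact Finset.mem_insert_self _ _)
    have his : i ∉ s := fun h => hi (Finset.mem_insert_of_mem h)
    rcases lt_or_gt_of_ne hia with h | h
    · rw [eF_insert_max c a s hs, ← mul_assoc, dLog_swap, neg_mul, mul_assoc, ih his, mul_smul_comm,
        ← eF_insert_max c a (insert i s), Finset.insert_comm]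
      · have : sg i (insert i s) = - sg i (insert i (insert a s)) := by
          rw [← sg_erase_of_lt i a _ _ h]
          · congr 1
            rw [Finset.insert_comm, Finset.erase_insert]
            simp [ha, hia.symm]
          · simp
        rw [this, neg_smul, neg_neg]
      · intro y hy
        rcases Finset.mem_insert.1 hy with rfl | hy
        · exact h
        · exact hs y hy
    · have h2 : ∀ y ∈ insert a s, y < i := by
        intro y hy
        rcases Finset.mem_insert.1 hy with rfl | hy
        · exact h
        · exact (hs y hy).trans h
      rw [← eF_insert_max c i _ h2, sg_max, one_smul]
      intro y hy
      rcases Finset.mem_insert.1 hy with rfl | hy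
      · exact le_rfl
      · exact (h2 y hy).le

lemma eF_mul_zero (i : X) (T : Finset X) (hi : i ∈ T) : dLog F (c i) * eF c T = 0 := by
  have h1 := eF_mul c i (T.erase i) (Finset.notMem_erase _ _)
  rw [Finset.insert_erase hi] at h1
  have h2 : eF c T = sg i T • (dLog F (c i) * eF c (T.erase i)) := by
    rw [h1, smul_smul, sg_mul_self, one_smul]
  rw [h2, mul_smul_comm, ← mul_assoc]
  have : dLog F (c i) * dLog F (c i) = 0 := by unfold dLog; exact ExteriorAlgebra.ι_sq_zero _
  rw [this, zero_mul, smul_zero]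

variable {L : Type*} [Field L] (ρ : L →+* F) (U : Finset X)

/-- the form with coordinates `ρ f` -/
def Psi (n : ℕ) (f : Finset X → L) : DF F := ∑ S ∈ U.powersetCard n, ρ (f S) • eF c S

lemma Psi_add (n : ℕ) (f g : Finset X → L) : Psi c ρ U n (f + g) = Psi c ρ U n f + Psi c ρ U n g := by
  unfold Psi
  rw [← Finset.sum_add_distrib]
  exact Finset.sum_congr rfl fun S _ => by rw [Pi.add_apply, map_add, add_smul]

lemma Psi_alt (n : ℕ) (g : X → Finset X → L) :
    Psi c ρ U (n+1) (fun S => ∑ i ∈ S, sg i S • g i (S.erase i)) =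
      ∑ T ∈ U.powersetCard n, ∑ i ∈ U, ρ (g i T) • (dLog F (c i) * eF c T) := by
  unfold Psi
  have h1 : ∀ T ∈ U.powersetCard n, ∑ i ∈ U, ρ (g i T) • (dLog F (c i) * eF c T) =
      ∑ i ∈ U \ T, ρ (g i T) • (dLog F (c i) * eF c T) := by
    intro T hT
    symm
    refine Finset.sum_subset Finset.sdiff_subset fun i hi h => ?_
    rw [eF_mul_zero c i T, smul_zero]
    by_contra h'
    exact h (Finset.mem_sdiff.2 ⟨hi, h'⟩)
  rw [Finset.sum_congr rfl h1]
  simp only [map_sum, Finset.sum_smul]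
  rw [Finset.sum_sigma', Finset.sum_sigma']
  refine Finset.sum_bij' (fun a _ => ⟨a.1.erase a.2, a.2⟩) (fun a _ => ⟨insert a.2 a.1, a.2⟩) ?_ ?_ ?_ ?_ ?_
  · rintro ⟨S, i⟩ h
    simp only [Finset.mem_sigma, Finset.mem_powersetCard, Finset.mem_sdiff] at h ⊢
    refine ⟨⟨(Finset.erase_subset _ _).trans h.1.1, ?_⟩, h.1.1 h.2, Finset.notMem_erase _ _⟩
    rw [Finset.card_erase_of_mem h.2, h.1.2]; rfl
  · rintro ⟨T, i⟩ h
    simp only [Finset.mem_sigma, Finset.mem_powersetCard, Finset.mem_sdiff] at h ⊢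
    refine ⟨⟨Finset.insert_subset h.2.1 h.1.1, ?_⟩, Finset.mem_insert_self _ _⟩
    rw [Finset.card_insert_of_notMem h.2.2, h.1.2]
  · rintro ⟨S, i⟩ h
    simp only [Finset.mem_sigma] at h
    simp only [Finset.insert_erase h.2]
  · rintro ⟨T, i⟩ h
    simp only [Finset.mem_sigma, Finset.mem_sdiff] at h
    simp only [Finset.erase_insert h.2.2]
  · rintro ⟨S, i⟩ h
    simp only [Finset.mem_sigma] at h
    have h1 := eF_mul c i (S.erase i) (Finset.notMem_erase _ _)
    rw [Finset.insert_erase h.2] at h1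
    simp only
    rw [h1, map_zsmul, smul_comm, smul_assoc]

end EForms

section Part5
universe u
variable {X : Type*} [LinearOrder X] {F : Type*} [Field F] {p : ℕ} [hpF : Fact p.Prime] (SF : DiffStr p F) {r : ℕ}
  {b : Fin r → F} {m : Fin r → ℕ}
variable {L : Type u} [Field L] [Algebra (ZMod p) L] (lF : F →+* L) (bp : Fin r → L) (ρ : L →+* F)
  (D : X → Module.End (ZMod p) L) (c : X → F)

/-- monomials -/
def Nset : Set L := {z | ∃ (w : Fin r → ℕ) (s : F) (v : X →₀ ℕ), s ≠ 0 ∧ z = (∏ j, bp j ^ w j) * lF s ∧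
  dLog F s = v.sum (fun i k => k • dLog F (c i)) ∧ ∀ i, D i z = v i • z}

/-- pairs -/
def Agrp (Λ : DF F) : AddSubgroup (L × (L → DF F)) :=
  AddSubgroup.closure {z | ∃ (w : Fin r → ℕ) (s : F), s ≠ 0 ∧ 
    z = ((∏ j, bp j ^ w j) * lF s, fun u => ρ (u * ((∏ j, bp j ^ w j) * lF s)) • (dLog F s * Λ))}

variable (hb : ∀ j, b j ≠ 0) (hm : ∀ j, 1 ≤ m j) (hρ : ∀ a, ρ (lF a) = a ^ p ^ (Finset.univ.sup m - 1))
  (hρb : ∀ j, ρ (bp j) = b j ^ p ^ (Finset.univ.sup m - m j))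
  (hN : ∀ u : L, u ∈ AddSubgroup.closure (Nset lF bp D c)) (hc : ∀ i, c i ≠ 0) {n : ℕ}

include hb hm hρ hρb in
lemma G1' (l : List F) (hl : l.length = n) (h0 : ∀ a ∈ l, a ≠ 0) (w : Fin r → ℕ) (s : F) (hs : s ≠ 0) :
    ρ ((∏ j, bp j ^ w j) * lF s) • (dLog F s * logL l) ∈ Ggrp SF b m n := by
  rw [map_mul, map_prod, hρ]
  simp only [map_pow, hρb]
  exact G1 l hl h0 hb hm w s hs

include hb hm hρ hρb in
lemma A_pair (l : List F) (hl : l.length = n) (h0 : ∀ a ∈ l, a ≠ 0) (z : L × (L → DF F))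
    (hz : z ∈ Agrp lF bp ρ (logL l)) (v : Fin r → ℕ) (a : F) (ha : a ≠ 0) :
    z.2 ((∏ j, bp j ^ v j) * lF a) + ρ (((∏ j, bp j ^ v j) * lF a) * z.1) • (dLog F a * logL l) ∈ Ggrp SF b m n := by
  induction hz using AddSubgroup.closure_induction with
  | mem z hz =>
    obtain ⟨w, s, hs, rfl⟩ := hz
    simp only
    rw [← smul_add, ← add_mul, add_comm, ← dLog_mul _ _ ha hs]
    have : (∏ j, bp j ^ v j) * lF a * ((∏ j, bp j ^ w j) * lF s) = (∏ j, bp j ^ (v + w) j) * lF (a * s) := by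
      simp only [Pi.add_apply, pow_add, Finset.prod_mul_distrib, map_mul]; ring
    rw [this]
    exact G1' SF lF bp ρ hb hm hρ hρb l hl h0 _ _ (mul_ne_zero ha hs)
  | zero => simp
  | add x y _ _ hx hy =>
    have := add_mem hx hy
    convert this using 1
    simp only [Prod.fst_add, Prod.snd_add, Pi.add_apply, mul_add, map_add, add_smul]; abel
  | neg x _ hx =>
    have := neg_mem hx
    convert this using 1
    simp only [Prod.fst_neg, Prod.snd_neg, Pi.neg_apply, mul_neg, map_neg, neg_smul]; abel

include hb hm hρ hρb hN in
lemma A_zero (l : List F) (hl : l.length = n) (h0 : ∀ a ∈ l, a ≠ 0) (ξ : L → DF F)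
    (hadd : ∀ u v, ξ (u + v) = ξ u + ξ v)
    (hz : ((0 : L), ξ) ∈ Agrp lF bp ρ (logL l)) (u : L) : ξ u ∈ Ggrp SF b m n := by
  let ξ' : L →+ DF F := AddMonoidHom.mk' ξ hadd
  have : u ∈ (Ggrp SF b m n).comap ξ' := by
    refine (AddSubgroup.closure_le _).2 ?_ (hN u)
    rintro _ ⟨w, s, v, hs, rfl, _⟩
    have := A_pair SF lF bp ρ hb hm hρ hρb l hl h0 _ hz w s hs
    simp only [mul_zero, map_zero, zero_smul, add_zero] at this
    exact this
  exact this

lemma sum_eq_supp {M : Type*} [AddCommMonoid M] (U U' : Finset X) (f : X → M) (h : ∀ i ∉ U, f i = 0) :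
    ∑ i ∈ U ∪ U', f i = ∑ i ∈ U, f i :=
  (Finset.sum_subset Finset.subset_union_left (fun i _ hi => h i hi)).symm

lemma N_sum (l : List F) (z : L) (w : Fin r → ℕ) (s : F) (v : X →₀ ℕ)  (hz : z = (∏ j, bp j ^ w j) * lF s) (hs : dLog F s = v.sum (fun i k => k • dLog F (c i))) (hD : ∀ i, D i z = v i • z)
   (U : Finset X) (hU : v.support ⊆ U) (u : L) :
    ∑ i ∈ U, ρ (u * D i z) • (dLog F (c i) * logL l) = ρ (u * z) • (dLog F s * logL l) := by
  rw [hs, Finsupp.sum, Finset.sum_subset hU (fun i _ hi => by rw [Finsupp.notMem_support_iff.1 hi, zero_smul]),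
    Finset.sum_mul, Finset.smul_sum]
  refine Finset.sum_congr rfl fun i _ => ?_
  rw [hD, mul_smul_comm, map_nsmul, smul_mul_assoc, smul_assoc, smul_comm]

lemma A_D (l : List F) (z : L) (hz : z ∈ AddSubgroup.closure (Nset lF bp D c)) :
    ∃ U0 : Finset X, ∀ U, U0 ⊆ U → 
      (z, fun u => ∑ i ∈ U, ρ (u * D i z) • (dLog F (c i) * logL l)) ∈ Agrp lF bp ρ (logL l) := by
  induction hz using AddSubgroup.closure_induction with
  | mem z hz =>
    obtain ⟨w, s, v, hs, h1, h2, h3⟩ := hz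
    refine ⟨v.support, fun U hU => ?_⟩
    simp only [N_sum lF bp ρ D c l z w s v h1 h2 h3 U hU]
    rw [h1]
    exact AddSubgroup.subset_closure ⟨w, s, hs, rfl⟩
  | zero => 
    refine ⟨∅, fun U _ => ?_⟩
    have := zero_mem (Agrp lF bp ρ (logL l))
    convert this using 1
    ext u
    · rfl
    · simp
  | add x y _ _ hx hy =>
    obtain ⟨U1, h1⟩ := hx
    obtain ⟨U2, h2⟩ := hy
    refine ⟨U1 ∪ U2, fun U hU => ?_⟩
    have := add_mem (h1 U (Finset.union_subset_left hU)) (h2 U (Finset.union_subset_right hU))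
    convert this using 1
    ext u
    · rfl
    · simp only [Prod.mk_add_mk, Pi.add_apply, map_add, mul_add, add_smul, Finset.sum_add_distrib]
  | neg x _ hx =>
    obtain ⟨U1, h1⟩ := hx
    refine ⟨U1, fun U hU => ?_⟩
    have := neg_mem (h1 U hU)
    convert this using 1
    ext u
    · rfl
    · simp only [Prod.neg_mk, Pi.neg_apply, map_neg, mul_neg, neg_smul, Finset.sum_neg_distrib]

include hb hm hρ hρb hN in
lemma star (l : List F) (hl : l.length = n) (h0 : ∀ a ∈ l, a ≠ 0) (z : F) (hz : z ≠ 0) (u : L) (U : Finset X)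
    (hU : ∀ i ∉ U, D i (lF z) = 0) :
    ρ u • (dLog F z * logL l) - ∑ i ∈ U, ρ (u * ((lF z)⁻¹ * D i (lF z))) • (dLog F (c i) * logL l) ∈ Ggrp SF b m n := by
  obtain ⟨U0, h⟩ := A_D lF bp ρ D c l (lF z) (hN _)
  have h2 := h (U ∪ U0) Finset.subset_union_right
  have h3 : (lF z, fun u => ρ (u * lF z) • (dLog F z * logL l)) ∈ Agrp lF bp ρ (logL l) :=
    AddSubgroup.subset_closure ⟨0, z, hz, by simp⟩
  have h4 := sub_mem h3 h2
  rw [Prod.mk_sub_mk, sub_self] at h4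
  have h5 := A_zero SF lF bp ρ D c hb hm hρ hρb hN l hl h0 _ ?_ h4 (u * (lF z)⁻¹)
  · have hz' : lF z ≠ 0 := by simpa using hz
    simp only [Pi.sub_apply] at h5
    rw [inv_mul_cancel_right₀ hz', sum_eq_supp U U0 _ (fun i hi => by rw [hU i hi]; simp)] at h5
    simpa only [mul_assoc] using h5
  · intro u v
    simp only [Pi.sub_apply, add_mul, map_add, add_smul, Finset.sum_add_distrib]
    abel

include hb hm hρ hρb hN in
lemma starstar (l : List F) (hl : l.length = n) (h0 : ∀ a ∈ l, a ≠ 0) (z : L) (U : Finset X)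
    (hU : ∀ i ∉ U, D i z = 0) :
    ∑ i ∈ U, ρ (D i z) • (dLog F (c i) * logL l) ∈ Ggrp SF b m n := by
  have key : ∀ z ∈ AddSubgroup.closure (Nset lF bp D c), ∃ U0 : Finset X, ∀ U, U0 ⊆ U → 
     ∑ i ∈ U, ρ (D i z) • (dLog F (c i) * logL l) ∈ Ggrp SF b m n := by
    intro z hz
    induction hz using AddSubgroup.closure_induction with
    | mem z hz =>
      obtain ⟨w, s, v, hs, h1, h2, h3⟩ := hz
      refine ⟨v.support, fun U hU => ?_⟩
      have := N_sum lF bp ρ D c l z w s v h1 h2 h3 U hU 1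
      simp only [one_mul] at this
      rw [this, h1]
      exact G1' SF lF bp ρ hb hm hρ hρb l hl h0 _ _ hs
    | zero => exact ⟨∅, fun U _ => by simp⟩
    | add x y _ _ hx hy =>
      obtain ⟨U1, h1⟩ := hx
      obtain ⟨U2, h2⟩ := hy
      refine ⟨U1 ∪ U2, fun U hU => ?_⟩
      have := add_mem (h1 U (Finset.union_subset_left hU)) (h2 U (Finset.union_subset_right hU))
      simpa only [map_add, add_smul, Finset.sum_add_distrib]
    | neg x _ hx =>
      obtain ⟨U1, h1⟩ := hx
      refine ⟨U1, fun U hU => ?_⟩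
      have := neg_mem (h1 U hU)
      simpa only [map_neg, neg_smul, Finset.sum_neg_distrib]
  obtain ⟨U0, h⟩ := key z (hN z)
  have := h (U ∪ U0) Finset.subset_union_right
  rwa [sum_eq_supp U U0 _ (fun i hi => by rw [hU i hi]; simp)] at this

/-- coordinates of a logarithmic form -/
def Pcoord : List F → Finset X → L
  | [] => fun S => if S = ∅ then 1 else 0
  | y :: ys => wdg (fun i => (lF y)⁻¹ * D i (lF y)) (Pcoord ys)

include hb hm hρ hρb hN in
lemma star' (l l' : List F) (hl : l.length + l'.length = n) (h0 : ∀ a ∈ l, a ≠ 0) (h0' : ∀ a ∈ l', a ≠ 0)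
    (z : F) (hz : z ≠ 0) (u : L) (U : Finset X)
    (hU : ∀ i ∉ U, D i (lF z) = 0) :
    ρ u • (logL l * dLog F z * logL l') -
      ∑ i ∈ U, ρ (u * ((lF z)⁻¹ * D i (lF z))) • (logL l * dLog F (c i) * logL l') ∈ Ggrp SF b m n := by
  have := star SF lF bp ρ D c hb hm hρ hρb hN (l ++ l') (by simpa using hl)
    (fun a ha => (List.mem_append.1 ha).elim (h0 a) (h0' a)) z hz u U hU
  have := zsmul_mem this ((-1) ^ l.length)
  convert this using 1
  rw [smul_sub, Finset.smul_sum]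
  simp only [logL_swap, logL_append, smul_mul_assoc, mul_assoc]
  congr 1
  · rw [smul_comm]
  · exact Finset.sum_congr rfl fun i _ => by rw [smul_comm]

include hb hm hρ hρb hN hc in
lemma telescope (y : List F) (U : Finset X) (hy : ∀ a ∈ y, a ≠ 0) (hU : ∀ a ∈ y, ∀ i ∉ U, D i (lF a) = 0) :
    ∀ (l : List F) (_ : l.length + y.length = n + 1) (_ : ∀ a ∈ l, a ≠ 0) (u : L),
    ρ u • (logL l * logL y) - logL l * Psi c ρ U y.length (fun S => u * Pcoord lF D y S) ∈ Ggrp SF b m n := by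
  induction y with
  | nil =>
    intro l _ _ u
    simp [Psi, Pcoord, logL_nil, eF, eList]
  | cons z ys ih =>
    intro l hl h0 u
    have hz := hy z (by simp)
    have h1 := star' SF lF bp ρ D c hb hm hρ hρb hN (n := n) l ys (by simp at hl; omega) h0 (fun a ha => hy a (by simp [ha])) z hz u U
      (hU z (by simp))
    have h2 : ∀ i ∈ U, ρ (u * ((lF z)⁻¹ * D i (lF z))) • (logL l * dLog F (c i) * logL ys) - 
       logL l * dLog F (c i) * Psi c ρ U ys.length (fun S => (u * ((lF z)⁻¹ * D i (lF z))) * Pcoord lF D ys S)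
        ∈ Ggrp SF b m n := by
      intro i _
      have := ih (fun a ha => hy a (by simp [ha])) (fun a ha => hU a (by simp [ha])) (l ++ [c i]) (by simp at hl ⊢; omega)
        (fun a ha => by
          rcases List.mem_append.1 ha with h | h
          · exact h0 a h
          · rw [List.mem_singleton.1 h]; exact hc i) (u * ((lF z)⁻¹ * D i (lF z)))
      simpa only [logL_append, logL_cons, logL_nil, mul_one] using this
    have h3 := add_mem h1 (sum_mem h2)
    rw [Finset.sum_sub_distrib, sub_add_sub_cancel] at h3
    convert h3 using 1
    rw [logL_cons, mul_assoc]
    congr 1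
    have e1 : (fun S => u * Pcoord lF D (z :: ys) S) = fun S => ∑ i ∈ S, sg i S • (fun i T => u * ((lF z)⁻¹ * D i (lF z)) * Pcoord lF D ys T) i (S.erase i) := by
      ext S
      simp only [Pcoord, wdg, Finset.mul_sum, mul_smul_comm, mul_assoc]
    rw [e1, List.length_cons, Psi_alt c ρ U ys.length (fun i T => u * ((lF z)⁻¹ * D i (lF z)) * Pcoord lF D ys T),
      Finset.sum_comm, Finset.mul_sum]
    refine Finset.sum_congr rfl fun i _ => ?_
    simp only [Psi, Finset.mul_sum, mul_smul_comm, mul_assoc]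

include hb hm hρ hρb hN hc in
lemma Psi_dd (h : Finset X → L) (U : Finset X) (hU : ∀ S, ∀ i ∉ U, D i (h S) = 0) :
    Psi c ρ U (n+1) (dd D h) ∈ Ggrp SF b m n := by
  have := Psi_alt c ρ U n (fun i T => D i (h T))
  have e : dd D h = fun S => ∑ i ∈ S, sg i S • (fun i T => D i (h T)) i (S.erase i) := rfl
  rw [e, this]
  refine sum_mem fun T hT => ?_
  exact starstar SF lF bp ρ D c hb hm hρ hρb hN _ (by rw [eList_length]; exact (Finset.mem_powersetCard.1 hT).2) 
    (eList_ne c hc T) _ U (hU T)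

lemma Psi_pth (θ : Finset X → L) (U : Finset X) :
    Psi c ρ U (n+1) (fun S => θ S ^ p - θ S) ∈ Ggrp SF b m n := by
  refine hRel_le SF b m n (sum_mem fun T hT => ?_)
  rw [map_sub, map_pow, sub_smul]
  exact pth_mem SF _ _ (by rw [eList_length]; exact (Finset.mem_powersetCard.1 hT).2) _

include hb hm hρ hρb hN hc in
lemma Psi_log (y : List F) (hl : y.length = n + 1) (U : Finset X) (hy : ∀ a ∈ y, a ≠ 0)
    (hU : ∀ a ∈ y, ∀ i ∉ U, D i (lF a) = 0) (a : F) :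
    a • logL y - Psi c ρ U (n+1) (fun S => lF a * Pcoord lF D y S) ∈ Ggrp SF b m n := by
  have h1 := telescope SF lF bp ρ D c hb hm hρ hρb hN hc y U hy hU [] (by simpa using hl) (by simp) (lF a)
  rw [logL_nil, one_mul, one_mul, hl, hρ] at h1
  have h2 := hRel_le SF b m n (ppow_mem SF (n+1) y hl a (Finset.univ.sup m - 1))
  have := sub_mem h1 h2
  convert this using 1
  abel
end Part5


section DiffLemma
universe u
variable {p : ℕ} [hpF : Fact p.Prime] {E : Type u} [Field E] [CharP E p]

lemma exists_max_subfield (M : Subfield E) (a : E) (ha : a ∉ M) :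
    ∃ N : Subfield E, M ≤ N ∧ a ∉ N ∧ ∀ N' : Subfield E, N < N' → a ∈ N' := by
  obtain ⟨N, hN1, hN2⟩ := zorn_le_nonempty₀ {N : Subfield E | M ≤ N ∧ a ∉ N} (by
    intro c hc hch y hy
    refine ⟨sSup c, ⟨(hc hy).1.trans (le_sSup hy), ?_⟩, fun z hz => le_sSup hz⟩
    rw [Subfield.mem_sSup_of_directedOn ⟨y, hy⟩ hch.directedOn]
    rintro ⟨s, hs, h⟩
    exact (hc hs).2 h) M ⟨le_rfl, ha⟩
  refine ⟨N, hN1, hN2.1.2, fun N' h => ?_⟩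
  by_contra h'
  exact absurd (hN2.2 ⟨hN1.trans h.le, h'⟩ h.le) (not_le_of_gt h)

lemma minpoly_pth (N : Subfield E) (hN : ∀ g : E, g ^ p ∈ N) (y : E) (hy : y ∉ N) :
    minpoly N y = Polynomial.X ^ p - Polynomial.C ⟨y ^ p, hN y⟩ := by
  have hp := hpF.out
  symm
  refine minpoly.eq_of_irreducible_of_monic (X_pow_sub_C_irreducible_of_prime hp ?_) ?_
    (Polynomial.monic_X_pow_sub_C _ hp.ne_zero)
  · intro z hz
    have : (z : E) ^ p = y ^ p := congrArg Subtype.val hz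
    exact hy (frobenius_inj E p this ▸ z.2)
  · simp only [map_sub, map_pow, Polynomial.aeval_X, Polynomial.aeval_C]
    exact sub_self _

omit hpF [CharP E p] in
lemma lt_adjoin (N : Subfield E) (y : E) (hy : y ∉ N) : N < (IntermediateField.adjoin N {y}).toSubfield := by
  refine lt_of_le_of_ne (fun z hz => ?_) fun h => hy ?_
  · exact (IntermediateField.adjoin N {y}).algebraMap_mem ⟨z, hz⟩
  · rw [h]; exact IntermediateField.mem_adjoin_simple_self N y

omit hpF [CharP E p] in
lemma deriv_zero_of_adjoin {K : Type u} [Field K] [Algebra K E] (a : E) (ha : Algebra.adjoin K {a} = ⊤) (h : KaehlerDifferential.D K E a = 0) :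
    Algebra.FormallyUnramified K E := by
  rw [Algebra.formallyUnramified_iff]
  have h0 : ∀ z : E, KaehlerDifferential.D K E z = 0 := by
    intro z
    have := Derivation.eqOn_adjoin (D1 := KaehlerDifferential.D K E) (D2 := 0) (s := {a}) (by
      rintro _ rfl; exact h)
    have hz : z ∈ (Algebra.adjoin K {a} : Set E) := by rw [ha]; trivial
    exact this hz
  have := KaehlerDifferential.span_range_derivation K E
  have h2 : Set.range (KaehlerDifferential.D K E) = {0} := by
    ext w; constructor
    · rintro ⟨z, rfl⟩; exact h0 z
    · rintro rfl; exact ⟨0, map_zero _⟩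
  rw [h2, Submodule.span_singleton_eq_bot.2 rfl] at this
  exact (Submodule.subsingleton_iff E).1 ((subsingleton_iff_bot_eq_top).1 this)

theorem diff_mem (M : Subfield E) (hM : ∀ g : E, g ^ p ∈ M) (a : E)
    (ha : KaehlerDifferential.D ℤ E a ∈ Submodule.span E ((fun z => KaehlerDifferential.D ℤ E z) '' (M : Set E))) :
    a ∈ M := by
  have hp := hpF.out
  by_contra hna
  obtain ⟨N, hMN, haN, hmax⟩ := exists_max_subfield M a hna
  have hN : ∀ g : E, g ^ p ∈ N := fun g => hMN (hM g)
  have hintr : ∀ y : E, IsIntegral N y := fun y =>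
    ⟨Polynomial.X ^ p - Polynomial.C ⟨y ^ p, hN y⟩, Polynomial.monic_X_pow_sub_C _ hp.ne_zero, by
      simp only [Polynomial.eval₂_sub, Polynomial.eval₂_X_pow, Polynomial.eval₂_C]
      exact sub_self _⟩
  have hrank : ∀ y ∉ N, Module.finrank N (IntermediateField.adjoin N {y}) = p := by
    intro y hy
    rw [IntermediateField.adjoin.finrank (hintr y), minpoly_pth N hN y hy, Polynomial.natDegree_X_pow_sub_C]
  have htop : IntermediateField.adjoin N {a} = ⊤ := by
    rw [eq_top_iff]
    intro y _
    by_cases hy : y ∈ N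
    · exact (IntermediateField.adjoin N {a}).algebraMap_mem ⟨y, hy⟩
    · have h1 : a ∈ IntermediateField.adjoin N {y} := hmax _ (lt_adjoin N y hy)
      have h2 : IntermediateField.adjoin N {a} ≤ IntermediateField.adjoin N {y} :=
        IntermediateField.adjoin_simple_le_iff.2 h1
      haveI : FiniteDimensional N (IntermediateField.adjoin N {y}) := IntermediateField.adjoin.finiteDimensional (hintr y)
      have h3 := IntermediateField.eq_of_le_of_finrank_eq h2 (by rw [hrank a haN, hrank y hy])
      rw [h3]
      exact IntermediateField.mem_adjoin_simple_self N y
  have htop' : Algebra.adjoin N {a} = ⊤ := by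
    rw [← IntermediateField.adjoin_simple_toSubalgebra_of_isAlgebraic (hintr a).isAlgebraic, htop]; rfl
  haveI : Module.Finite N E := by
    haveI : FiniteDimensional N (IntermediateField.adjoin N {a}) := IntermediateField.adjoin.finiteDimensional (hintr a)
    rw [htop] at this
    exact IntermediateField.topEquiv.toLinearEquiv.finiteDimensional
  have hz : KaehlerDifferential.D N E a = 0 := by
    have h1 : KaehlerDifferential.map ℤ N E E (KaehlerDifferential.D ℤ E a) = KaehlerDifferential.D N E a := by
      rw [KaehlerDifferential.map_D]; rfl
    rw [← h1]
    have h2 : Submodule.span E ((fun z => KaehlerDifferential.D ℤ E z) '' (M : Set E)) ≤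
        LinearMap.ker (KaehlerDifferential.map ℤ N E E) := by
      rw [Submodule.span_le]
      rintro _ ⟨z, hz, rfl⟩
      change KaehlerDifferential.map ℤ N E E (KaehlerDifferential.D ℤ E z) = 0
      rw [KaehlerDifferential.map_D]
      exact (KaehlerDifferential.D N E).map_algebraMap ⟨z, hMN hz⟩
    exact h2 ha
  haveI := deriv_zero_of_adjoin (K := N) a htop' hz
  haveI : Algebra.IsSeparable N E := Algebra.FormallyUnramified.isSeparable N E
  have hs : (minpoly N a).Separable := Algebra.IsSeparable.isSeparable N a
  rw [minpoly_pth N hN a haN] at hs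
  haveI : CharP N p := (RingHom.charP_iff (algebraMap N E) (algebraMap N E).injective p).2 inferInstance
  have hd : Polynomial.derivative (Polynomial.X ^ p - Polynomial.C (⟨a ^ p, hN a⟩ : N)) = 0 := by
    rw [Polynomial.derivative_sub, Polynomial.derivative_X_pow, Polynomial.derivative_C, CharP.cast_eq_zero]; simp
  rw [Polynomial.Separable, hd, isCoprime_zero_right] at hs
  have := Polynomial.natDegree_eq_zero_of_isUnit hs
  rw [Polynomial.natDegree_X_pow_sub_C] at this
  exact hp.ne_zero this
end DiffLemma


section BasisEx
universe u v
variable (F : Type v) (E : Type u) [Field F] [Field E] [Algebra F E]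

lemma exists_order (X : Type u) (J : Set X) : ∃ (_ : LinearOrder X), ∀ i j : X, i ∉ J → j ∈ J → i < j := by
  classical
  letI : LinearOrder X := linearOrderOfSTO WellOrderingRel
  let f : X → Bool ×ₗ X := fun i => toLex (decide (i ∈ J), i)
  have hf : Function.Injective f := fun i j h => congrArg (fun z => (ofLex z).2) h
  refine ⟨LinearOrder.lift' f hf, fun i j hi hj => ?_⟩
  change f i < f j
  rw [Prod.Lex.lt_iff]
  left
  simp [f, hi, hj]

lemma exists_basis : ∃ (X : Type u) (_ : LinearOrder X) (B : Module.Basis X E (KaehlerDifferential ℤ E))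
    (x : X → E) (J : Set X) (c : X → F), (∀ i, c i ≠ 0) ∧ (∀ i, x i ≠ 0) ∧
    (∀ l, B l = (x l)⁻¹ • KaehlerDifferential.D ℤ E (x l)) ∧ (∀ i, i ∉ J → x i = algebraMap F E (c i)) ∧
    (∀ i ∈ J, c i = 1) ∧ (∀ i j, i ∉ J → j ∈ J → i < j) ∧
    ∀ a : F, ∀ j ∈ J, B.repr (KaehlerDifferential.D ℤ E (algebraMap F E a)) j = 0 := by
  classical
  let dl : E → KaehlerDifferential ℤ E := fun z => z⁻¹ • KaehlerDifferential.D ℤ E z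
  let T1 : Set (KaehlerDifferential ℤ E) := {w | ∃ a : F, a ≠ 0 ∧ dl (algebraMap F E a) = w}
  let T : Set (KaehlerDifferential ℤ E) := {w | ∃ a : E, a ≠ 0 ∧ dl a = w}
  have hT : T1 ⊆ T := by
    rintro _ ⟨a, ha, rfl⟩
    exact ⟨_, by simpa using ha, rfl⟩
  obtain ⟨I, hI1, -, hI2, hI3⟩ := exists_linearIndepOn_id_extension (K := E) (linearIndepOn_empty E id) (Set.empty_subset T1)
  obtain ⟨b, hb1, hb2, hb3, hb4⟩ := exists_linearIndepOn_id_extension (K := E) hI3 (hI1.trans hT)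
  have hli : LinearIndependent E (fun i : b => (i : KaehlerDifferential ℤ E)) := hb4
  have hsp : ⊤ ≤ Submodule.span E (Set.range (fun i : b => (i : KaehlerDifferential ℤ E))) := by
    rw [Subtype.range_coe, ← KaehlerDifferential.span_range_derivation ℤ E, Submodule.span_le]
    rintro _ ⟨z, rfl⟩
    by_cases hz : z = 0
    · subst hz; rw [map_zero]; exact zero_mem _
    · have : KaehlerDifferential.D ℤ E z = z • dl z := by
        rw [smul_smul, mul_inv_cancel₀ hz, one_smul]
      rw [this]
      exact Submodule.smul_mem _ _ (hb3 ⟨z, hz, rfl⟩)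
  let B := Module.Basis.mk hli hsp
  have hBv : ∀ i : b, B i = (i : KaehlerDifferential ℤ E) := fun i => Module.Basis.mk_apply hli hsp i
  let J : Set b := {i | (i : KaehlerDifferential ℤ E) ∉ I}
  obtain ⟨ord, hord⟩ := exists_order b J
  have hch : ∀ i : b, ∃ (x : E) (c : F), c ≠ 0 ∧ x ≠ 0 ∧ (i : KaehlerDifferential ℤ E) = dl x ∧
      (i ∉ J → x = algebraMap F E c) ∧ (i ∈ J → c = 1) := by
    intro i
    by_cases hi : i ∈ J
    · obtain ⟨z, hz, h⟩ := hb1 i.2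
      exact ⟨z, 1, one_ne_zero, hz, h.symm, fun h => absurd hi h, fun _ => rfl⟩
    · obtain ⟨z, hz, h⟩ := hI1 (not_not.1 hi)
      exact ⟨algebraMap F E z, z, hz, by simpa using hz, h.symm, fun _ => rfl, fun h => absurd h hi⟩
  choose x c h1 h2 h3 h4 h5 using hch
  refine ⟨b, ord, B, x, J, c, h1, h2, fun l => by rw [hBv, h3], h4, h5, hord, ?_⟩
  intro a j hj
  by_cases ha : a = 0
  · subst ha; simp
  have hspI : KaehlerDifferential.D ℤ E (algebraMap F E a) ∈ Submodule.span E (B '' Jᶜ) := by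
    have : KaehlerDifferential.D ℤ E (algebraMap F E a) = algebraMap F E a • dl (algebraMap F E a) := by
      rw [smul_smul, mul_inv_cancel₀ (by simpa using ha), one_smul]
    rw [this]
    refine Submodule.smul_mem _ _ (Submodule.span_mono ?_ (hI2 ⟨a, ha, rfl⟩))
    intro w hw
    exact ⟨⟨w, hb2 hw⟩, fun h => h hw, hBv _⟩
  have := B.mem_span_image.1 hspI
  by_contra h
  exact this (Finsupp.mem_support_iff.2 h) hj
end BasisEx


section NSpan
universe u v
variable {X : Type*} [LinearOrder X]
variable {p : ℕ} [hpF : Fact p.Prime] {E : Type u} [Field E] [Algebra (ZMod p) E]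
variable {F : Type v} [Field F] [Algebra F E] [hcF : CharP F p]
variable (D : X → Module.End (ZMod p) E) (hder : ∀ l, IsDer (D l))
variable {r : ℕ} (β : Fin r → E) (c : X → F)

/-- monomials as a submonoid of `E` -/
def NE : Submonoid E where
  carrier := {z | ∃ (w : Fin r → ℕ) (s : F) (v : X →₀ ℕ), s ≠ 0 ∧ z = (∏ j, (β j ^ p) ^ w j) * algebraMap F E s ∧
    dLog F s = v.sum (fun i k => k • dLog F (c i)) ∧ ∀ i, D i z = v i • z}
  one_mem' := ⟨0, 1, 0, one_ne_zero, by simp, by simp [dLog_one], fun i => by simp [(hder i).one]⟩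
  mul_mem' := by
    rintro z z' ⟨w, s, v, h1, h2, h3, h4⟩ ⟨w', s', v', h1', h2', h3', h4'⟩
    refine ⟨w + w', s * s', v + v', mul_ne_zero h1 h1', ?_, ?_, fun i => ?_⟩
    · rw [h2, h2']
      simp only [Pi.add_apply, pow_add, Finset.prod_mul_distrib, map_mul]; ring
    · rw [dLog_mul _ _ h1 h1', h3, h3', Finsupp.sum_add_index']
      · intro i; simp
      · intro i k k'; rw [add_smul]
    · rw [hder i, h4, h4', Finsupp.add_apply, add_smul, smul_mul_assoc, mul_smul_comm]

lemma dLog_pth (a : F) : dLog F (a ^ p) = 0 := by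
  by_cases ha : a = 0
  · subst ha; rw [zero_pow hpF.out.ne_zero]; simp [dLog]
  · rw [dLog_pow _ ha, ← Nat.cast_smul_eq_nsmul F, CharP.cast_eq_zero, zero_smul]

include hcF in
lemma pth_mem_NE (hgen : Algebra.adjoin F (Set.range β) = ⊤) (g : E) :
    g ^ p ∈ Subring.closure (NE D hder β c : Set E) := by
  haveI : CharP E p := charP_of_alg
  have hg : g ∈ Algebra.adjoin F (Set.range β) := by rw [hgen]; trivial
  induction hg using Algebra.adjoin_induction with
  | mem g hg =>
    obtain ⟨j, rfl⟩ := hg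
    refine Subring.subset_closure ⟨Pi.single j 1, 1, 0, one_ne_zero, ?_, by simp [dLog_one], fun i => by simp [D_pth D hder]⟩
    rw [Finset.prod_eq_single j]
    · simp
    · intro k _ hk; simp [hk]
    · simp
  | algebraMap a =>
    by_cases ha : a = 0
    · subst ha; rw [map_zero, zero_pow hpF.out.ne_zero]; exact zero_mem _
    · exact Subring.subset_closure ⟨0, a ^ p, 0, pow_ne_zero _ ha, by simp, by simp [dLog_pth], fun i => by
        simp [D_pth D hder]⟩
  | add x y _ _ hx hy => rw [add_pow_char]; exact add_mem hx hy
  | mul x y _ _ hx hy => rw [mul_pow]; exact mul_mem hx hy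

/-- a subring containing all p-th powers is a subfield -/
def subfieldOf (R : Subring E) (hR : ∀ g : E, g ^ p ∈ R) : Subfield E where
  toSubring := R
  inv_mem' := by
    intro y hy
    by_cases h : y = 0
    · subst h; simpa using hy
    · have : y⁻¹ = y ^ (p - 1) * (y⁻¹) ^ p := by
        have h1 : y ^ p = y ^ (p - 1) * y := by rw [← pow_succ, Nat.sub_add_cancel hpF.out.one_le]
        rw [inv_pow, h1, mul_inv, mul_inv_cancel_left₀ (pow_ne_zero _ h)]
      change y⁻¹ ∈ R
      rw [this]
      exact R.mul_mem (pow_mem hy _) (hR _)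

end NSpan

section NSpan2
universe u v
variable {X : Type*} [LinearOrder X]
variable {p : ℕ} [hpF : Fact p.Prime] {E : Type u} [Field E] [Algebra (ZMod p) E]
variable {F : Type v} [Field F] [Algebra F E] [hcF : CharP F p]
variable {r : ℕ} (β : Fin r → E) (c : X → F)
variable (B : Module.Basis X E (KaehlerDifferential ℤ E)) (x : X → E) (J : Set X)
   (hc : ∀ i, c i ≠ 0) (hx : ∀ i, x i ≠ 0) (hB : ∀ l, B l = (x l)⁻¹ • KaehlerDifferential.D ℤ E (x l))
   (hxc : ∀ i, i ∉ J → x i = algebraMap F E (c i))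
   (hFJ : ∀ a : F, ∀ j ∈ J, B.repr (KaehlerDifferential.D ℤ E (algebraMap F E a)) j = 0)
   (hgen : Algebra.adjoin F (Set.range β) = ⊤)

include hcF hgen hc hx hB hxc in
lemma mem_NE_closure (u : E) (hu : ∀ j ∈ J, Dl (p := p) B j u = 0) :
    u ∈ AddSubgroup.closure (NE (Dl (p := p) B) (Dl_der B) β c : Set E) := by
  haveI : CharP E p := charP_of_alg
  have h1 : u ∈ subfieldOf (Subring.closure (NE (Dl (p := p) B) (Dl_der B) β c : Set E))
      (pth_mem_NE _ (Dl_der B) β c hgen) := by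
    refine diff_mem (p := p) _ (pth_mem_NE _ (Dl_der B) β c hgen) u ?_
    rw [← B.linearCombination_repr (KaehlerDifferential.D ℤ E u), Finsupp.linearCombination_apply]
    refine Submodule.sum_mem _ fun i hi => Submodule.smul_mem _ _ ?_
    have hiJ : i ∉ J := fun h => Finsupp.mem_support_iff.1 hi (hu i h)
    rw [hB i]
    refine Submodule.smul_mem _ _ (Submodule.subset_span ⟨x i, ?_, rfl⟩)
    refine Subring.subset_closure ⟨0, c i, Finsupp.single i 1, hc i, ?_, ?_, fun l => ?_⟩
    · simp [hxc i hiJ]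
    · simp
    · rw [Dl_x B x hx hB, Finsupp.single_apply]
      by_cases h : l = i
      · simp [h]
      · simp [h, Ne.symm h]
  have h2 : u ∈ Subring.closure (NE (Dl (p := p) B) (Dl_der B) β c : Set E) := h1
  rwa [Subring.mem_closure_iff, Submonoid.closure_eq] at h2

variable (p) in
/-- the field of constants -/
abbrev LK : IntermediateField (ZMod p) E := constField (Dl (p := p) B) (Dl_der B) Jᶜ

lemma mem_LK (a : E) : a ∈ LK p B J ↔ ∀ j ∈ J, Dl (p := p) B j a = 0 := by
  rw [mem_constField]; simp

include hFJ in
lemma alg_mem_LK (a : F) : algebraMap F E a ∈ LK p B J := (mem_LK B J _).2 fun j hj => hFJ a j hj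

lemma pth_mem_LK (a : E) : a ^ p ∈ LK p B J := (mem_LK B J _).2 fun _ _ => D_pth _ (Dl_der B) _ _

/-- inclusion of F -/
def lFK : F →+* LK p B J := (algebraMap F E).codRestrict (LK p B J) (alg_mem_LK B J hFJ)

/-- p-th powers of generators -/
def bpK (j : Fin r) : LK p B J := ⟨β j ^ p, pth_mem_LK B J _⟩

/-- derivations of the constants -/
def DK (i : X) : Module.End (ZMod p) (LK p B J) := Drestr (Dl (p := p) B) (Dl_der B) (Dl_comm B x hx hB) Jᶜ i

include hcF hgen hc hx hB hxc in
lemma hN_K (u : LK p B J) : u ∈ AddSubgroup.closure (Nset (lFK B J hFJ) (bpK β B J) (DK B x J hx hB) c) := by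
  have h1 := mem_NE_closure β c B x J hc hx hB hxc hgen u ((mem_LK B J _).1 u.2)
  let φ : LK p B J →+ E := (LK p B J).val.toLinearMap.toAddMonoidHom
  have h2 : AddSubgroup.closure (NE (Dl (p := p) B) (Dl_der B) β c : Set E) ≤ 
    (AddSubgroup.closure (Nset (lFK B J hFJ) (bpK β B J) (DK B x J hx hB) c)).map φ := by
    rw [AddSubgroup.closure_le]
    rintro z ⟨w, s, v, h1, h2, h3, h4⟩
    have hz : (((∏ j, bpK β B J j ^ w j) * lFK B J hFJ s : LK p B J) : E) = z := by
      rw [h2]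
      push_cast
      rfl
    refine ⟨(∏ j, bpK β B J j ^ w j) * lFK B J hFJ s, AddSubgroup.subset_closure ⟨w, s, v, h1, rfl, h3, fun i => ?_⟩, hz⟩
    apply Subtype.ext
    refine (Drestr_coe _ _ (Dl_comm B x hx hB) _ _ _).trans ?_
    rw [hz, h4, ← hz]; push_cast; rfl
  obtain ⟨u', h3, h4⟩ := h2 h1
  rwa [← Subtype.ext h4]

lemma lift_ringHom {A B C : Type*} [Ring A] [Field B] [Ring C] [Nontrivial C] (f : A →+* C) (g : B →+* C)
    (h : ∀ a, ∃ y, g y = f a) : ∃ ρ : A →+* B, ∀ a, g (ρ a) = f a := by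
  choose ρ hρ using h
  have hi := g.injective
  exact ⟨{
    toFun := ρ
    map_one' := hi (by rw [hρ, map_one, map_one])
    map_zero' := hi (by rw [hρ, map_zero f, map_zero g])
    map_mul' := fun a b => hi (by rw [hρ, map_mul, map_mul, hρ, hρ])
    map_add' := fun a b => hi (by rw [hρ, map_add, map_add, hρ, hρ]) }, hρ⟩

variable {b : Fin r → F} {m : Fin r → ℕ} (hm : ∀ j, 1 ≤ m j) (hβ : ∀ i, β i ^ p ^ m i = algebraMap F E (b i))

include hm hβ in
lemma beta_pow (j : Fin r) : (β j ^ p) ^ p ^ (Finset.univ.sup m - 1) = algebraMap F E (b j ^ p ^ (Finset.univ.sup m - m j)) := by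
  have hme : m j ≤ Finset.univ.sup m := Finset.le_sup (f := m) (Finset.mem_univ j)
  have := hm j
  rw [map_pow, ← hβ, ← pow_mul, ← pow_mul, ← pow_succ', ← pow_add]
  congr 2; omega

include hcF hgen hc hx hB hxc hm hβ in
lemma exists_rho : ∃ ρ : LK p B J →+* F, (∀ a, ρ (lFK B J hFJ a) = a ^ p ^ (Finset.univ.sup m - 1)) ∧
    ∀ j, ρ (bpK β B J j) = b j ^ p ^ (Finset.univ.sup m - m j) := by
  haveI : CharP E p := charP_of_alg
  let f : LK p B J →+* E := (iterateFrobenius E p (Finset.univ.sup m - 1)).comp (LK p B J).val.toRingHom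
  have hf : ∀ a, f a = (a : E) ^ p ^ (Finset.univ.sup m - 1) := fun a => rfl
  have key : ∀ a, a ∈ (algebraMap F E).range.toAddSubgroup.comap (f : LK p B J →+ E) := by
    intro a
    refine (AddSubgroup.closure_le _).2 ?_ (hN_K β c B x J hc hx hB hxc hFJ hgen a)
    rintro z ⟨w, s, v, h1, h2, h3, h4⟩
    refine ⟨(∏ j, (b j ^ p ^ (Finset.univ.sup m - m j)) ^ w j) * s ^ p ^ (Finset.univ.sup m - 1), ?_⟩
    change _ = f z
    rw [h2, map_mul, map_mul, map_prod, map_prod]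
    congr 1
    · refine Finset.prod_congr rfl fun j _ => ?_
      rw [map_pow (algebraMap F E) _ (w j), map_pow f, ← beta_pow β hm hβ j]; rfl
    · rw [map_pow]; rfl
  obtain ⟨ρ, hρ⟩ := lift_ringHom f (algebraMap F E) key
  refine ⟨ρ, fun a => ?_, fun j => ?_⟩
  · apply (algebraMap F E).injective
    rw [hρ, map_pow]; rfl
  · apply (algebraMap F E).injective
    rw [hρ, ← beta_pow β hm hβ j]; rfl
end NSpan2


section Assemble
universe u v
variable {X : Type*} [LinearOrder X]
variable {p : ℕ} [hpF : Fact p.Prime] {E : Type u} [Field E] [Algebra (ZMod p) E]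
variable {F : Type v} [Field F] [Algebra F E] [hcF : CharP F p]
variable {SF : DiffStr p F} {SE : DiffStr p E} (R : DiffRes p F E SF SE)

omit hpF [Algebra (ZMod p) E] hcF in
lemma res_dLog (a : F) : R.res (dLog F a) = dLog E (algebraMap F E a) := by
  rw [dLog_eq, dLog_eq, R.res_smul, R.res_dForm, map_inv₀]

omit hpF [Algebra (ZMod p) E] hcF in
lemma res_logL (y : List F) : R.res (logL y) = logL (y.map (algebraMap F E)) := by
  induction y with
  | nil => simp [logL_nil, R.res_one]
  | cons a y ih => rw [logL_cons, R.res_mul, res_dLog, ih, List.map_cons, logL_cons]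

variable {r : ℕ} (β : Fin r → E) (c : X → F)
variable (B : Module.Basis X E (KaehlerDifferential ℤ E)) (x : X → E) (J : Set X)
   (hc : ∀ i, c i ≠ 0) (hx : ∀ i, x i ≠ 0) (hB : ∀ l, B l = (x l)⁻¹ • KaehlerDifferential.D ℤ E (x l))
   (hxc : ∀ i, i ∉ J → x i = algebraMap F E (c i))
   (hFJ : ∀ a : F, ∀ j ∈ J, B.repr (KaehlerDifferential.D ℤ E (algebraMap F E a)) j = 0)
   (hgen : Algebra.adjoin F (Set.range β) = ⊤)

lemma DK_coe (i : X) (a : LK p B J) : ((DK B x J hx hB i a : LK p B J) : E) = Dl (p := p) B i a := rfl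

lemma lFK_coe (a : F) : ((lFK B J hFJ a : LK p B J) : E) = algebraMap F E a := rfl

lemma DK_J (i : X) (hi : i ∈ J) (a : LK p B J) : DK B x J hx hB i a = 0 :=
  Subtype.ext ((mem_LK B J _).1 a.2 i hi)

include R in
lemma Pcoord_coe (y : List F) (S : Finset X) :
    ((Pcoord (lFK B J hFJ) (DK B x J hx hB) y S : LK p B J) : E) = phi B (R.res (logL y)) S := by
  induction y generalizing S with
  | nil =>
    rw [logL_nil, R.res_one, phi_one]
    simp only [Pcoord]
    split_ifs <;> rfl
  | cons a y ih =>
    rw [logL_cons, R.res_mul, res_dLog, phi_dLog (p := p)]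
    simp only [Pcoord, wdg, ← ih]
    push_cast
    refine Finset.sum_congr rfl fun i _ => ?_
    rw [DK_coe, lFK_coe]

lemma Pcoord_J (y : List F) (S : Finset X) (hS : ∃ j ∈ S, j ∈ J) :
    Pcoord (lFK B J hFJ) (DK B x J hx hB) y S = 0 := by
  obtain ⟨j, hj, hjJ⟩ := hS
  induction y generalizing S with
  | nil =>
    simp only [Pcoord]
    rw [if_neg]
    rintro rfl; simp at hj
  | cons a y ih =>
    simp only [Pcoord, wdg]
    refine Finset.sum_eq_zero fun i _ => ?_
    by_cases hi : i = j
    · subst hi; rw [DK_J B x J hx hB i hjJ]; simp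
    · rw [ih (S.erase i) (Finset.mem_erase.2 ⟨Ne.symm hi, hj⟩)]; simp

variable {b : Fin r → F} {m : Fin r → ℕ} (hb : ∀ j, b j ≠ 0)
  (hm : ∀ j, 1 ≤ m j) (hβ : ∀ i, β i ^ p ^ m i = algebraMap F E (b i))
  (ρ : LK p B J →+* F) (hρ : ∀ a, ρ (lFK B J hFJ a) = a ^ p ^ (Finset.univ.sup m - 1))
  (hρb : ∀ j, ρ (bpK β B J j) = b j ^ p ^ (Finset.univ.sup m - m j))

lemma list_fin (y : List F) : ∃ U : Finset X, ∀ a ∈ y, ∀ i ∉ U, Dl (p := p) B i (algebraMap F E a) = 0 := by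
  induction y with
  | nil => exact ⟨∅, by simp⟩
  | cons a y ih =>
    obtain ⟨U, hU⟩ := ih
    obtain ⟨U', hU'⟩ := Dl_fin (p := p) B (algebraMap F E a)
    refine ⟨U ∪ U', fun z hz i hi => ?_⟩
    rw [Finset.mem_union, not_or] at hi
    rcases List.mem_cons.1 hz with rfl | hz
    · exact hU' i hi.2
    · exact hU z hz i hi.1

include R hcF hc hx hB hxc hgen hb hm hρ hρb in
lemma omega_coords {n : ℕ} (ω : DF F) (hω : ω ∈ omegaPow F (n+1)) :
    ∃ f : Finset X → LK p B J, (∀ S, (f S : E) = phi B (R.res ω) S) ∧ (∀ S : Finset X, (∃ j ∈ S, j ∈ J) → f S = 0) ∧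
      ∃ U0 : Finset X, ∀ U, U0 ⊆ U → ω - Psi c ρ U (n+1) f ∈ Ggrp SF b m n := by
  refine omega_induction (n := n+1) (fun ω => ∃ f : Finset X → LK p B J, (∀ S, (f S : E) = phi B (R.res ω) S) ∧ (∀ S : Finset X, (∃ j ∈ S, j ∈ J) → f S = 0) ∧
      ∃ U0 : Finset X, ∀ U, U0 ⊆ U → ω - Psi c ρ U (n+1) f ∈ Ggrp SF b m n) ?_ ?_ ?_ ω hω
  · exact ⟨0, by simp, by simp, ∅, fun U _ => by simp [Psi]⟩
  · rintro w w' ⟨f, h1, h2, U, h3⟩ ⟨f', h1', h2', U', h3'⟩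
    refine ⟨f + f', fun S => ?_, fun S hS => ?_, U ∪ U', fun V hV => ?_⟩
    · rw [map_add, map_add, Pi.add_apply, Pi.add_apply, ← h1, ← h1']; rfl
    · rw [Pi.add_apply, h2 S hS, h2' S hS, add_zero]
    · have := add_mem (h3 V (Finset.union_subset_left hV)) (h3' V (Finset.union_subset_right hV))
      convert this using 1
      rw [Psi_add]; abel
  · intro a y hy
    obtain ⟨U0, hU0⟩ := list_fin (p := p) (E := E) B (List.ofFn y)
    refine ⟨fun S => lFK B J hFJ a * Pcoord (lFK B J hFJ) (DK B x J hx hB) (List.ofFn y) S, fun S => ?_, fun S hS => ?_,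
      U0, fun U hU => ?_⟩
    · rw [logForm_eq_logL, R.res_smul, map_smul, Pi.smul_apply, ← Pcoord_coe R B x J hx hB hFJ]; rfl
    · beta_reduce
      rw [Pcoord_J B x J hx hB hFJ _ S hS, mul_zero]
    · rw [logForm_eq_logL]
      refine Psi_log SF (lFK B J hFJ) (bpK β B J) ρ (DK B x J hx hB) c hb hm hρ hρb
        (hN_K β c B x J hc hx hB hxc hFJ hgen) hc _ (by simp) U (fun z hz => ?_) (fun z hz i hi => ?_) a
      · obtain ⟨i, rfl⟩ := List.mem_ofFn.1 hz; exact hy i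
      · exact Subtype.ext (hU0 z hz i (fun h => hi (hU h)))

include R hcF hc hx hB hxc hgen hb hm hρ hρb hFJ in
theorem forward_aux (hJ : ∀ i j, i ∉ J → j ∈ J → i < j) {n : ℕ} (ω : DF F) (hω : ω ∈ omegaPow F (n+1))
    (h : R.res ω ∈ hRel SE (n+1)) : ω ∈ Ggrp SF b m n := by
  obtain ⟨f, hf1, hf2, U0, hU0⟩ := omega_coords R β c B x J hc hx hB hxc hFJ hgen hb hm ρ hρ hρb ω hω
  obtain ⟨θ, η, ⟨U1, h1⟩, ⟨U2, h2⟩, heq⟩ := phi_hRel B x hx hB SE (R.res ω) h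
  obtain ⟨U3, h3⟩ := phi_nice (p := p) B x hx hB (R.res ω) (R.res_grade _ ω hω)
  let U := U1 ∪ U2 ∪ U3
  have hDx : ∀ i, Dl (p := p) B i (x i) = x i := fun i => by rw [Dl_x B x hx hB, if_pos rfl]
  have hDx' : ∀ i j, i ≠ j → Dl (p := p) B i (x j) = 0 := fun i j hij => by rw [Dl_x B x hx hB, if_neg hij]
  have hU1 : U1 ⊆ U := fun i hi => Finset.mem_union_left _ (Finset.mem_union_left _ hi)
  have hU2 : U2 ⊆ U := fun i hi => Finset.mem_union_left _ (Finset.mem_union_right _ hi)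
  have hU3 : U3 ⊆ U := fun i hi => Finset.mem_union_right _ hi
  obtain ⟨θ', g, k1, k2, k3, k4, k5, k6, k7⟩ := core_inf (Dl (p := p) B) (Dl_der B) (Dl_comm B x hx hB) (Dl_pow B x hx hB)
    x hx hDx hDx' J hJ U (phi B (R.res ω)) θ η
    (fun S hS => by rw [← hf1, hf2 S hS]; rfl)
    (fun j hj S => by rw [← hf1]; exact (mem_LK B J _).1 (f S).2 j hj)
    (fun S hS => (h3 S).1 fun h => hS (h.trans hU3))
    (fun S l hl => (h3 S).2 l fun h => hl (hU3 h))
    (fun S l hl => (h1 S).2 l fun h => hl (hU1 h))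
    (fun S l hl => (h2 S).2 l fun h => hl (hU2 h)) heq
  let θK : Finset X → LK p B J := fun S => ⟨θ' S, (mem_LK B J _).2 fun j hj => k2 j hj S⟩
  let gK : Finset X → LK p B J := fun S => ⟨g S, (mem_LK B J _).2 fun j hj => k4 j hj S⟩
  have hfe : f = (fun S => θK S ^ p - θK S) + dd (DK B x J hx hB) gK := by
    ext S
    rw [hf1, k7 S, Pi.add_apply, dd, dd]
    push_cast
    rfl
  choose V hV using fun S : Finset X => Dl_fin (p := p) B (g S)
  let W := U0 ∪ U.powerset.biUnion V
  have hW : ∀ S, ∀ i ∉ W, DK B x J hx hB i (gK S) = 0 := by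
    intro S i hi
    apply Subtype.ext
    change Dl (p := p) B i (g S) = 0
    by_cases hS : S ⊆ U
    · refine hV S i fun h => hi (Finset.mem_union_right _ (Finset.mem_biUnion.2 ⟨S, Finset.mem_powerset.2 hS, h⟩))
    · rw [k6 S hS, map_zero]
  have e1 := hU0 W Finset.subset_union_left
  rw [hfe, Psi_add] at e1
  have e2 := Psi_pth (n := n) (b := b) (m := m) SF ρ c θK W
  have e3 := Psi_dd (n := n) SF (lFK B J hFJ) (bpK β B J) ρ (DK B x J hx hB) c hb hm hρ hρb
        (hN_K β c B x J hc hx hB hxc hFJ hgen) hc gK W hW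
  have := add_mem e1 (add_mem e2 e3)
  rwa [sub_add_cancel] at this

end Assemble

section Forward
universe u v
variable {p : ℕ} [hpF : Fact p.Prime] {E : Type u} [Field E] [CharP E p]
variable {F : Type v} [Field F] [Algebra F E] [hcF : CharP F p]
variable {SF : DiffStr p F} {SE : DiffStr p E} (R : DiffRes p F E SF SE)
variable {r : ℕ} (β : Fin r → E) (hgen : Algebra.adjoin F (Set.range β) = ⊤)
 {b : Fin r → F} {m : Fin r → ℕ} (hb : ∀ j, b j ≠ 0)
  (hm : ∀ j, 1 ≤ m j) (hβ : ∀ i, β i ^ p ^ m i = algebraMap F E (b i))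

include R hgen hb hm hβ in
theorem forward_dir {n : ℕ} (ω : DF F) (hω : ω ∈ omegaPow F (n+1))
    (h : R.res ω ∈ hRel SE (n+1)) : ω ∈ Ggrp SF b m n := by
  letI : Algebra (ZMod p) E := ZMod.algebra E p
  obtain ⟨X, ord, B, x, J, c, hc, hx, hB, hxc, -, hJ, hFJ⟩ := exists_basis F E
  obtain ⟨ρ, hρ, hρb⟩ := exists_rho (p := p) β c B x J hc hx hB hxc hFJ hgen hm hβ
  exact forward_aux R β c B x J hc hx hB hxc hFJ hgen hb hm ρ hρ hρb hJ ω hω h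
end Forward


section Easy
universe u v
variable {p : ℕ} [hpF : Fact p.Prime] {E : Type u} [Field E] [hcE : CharP E p]
variable {F : Type v} [Field F] [Algebra F E] [hcF : CharP F p]
variable {SF : DiffStr p F} {SE : DiffStr p E} (R : DiffRes p F E SF SE)

omit hpF hcE hcF in
lemma res_pred (n : ℕ) (η : DF F) (hη : η ∈ omegaPred F n) : R.res η ∈ omegaPred E n := by
  cases n with
  | zero =>
    have : η = 0 := hη
    rw [this, map_zero]; exact zero_mem _
  | succ n => exact R.res_grade n η hη

omit hpF hcE hcF in
lemma res_asMap {n : ℕ} (ω : DF F) (hω : ω ∈ omegaPow F n) : R.res (asMap SF ω) ∈ hRel SE n := by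
  refine omega_induction (n := n) (fun ω => R.res (asMap SF ω) ∈ hRel SE n) ?_ ?_ ?_ ω hω
  · rw [map_zero, map_zero]; exact zero_mem _
  · intro a b ha hb; rw [map_add, map_add]; exact add_mem ha hb
  · intro a y _
    obtain ⟨η, hη, h⟩ := SF.sp_log n a y
    have h2 : asMap SF (a • logForm F y) = SF.sp (a • logForm F y) - a • logForm F y := rfl
    rw [h2, h, logForm_eq_logL, map_sub, map_add, R.res_smul, R.res_smul, R.res_d, res_logL, map_pow, add_sub_right_comm]
    refine add_mem (pth_mem SE n _ (by simp) _) ?_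
    exact AddSubgroup.mem_sup_right ⟨R.res η, res_pred R n η hη, rfl⟩

omit hpF hcE hcF in
lemma res_hRel {n : ℕ} (ω : DF F) (hω : ω ∈ hRel SF n) : R.res ω ∈ hRel SE n := by
  obtain ⟨_, ⟨z, hz, rfl⟩, _, ⟨w, hw, rfl⟩, rfl⟩ := AddSubgroup.mem_sup.1 hω
  rw [map_add, R.res_d]
  exact add_mem (res_asMap R z hz) (AddSubgroup.mem_sup_right ⟨R.res w, res_pred R n w hw, rfl⟩)

include hcE in
lemma easy_exact {n : ℕ} (l : List E) (hl : l.length = n) (h0 : ∀ a ∈ l, a ≠ 0) (c s : E) (hc : c ≠ 0) (hs : s ≠ 0) :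
    (c ^ p * s) • (dLog E s * logL l) ∈ hRel SE (n+1) := by
  have h1 : (c ^ p * s) • (dLog E s * logL l) = dForm E (c ^ p * s) * logL l := by
    rw [← smul_dLog _ (mul_ne_zero (pow_ne_zero p hc) hs), dLog_mul _ _ (pow_ne_zero p hc) hs, dLog_pth, zero_add,
      smul_mul_assoc]
  rw [h1]
  exact exact_mem SE n l hl h0 _

variable {r : ℕ} (β : Fin r → E) {b : Fin r → F} {m : Fin r → ℕ} (hb : ∀ j, b j ≠ 0)
  (hm : ∀ j, 1 ≤ m j) (hβ : ∀ i, β i ^ p ^ m i = algebraMap F E (b i))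

omit hpF hcE hcF in
lemma res_gen {n : ℕ} (y : Fin (n+1) → F) (hy : ∀ i, y i ≠ 0) : ∃ l : List E, l.length = n ∧ (∀ a ∈ l, a ≠ 0) ∧
    R.res (logForm F y) = dLog E (algebraMap F E (y 0)) * logL l := by
  refine ⟨(List.ofFn (fun i : Fin n => y i.succ)).map (algebraMap F E), by simp, ?_, ?_⟩
  · intro a ha
    obtain ⟨z, hz, rfl⟩ := List.mem_map.1 ha
    obtain ⟨i, rfl⟩ := List.mem_ofFn.1 hz
    simpa using hy i.succ
  · rw [logForm_succ, R.res_mul, res_dLog, logForm_eq_logL, res_logL]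

include hb hm hβ hcE R in
theorem backward_dir {n : ℕ} (ω : DF F) (hω : ω ∈ Ggrp SF b m n) : R.res ω ∈ hRel SE (n+1) := by
  have hp := hpF.out
  have hβ0 : ∀ j, β j ≠ 0 := by
    intro j h
    have := hβ j
    rw [h, zero_pow (pow_ne_zero _ hp.ne_zero)] at this
    exact hb j ((map_eq_zero (algebraMap F E)).1 this.symm)
  have : Ggrp SF b m n ≤ (hRel SE (n+1)).comap R.res := by
    unfold Ggrp
    rw [AddSubgroup.closure_le]
    rintro w ((hw | ⟨j, y, hy, rfl⟩) | ⟨t, k, y, ht, ht', hk, hy, rfl⟩)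
    · exact res_hRel R w hw
    · change R.res _ ∈ hRel SE (n+1)
      obtain ⟨l, hl, h0, e⟩ := res_gen R y hy
      have e2 : algebraMap F E (b j * y 0) = (β j ^ p ^ (m j - 1)) ^ p * algebraMap F E (y 0) := by
        rw [map_mul, ← hβ j, ← pow_mul, ← pow_succ, Nat.sub_add_cancel (hm j)]
      rw [R.res_smul, e, e2]
      exact easy_exact l hl h0 _ _ (pow_ne_zero _ (hβ0 j)) (by simpa using hy 0)
    · change R.res _ ∈ hRel SE (n+1)
      obtain ⟨l, hl, h0, e⟩ := res_gen R y hy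
      choose k' hk' using fun j => (hk j).2
      let C : E := ∏ j, β j ^ (p ^ (m j + (t + 1 - m j) - (t + 1)) * k' j)
      have hC : C ≠ 0 := Finset.prod_ne_zero_iff.2 fun j _ => pow_ne_zero _ (hβ0 j)
      have e2 : algebraMap F E ((∏ j, b j ^ k j) * y 0 ^ p ^ t) = (C ^ p * algebraMap F E (y 0)) ^ p ^ t := by
        rw [map_mul, map_prod, mul_pow, map_pow, ← pow_mul, ← Finset.prod_pow]
        congr 1
        refine Finset.prod_congr rfl fun j _ => ?_
        rw [map_pow, ← hβ j, ← pow_mul, ← pow_mul, ← pow_succ']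
        congr 1
        rw [hk' j, mul_right_comm, ← mul_assoc, ← pow_add, ← pow_add]
        congr 2
        omega
      have hs : algebraMap F E (y 0) ≠ 0 := by simpa using hy 0
      rw [R.res_smul, e, e2]
      have h1 := ppow_mem SE (n+1) (algebraMap F E (y 0) :: l) (by simp [hl]) (C ^ p * algebraMap F E (y 0)) t
      have h2 := easy_exact (SE := SE) l hl h0 C _ hC hs
      rw [logL_cons] at h1
      have := add_mem h1 h2
      rwa [sub_add_cancel] at this
  exact this hω

omit hpF hcF in
lemma omega_zero (ω : DF F) (hω : ω ∈ omegaPow F 0) : ∃ a : F, ω = a • (1 : DF F) := by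
  unfold omegaPow at hω
  rw [pow_zero] at hω
  obtain ⟨a, rfl⟩ := Submodule.mem_one.1 hω
  exact ⟨a, Algebra.algebraMap_eq_smul_one a⟩

omit hpF hcF in
lemma hRel_zero (ω : DF F) (hω : ω ∈ hRel SF 0) : ∃ a : F, ω = (a ^ p - a) • (1 : DF F) := by
  obtain ⟨_, ⟨z, hz, rfl⟩, _, ⟨w, hw, rfl⟩, rfl⟩ := AddSubgroup.mem_sup.1 hω
  obtain ⟨a, rfl⟩ := omega_zero z hz
  have hw0 : w = 0 := hw
  refine ⟨a, ?_⟩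
  obtain ⟨η, hη, h⟩ := SF.sp_log 0 a Fin.elim0
  have hη0 : η = 0 := hη
  have h1 : logForm F (Fin.elim0 : Fin 0 → F) = 1 := by simp [logForm]
  rw [h1, hη0, map_zero, add_zero] at h
  have h2 : asMap SF (a • (1 : DF F)) = SF.sp (a • (1 : DF F)) - a • (1 : DF F) := rfl
  rw [hw0, map_zero, add_zero, h2, h, sub_smul]

include hcE hβ in
lemma pow_mem_base (hgen : Algebra.adjoin F (Set.range β) = ⊤) (g : E) :
    ∃ s : F, g ^ p ^ (Finset.univ.sup m) = algebraMap F E s := by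
  have hg : g ∈ Algebra.adjoin F (Set.range β) := by rw [hgen]; trivial
  induction hg using Algebra.adjoin_induction with
  | mem g hg =>
    obtain ⟨j, rfl⟩ := hg
    have hj : m j ≤ Finset.univ.sup m := Finset.le_sup (Finset.mem_univ j)
    refine ⟨b j ^ p ^ (Finset.univ.sup m - m j), ?_⟩
    rw [map_pow, ← hβ j, ← pow_mul, ← pow_add, Nat.add_sub_cancel' hj]
  | algebraMap a => exact ⟨a ^ p ^ (Finset.univ.sup m), by rw [map_pow]⟩
  | add g h _ _ hg hh =>
    obtain ⟨s, hs⟩ := hg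
    obtain ⟨t, ht⟩ := hh
    exact ⟨s + t, by rw [add_pow_char_pow, hs, ht, map_add]⟩
  | mul g h _ _ hg hh =>
    obtain ⟨s, hs⟩ := hg
    obtain ⟨t, ht⟩ := hh
    exact ⟨s * t, by rw [mul_pow, hs, ht, map_mul]⟩

include hcE hβ R in
lemma zero_dir (hgen : Algebra.adjoin F (Set.range β) = ⊤) (ω : DF F) (hω : ω ∈ omegaPow F 0)
    (h : R.res ω ∈ hRel SE 0) : ω ∈ hRel SF 0 := by
  obtain ⟨a, rfl⟩ := omega_zero ω hω
  obtain ⟨t, ht⟩ := hRel_zero _ h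
  rw [R.res_smul, R.res_one] at ht
  have h1 : algebraMap F E a = t ^ p - t := smul_left_injective E (one_ne_zero (α := DF E)) ht
  have h2 : ∀ k : ℕ, ∃ s : F, t ^ p ^ k = algebraMap F E s + t := by
    intro k
    induction k with
    | zero => exact ⟨0, by simp⟩
    | succ k ih =>
      obtain ⟨s, hs⟩ := ih
      refine ⟨s ^ p + a, ?_⟩
      rw [pow_succ, pow_mul, hs, add_pow_char, map_add, map_pow, h1]
      ring
  obtain ⟨s, hs⟩ := h2 (Finset.univ.sup m)
  obtain ⟨s', hs'⟩ := pow_mem_base β hβ hgen t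
  have h3 : t = algebraMap F E (s' - s) := by
    rw [map_sub, ← hs', hs]; ring
  have h4 : a = (s' - s) ^ p - (s' - s) := by
    apply (algebraMap F E).injective
    rw [h1, h3, map_sub _ (_ ^ p), map_pow]
  have := pth_mem SF 0 [] rfl (s' - s)
  rw [logL_nil, ← sub_smul, ← h4] at this
  exact this

end Easy

/-- **Corollary 101.** Let `E = F(b₁^{1/p^{m₁}},…,b_r^{1/p^{m_r}})` be purely inseparable
of exponent `e = max{m₁,…,m_r}` with `bᵢ ∈ F∖F^p`, `mᵢ ≥ 1`. For `n ≥ 1` (below: degree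
`n+1`), the kernel `H_p^{n+1}(E/F)` is additively generated by
(i) `bⱼ·s·(ds/s)∧(da₂/a₂)∧…∧(daₙ/aₙ)` with `s, a₂,…,aₙ ∈ F^*`, and
(ii) `b₁^{k(t,1)}⋯b_r^{k(t,r)}·s^{p^t}·(ds/s)∧(da₂/a₂)∧…∧(daₙ/aₙ)` with `s, aᵢ ∈ F^*`,
`t = 1,…,e−1`, `0 ≤ k(t,j) ≤ p^t−1` and `max{1, p^{t−mⱼ+1}} ∣ k(t,j)`.
For `n = 0`, `H_p^1(E/F) = {0}`. -/
theorem hKernel_logarithmic_generators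
    (p : ℕ) (hp : p.Prime) (F E : Type*) [Field F] [Field E] [Algebra F E]
    [CharP F p] [CharP E p]
    (SF : DiffStr p F) (SE : DiffStr p E) (R : DiffRes p F E SF SE)
    (r : ℕ) (b : Fin r → F) (m : Fin r → ℕ)
    (hb : ∀ i, ¬ ∃ y : F, y ^ p = b i) (hm : ∀ i, 1 ≤ m i)
    (β : Fin r → E) (hβ : ∀ i, β i ^ p ^ m i = algebraMap F E (b i))
    (hgen : Algebra.adjoin F (Set.range β) = ⊤) :
    (∀ n : ℕ, ∀ ω ∈ omegaPow F (n + 1),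
      (R.res ω ∈ hRel SE (n + 1) ↔
        ω ∈ AddSubgroup.closure ((hRel SF (n + 1) : Set (DF F)) ∪
          { x | ∃ (j : Fin r) (y : Fin (n + 1) → F), (∀ i, y i ≠ 0) ∧
              x = (b j * y 0) • logForm F y } ∪
          { x | ∃ (t : ℕ) (k : Fin r → ℕ) (y : Fin (n + 1) → F),
              0 < t ∧ t < Finset.univ.sup m ∧
              (∀ j, k j < p ^ t ∧ p ^ (t + 1 - m j) ∣ k j) ∧ (∀ i, y i ≠ 0) ∧
              x = ((∏ j, b j ^ k j) * y 0 ^ p ^ t) • logForm F y }))) ∧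
    (∀ ω ∈ omegaPow F 0, (R.res ω ∈ hRel SE 0 ↔ ω ∈ hRel SF 0)) := by
  haveI : Fact p.Prime := ⟨hp⟩
  have hb0 : ∀ j, b j ≠ 0 := fun j h => hb j ⟨0, by rw [h, zero_pow hp.ne_zero]⟩
  refine ⟨fun n ω hω => ⟨fun h => forward_dir R β hgen hb0 hm hβ ω hω h,
    fun h => backward_dir R β hb0 hm hβ ω h⟩, fun ω hω => ⟨fun h => ?_, fun h => res_hRel R ω h⟩⟩
  exact zero_dir R β hβ hgen ω hω h
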